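/- Fix i ∈ {1,2}. For every α ∈ (0,9) and every ε ∈ (0, 10^{−10}α) there exist constants N_ε, C_ε ≥ 1 depending only on ε, and an absolute constant E ≥ 1, such that the following holds. Let δ ∈ (0,1), Υ > 0, and let F ⊆ B^{𝔯ᵢ}_1(0) be a finite set with #F ≥ N_ε satisfying 𝒢^{(α)}_{F,δ}(w) ≤ Υ for all w ∈ F. Then for every ℓ ≥ N_ε there is a subset J ⊆ 𝖡₁ᵁ with m_U(𝖡₁ᵁ ∖ J) ≤ C_ε·|log δ|·e^{−εℓ} such that for every u ∈ J there is F_u ⊆ F with #(F ∖ F_u) ≤ C_ε·|log δ|·e^{−εℓ}·#F and, for every w ∈ F_u, 𝒢^{(α)}_{F_u(w), δ'}((a_ℓ u).w) ≤ C_ε·e^{−φ(α)ℓ}·δ^{−E√ε}·Υ, where δ' = e^{2ℓ}·max{δ, (#F)^{−1/α}} and F_u(w) = {(a_ℓ u).w' : w' ∈ F_u, ‖(a_ℓ u).w' − (a_ℓ u).w‖ ≤ e^{−2ℓ}}. -/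

import Mathlib

open Matrix MeasureTheory
open scoped Classical

noncomputable section

abbrev M4 : Type := Matrix (Fin 4) (Fin 4) ℝ

/-- trace inner product ⟨X,Y⟩ = tr(XYᵀ) -/
def tinner (X Y : M4) : ℝ := (X * Yᵀ).trace

/-- sup norm: maximum absolute value of entries -/
def mnorm (X : M4) : ℝ := ⨆ p : Fin 4 × Fin 4, |X p.1 p.2|

/-- Euclidean (Frobenius) norm -/
def mnorm2 (X : M4) : ℝ := Real.sqrt (tinner X X)

/-- Gram matrices Q₁ (i=0) and Q₂ (i=1) -/
def Qmat (i : Fin 2) : M4 :=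
  if i = 0 then !![0,0,0,-(1/2); 0,0,1/2,0; 0,1/2,0,0; -(1/2),0,0,0]
  else !![0,0,0,-1; 0,1,0,0; 0,0,1,0; -1,0,0,0]

/-- 𝔰𝔩₄(ℝ) as a submodule of 4×4 matrices -/
def sl4 : Submodule ℝ M4 where
  carrier := {X | X.trace = 0}
  add_mem' := by
    intro a b ha hb
    simp only [Set.mem_setOf_eq] at *
    simp [Matrix.trace_add, ha, hb]
  zero_mem' := by simp
  smul_mem' := by
    intro c x hx
    simp only [Set.mem_setOf_eq] at *
    simp [Matrix.trace_smul, hx]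

/-- the involution σᵢ(X) = −QᵢXᵀQᵢ⁻¹ as a linear map -/
def sigmaMap (i : Fin 2) : M4 →ₗ[ℝ] M4 where
  toFun X := -(Qmat i * Xᵀ * (Qmat i)⁻¹)
  map_add' X Y := by
    simp [Matrix.transpose_add, add_mul, mul_add]; abel
  map_smul' c X := by
    simp [Matrix.transpose_smul, Matrix.smul_mul, Matrix.mul_smul]

/-- 𝔯ᵢ = {X ∈ 𝔰𝔩₄ : σᵢ(X) = −X} -/
def rSpace (i : Fin 2) : Submodule ℝ M4 :=
  sl4 ⊓ LinearMap.ker (sigmaMap i + (LinearMap.id : M4 →ₗ[ℝ] M4))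

/-- 𝔥ᵢ = {X ∈ 𝔰𝔩₄ : σᵢ(X) = X} -/
def hSpace (i : Fin 2) : Submodule ℝ M4 :=
  sl4 ⊓ LinearMap.ker (sigmaMap i - (LinearMap.id : M4 →ₗ[ℝ] M4))

/-- 𝐚 = diag(1,0,0,−1) -/
def aWt : M4 := Matrix.diagonal ![1,0,0,-1]

/-- ad(𝐚) = [𝐚, ·] -/
def adA : M4 →ₗ[ℝ] M4 where
  toFun X := aWt * X - X * aWt
  map_add' X Y := by simp [mul_add, add_mul]; abel
  map_smul' c X := by simp [Matrix.mul_smul, Matrix.smul_mul, smul_sub]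

/-- weight space (𝔯ᵢ)_λ -/
def wSpace (i : Fin 2) (lam : ℤ) : Submodule ℝ M4 :=
  rSpace i ⊓ LinearMap.ker (adA - (lam : ℝ) • (LinearMap.id : M4 →ₗ[ℝ] M4))

/-- 𝔯ᵢ^{(λ)} = ⊕_{μ ≥ λ} (𝔯ᵢ)_μ -/
def rUp (i : Fin 2) (lam : ℤ) : Submodule ℝ M4 :=
  ⨆ (μ : ℤ) (_ : lam ≤ μ), wSpace i μ

/-- a_t = diag(e^t, 1, 1, e^{−t}) -/
def aMat (t : ℝ) : M4 := Matrix.diagonal ![Real.exp t, 1, 1, Real.exp (-t)]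

/-- the unipotent elements u^{(i)}_{r,s} -/
def uMat (i : Fin 2) (r s : ℝ) : M4 :=
  if i = 0 then !![1, r, s, s*r; 0,1,0,s; 0,0,1,r; 0,0,0,1]
  else !![1, r, s, (r^2+s^2)/2; 0,1,0,r; 0,0,1,s; 0,0,0,1]

/-- adjoint action g.X = gXg⁻¹ -/
def Adm (g X : M4) : M4 := g * X * g⁻¹

/-- adjoint action as a linear map -/
def AdLin (g : M4) : M4 →ₗ[ℝ] M4 where
  toFun X := g * X * g⁻¹
  map_add' X Y := by simp [mul_add, add_mul]
  map_smul' c X := by simp [Matrix.mul_smul, Matrix.smul_mul]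

/-- the parameter square [−1,1]² -/
def uSq : Set (ℝ × ℝ) := Set.Icc (-1 : ℝ) 1 ×ˢ Set.Icc (-1 : ℝ) 1

/-- m_U = (1/4)·(Lebesgue measure in the parameters) -/
def mU (S : Set (ℝ × ℝ)) : ENNReal := volume S / 4

/-- modified α-energy 𝒢^{(α)}_{F,δ}(w) -/
def energy (α δ : ℝ) (F : Finset M4) (w : M4) : ℝ :=
  ∑ w' ∈ F.erase w, (max (mnorm (w' - w)) δ) ^ (-α)

/-- φ(α) = (1/36)·min{(8/9)α, 1 − α/9} -/
def phiFn (α : ℝ) : ℝ := (1/36) * min ((8/9)*α) (1 - α/9)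

/-- δ-covering number by closed balls for the sup norm -/
def covNum (δ : ℝ) (A : Set M4) : ℕ :=
  sInf {n : ℕ | ∃ t : Finset M4, t.card = n ∧ A ⊆ ⋃ c ∈ t, {y : M4 | mnorm (y - c) ≤ δ}}

/-- orthonormal basis of a subspace, as a tuple -/
def IsONB {n : Type} [Fintype n] (v : n → M4) (V : Submodule ℝ M4) : Prop :=
  (∀ k, v k ∈ V) ∧ (∀ k l, tinner (v k) (v l) = if k = l then 1 else 0) ∧
    Submodule.span ℝ (Set.range v) = V

/-- Gram matrix of a tuple of vectors -/
def gram {n : Type} [Fintype n] (v : n → M4) : Matrix n n ℝ :=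
  Matrix.of fun a b => tinner (v a) (v b)

/-- weights λ₁,…,λ₅ = −2,…,2 -/
def lamOf : Fin 5 → ℤ := ![-2,-1,0,1,2]

/-- dimension differences 𝖽 = (1,2,3,2,1) -/
def dOf : Fin 5 → ℝ := ![1,2,3,2,1]

/-- Index of the atom of 𝒟^𝐫_ρ containing x, for an adapted orthonormal basis b with weights wt. -/
def atomIdx (b : Fin 9 → M4) (wt : Fin 9 → ℤ) (r : Fin 5 → ℝ) (ρ : ℝ) (x : M4) :
    Fin 5 → Fin 9 → ℤ :=
  fun j k => if lamOf j ≤ wt k then ⌊ tinner x (b k) / ρ ^ (r j) ⌋ else 0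

end

namespace Entropy

variable {Ω : Type*} [Fintype Ω]

/-- number of points equivalent to `a` -/
noncomputable def cls (s : Setoid Ω) (a : Ω) : ℕ := (Finset.univ.filter fun b => s a b).card

/-- average logarithmic size of the class of a point -/
noncomputable def K (s : Setoid Ω) : ℝ := (∑ a, Real.log (cls s a)) / Fintype.card Ω

lemma cls_pos (s : Setoid Ω) (a : Ω) : 0 < cls s a :=
  Finset.card_pos.mpr ⟨a, by simp⟩

lemma cls_mono {s t : Setoid Ω} (h : s ≤ t) (a : Ω) : cls s a ≤ cls t a :=
  Finset.card_le_card fun b hb => by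
    simp only [Finset.mem_filter, Finset.mem_univ, true_and] at hb ⊢
    exact h hb

lemma cls_congr {s : Setoid Ω} {a b : Ω} (h : s a b) : cls s a = cls s b := by
  unfold cls
  congr 1
  ext c
  simp only [Finset.mem_filter, Finset.mem_univ, true_and]
  exact ⟨fun hc => s.trans' (s.symm' h) hc, fun hc => s.trans' h hc⟩

lemma K_mono {s t : Setoid Ω} (h : s ≤ t) : K s ≤ K t := by
  unfold K
  gcongr with a
  · exact_mod_cast cls_pos s a
  · exact cls_mono h a

lemma supermod_count {F G H : Setoid Ω} (hF : F ≤ H) (hG : G ≤ H) :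
    ∑ a, ((cls F a : ℝ) * cls G a) / (cls (F ⊓ G) a * cls H a) ≤ Fintype.card Ω := by
  have e1 : ∀ a, ((cls F a : ℝ) * cls G a) / (cls (F ⊓ G) a * cls H a) =
      ∑ b, ∑ c, if F a b ∧ G a c then (1 : ℝ) / (cls (F ⊓ G) a * cls H a) else 0 := by
    intro a
    have : ((cls F a : ℝ) * cls G a) = ∑ b, ∑ c, if F a b ∧ G a c then (1 : ℝ) else 0 := by
      unfold cls
      rw [Finset.card_filter, Finset.card_filter]
      push_cast
      rw [Finset.sum_mul_sum]
      refine Finset.sum_congr rfl fun b _ => Finset.sum_congr rfl fun c _ => ?_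
      by_cases h1 : F a b <;> by_cases h2 : G a c <;> simp [h1, h2]
    rw [this, Finset.sum_div]
    refine Finset.sum_congr rfl fun b _ => ?_
    rw [Finset.sum_div]
    refine Finset.sum_congr rfl fun c _ => ?_
    split_ifs <;> simp
  simp_rw [e1]
  rw [Finset.sum_comm]
  have e2 : ∀ b, ∑ a, ∑ c, (if F a b ∧ G a c then (1 : ℝ) / (cls (F ⊓ G) a * cls H a) else 0)
      ≤ 1 := by
    intro b
    rw [Finset.sum_comm]
    have e3 : ∀ c, ∑ a, (if F a b ∧ G a c then (1 : ℝ) / (cls (F ⊓ G) a * cls H a) else 0)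
        ≤ if H b c then (1 : ℝ) / cls H b else 0 := by
      intro c
      by_cases hex : ∃ a, F a b ∧ G a c
      · obtain ⟨a₀, h1, h2⟩ := hex
        have hbc : H b c := H.trans' (H.symm' (hF h1)) (hG h2)
        rw [if_pos hbc]
        have : ∀ a, (if F a b ∧ G a c then (1 : ℝ) / (cls (F ⊓ G) a * cls H a) else 0)
            = if (F ⊓ G) a₀ a then (1 : ℝ) / (cls (F ⊓ G) a₀ * cls H b) else 0 := by
          intro a
          by_cases h : F a b ∧ G a c
          · have h' : (F ⊓ G) a₀ a :=
              ⟨F.trans' h1 (F.symm' h.1), G.trans' h2 (G.symm' h.2)⟩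
            rw [if_pos h, if_pos h', cls_congr h', cls_congr (hF h.1)]
          · have h' : ¬ (F ⊓ G) a₀ a := fun h' =>
              h ⟨F.trans' (F.symm' h'.1) h1, G.trans' (G.symm' h'.2) h2⟩
            rw [if_neg h, if_neg h']
        simp_rw [this]
        rw [← Finset.sum_filter, Finset.sum_const, nsmul_eq_mul]
        have hp : (0 : ℝ) < cls (F ⊓ G) a₀ := by exact_mod_cast cls_pos _ _
        have hq : (0 : ℝ) < cls H b := by exact_mod_cast cls_pos _ _
        change (cls (F ⊓ G) a₀ : ℝ) * _ ≤ _
        apply le_of_eq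
        field_simp
      · have : ∀ a, (if F a b ∧ G a c then (1 : ℝ) / (cls (F ⊓ G) a * cls H a) else 0) = 0 :=
          fun a => if_neg fun h => hex ⟨a, h⟩
        simp_rw [this]
        simp only [Finset.sum_const_zero]
        split_ifs <;> positivity
    calc _ ≤ ∑ c, (if H b c then (1 : ℝ) / cls H b else 0) :=
          Finset.sum_le_sum fun c _ => e3 c
      _ = 1 := by
          rw [← Finset.sum_filter, Finset.sum_const, nsmul_eq_mul]
          have hq : (0 : ℝ) < cls H b := by exact_mod_cast cls_pos _ _
          change (cls H b : ℝ) * _ = _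
          field_simp
  have e4 : ∀ b, ∑ a, ∑ c, (if F a b ∧ G a c then (1 : ℝ) / (cls (F ⊓ G) a * cls H a) else 0)
      = ∑ a, ∑ c, (if F a b ∧ G a c then (1 : ℝ) / (cls (F ⊓ G) a * cls H a) else 0) :=
    fun b => rfl
  calc _ ≤ ∑ _b : Ω, (1 : ℝ) := Finset.sum_le_sum fun b _ => e2 b
    _ = _ := by simp

lemma K_supermod {F G H : Setoid Ω} (hF : F ≤ H) (hG : G ≤ H) :
    K F + K G ≤ K (F ⊓ G) + K H := by
  have hle : ∑ a, (Real.log (cls F a) + Real.log (cls G a)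
      - Real.log (cls (F ⊓ G) a) - Real.log (cls H a)) ≤ 0 := by
    calc _ ≤ ∑ a, (((cls F a : ℝ) * cls G a) / (cls (F ⊓ G) a * cls H a) - 1) := by
          refine Finset.sum_le_sum fun a _ => ?_
          have h1 : (0 : ℝ) < cls F a := by exact_mod_cast cls_pos _ _
          have h2 : (0 : ℝ) < cls G a := by exact_mod_cast cls_pos _ _
          have h3 : (0 : ℝ) < cls (F ⊓ G) a := by exact_mod_cast cls_pos _ _
          have h4 : (0 : ℝ) < cls H a := by exact_mod_cast cls_pos _ _
          have := Real.log_le_sub_one_of_pos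
            (show (0 : ℝ) < ((cls F a : ℝ) * cls G a) / (cls (F ⊓ G) a * cls H a) by positivity)
          rw [Real.log_div (by positivity) (by positivity), Real.log_mul h1.ne' h2.ne',
            Real.log_mul h3.ne' h4.ne'] at this
          linarith
      _ ≤ 0 := by
          rw [Finset.sum_sub_distrib]
          have := supermod_count hF hG
          simp only [Finset.sum_const, Finset.card_univ, nsmul_eq_mul, mul_one]
          linarith
  unfold K
  rw [← add_div, ← add_div]
  simp only [Finset.sum_sub_distrib, Finset.sum_add_distrib] at hle
  exact div_le_div_of_nonneg_right (by linarith) (Nat.cast_nonneg _)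

/-- If every class of `s` meets at most `C` classes of `t`, then meeting with `t` loses at most
`log C`. -/
lemma K_le_inf [Nonempty Ω] {s : Setoid Ω} {β : Type*} (f : Ω → β) {C : ℝ}
    (hC : ∀ a, ((Finset.image f (Finset.univ.filter fun b => s a b)).card : ℝ) ≤ C) :
    K s ≤ K (s ⊓ Setoid.ker f) + Real.log C := by
  have hn : (0 : ℝ) < Fintype.card Ω := by exact_mod_cast Fintype.card_pos
  have hCpos : 0 < C := by
    obtain ⟨a⟩ := ‹Nonempty Ω›
    refine lt_of_lt_of_le ?_ (hC a)
    have hne : (Finset.univ.filter fun b => s a b).Nonempty := ⟨a, by simp⟩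
    exact_mod_cast Finset.card_pos.mpr (hne.image f)
  set t := s ⊓ Setoid.ker f with ht
  -- the sum of `cls s / cls t` counts classes
  have key : ∑ a, (cls s a : ℝ) / cls t a ≤ C * Fintype.card Ω := by
    have e1 : ∀ a, (cls s a : ℝ) / cls t a = ∑ b, if s b a then (1 : ℝ) / cls t a else 0 := by
      intro a
      rw [← Finset.sum_filter, Finset.sum_const, nsmul_eq_mul, mul_one_div]
      have : (Finset.univ.filter fun b => s b a) = Finset.univ.filter fun b => s a b := by
        ext b
        simp only [Finset.mem_filter, Finset.mem_univ, true_and]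
        exact ⟨s.symm', s.symm'⟩
      rw [this]
      rfl
    simp_rw [e1]
    rw [Finset.sum_comm]
    have e2 : ∀ b, ∑ a, (if s b a then (1 : ℝ) / cls t a else 0) ≤ C := by
      intro b
      rw [← Finset.sum_filter]
      rw [← Finset.sum_fiberwise_of_maps_to (g := f)
        (t := Finset.image f (Finset.univ.filter fun a => s b a))
        (fun x hx => Finset.mem_image_of_mem f hx)]
      calc _ ≤ ∑ y ∈ Finset.image f (Finset.univ.filter fun a => s b a), (1 : ℝ) := by
            refine Finset.sum_le_sum fun y hy => ?_
            obtain ⟨a₀, ha₀, rfl⟩ := Finset.mem_image.mp hy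
            simp only [Finset.mem_filter, Finset.mem_univ, true_and] at ha₀
            have hset : (Finset.univ.filter fun a => s b a).filter (fun a => f a = f a₀)
                = Finset.univ.filter fun a => t a₀ a := by
              ext a
              simp only [Finset.mem_filter, Finset.mem_univ, true_and]
              constructor
              · rintro ⟨h1, h2⟩
                exact ⟨s.trans' (s.symm' ha₀) h1, h2.symm⟩
              · rintro ⟨h1, h2⟩
                exact ⟨s.trans' ha₀ h1, h2.symm⟩
            rw [hset]
            have : ∀ a ∈ Finset.univ.filter (fun a => t a₀ a),
                (1 : ℝ) / cls t a = 1 / cls t a₀ := by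
              intro a ha
              rw [cls_congr (Finset.mem_filter.mp ha).2]
            rw [Finset.sum_congr rfl this, Finset.sum_const, nsmul_eq_mul]
            have hq : (0 : ℝ) < cls t a₀ := by exact_mod_cast cls_pos _ _
            change (cls t a₀ : ℝ) * _ ≤ _
            apply le_of_eq
            field_simp
        _ ≤ C := by simpa using hC b
    calc _ ≤ ∑ _b : Ω, C := Finset.sum_le_sum fun b _ => e2 b
      _ = _ := by simp [mul_comm]
  have hle : ∑ a, (Real.log (cls s a) - Real.log (cls t a) - Real.log C) ≤ 0 := by
    calc _ ≤ ∑ a, (((cls s a : ℝ) / cls t a) / C - 1) := by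
          refine Finset.sum_le_sum fun a _ => ?_
          have h1 : (0 : ℝ) < cls s a := by exact_mod_cast cls_pos _ _
          have h2 : (0 : ℝ) < cls t a := by exact_mod_cast cls_pos _ _
          have := Real.log_le_sub_one_of_pos
            (show (0 : ℝ) < ((cls s a : ℝ) / cls t a) / C by positivity)
          rw [Real.log_div (by positivity) (by positivity),
            Real.log_div (by positivity) (by positivity)] at this
          linarith
      _ ≤ 0 := by
          rw [Finset.sum_sub_distrib, ← Finset.sum_div]
          simp only [Finset.sum_const, Finset.card_univ, nsmul_eq_mul, mul_one]
          have : (∑ a, (cls s a : ℝ) / cls t a) / C ≤ Fintype.card Ω := by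
            rw [div_le_iff₀ hCpos]; linarith
          linarith
  simp only [Finset.sum_sub_distrib, Finset.sum_const, Finset.card_univ, nsmul_eq_mul] at hle
  unfold K
  rw [div_add' _ _ _ hn.ne', div_le_div_iff_of_pos_right hn]
  linarith

/-- Jensen's inequality: `K` is at most the logarithm of the normalised number of equivalent
pairs. -/
lemma K_le_log [Nonempty Ω] (s : Setoid Ω) {B : ℝ}
    (hB : (∑ a, (cls s a : ℝ)) ≤ B * Fintype.card Ω) : K s ≤ Real.log B := by
  have hn : (0 : ℝ) < Fintype.card Ω := by exact_mod_cast Fintype.card_pos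
  have hpos : (0 : ℝ) < ∑ a, (cls s a : ℝ) :=
    Finset.sum_pos (fun a _ => by exact_mod_cast cls_pos s a) Finset.univ_nonempty
  have hB0 : 0 < B := by
    by_contra h
    nlinarith [not_lt.mp h]
  have hle : ∑ a, (Real.log (cls s a) - Real.log B) ≤ 0 := by
    calc _ ≤ ∑ a, ((cls s a : ℝ) / B - 1) := by
          refine Finset.sum_le_sum fun a _ => ?_
          have h1 : (0 : ℝ) < cls s a := by exact_mod_cast cls_pos _ _
          have := Real.log_le_sub_one_of_pos (show (0 : ℝ) < (cls s a : ℝ) / B by positivity)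
          rw [Real.log_div h1.ne' hB0.ne'] at this
          linarith
      _ ≤ 0 := by
          rw [Finset.sum_sub_distrib, ← Finset.sum_div]
          simp only [Finset.sum_const, Finset.card_univ, nsmul_eq_mul, mul_one]
          have : (∑ a, (cls s a : ℝ)) / B ≤ Fintype.card Ω := by
            rw [div_le_iff₀ hB0]; linarith
          linarith
  simp only [Finset.sum_sub_distrib, Finset.sum_const, Finset.card_univ, nsmul_eq_mul] at hle
  unfold K
  rw [div_le_iff₀ hn]
  linarith

lemma K_top [Nonempty Ω] : K (⊤ : Setoid Ω) = Real.log (Fintype.card Ω) := by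
  have hn : (Fintype.card Ω : ℝ) ≠ 0 := by exact_mod_cast Fintype.card_ne_zero
  have : ∀ a : Ω, cls (⊤ : Setoid Ω) a = Fintype.card Ω := by
    intro a
    unfold cls
    rw [← Finset.card_univ]
    congr 1
    exact Finset.filter_true_of_mem fun b _ => trivial
  unfold K
  simp only [this, Finset.sum_const, Finset.card_univ, nsmul_eq_mul]
  field_simp

lemma log_card_sub_le_K [Nonempty Ω] {β : Type*} (f : Ω → β) {C : ℝ}
    (hC : ((Finset.image f Finset.univ).card : ℝ) ≤ C) :
    Real.log (Fintype.card Ω) - Real.log C ≤ K (Setoid.ker f) := by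
  have h := K_le_inf (s := (⊤ : Setoid Ω)) f (C := C) (fun a => by
    refine le_trans ?_ hC
    exact_mod_cast Finset.card_le_card (Finset.image_subset_image (Finset.filter_subset _ _)))
  rw [K_top, top_inf_eq] at h
  linarith

end Entropy

namespace Entropy

variable {Ω : Type*} [Fintype Ω] {ι κ : Type*} [Fintype ι] [Fintype κ]

/-- the partition according to the integer parts of the coordinates at the given scales -/
noncomputable def part (Y : Ω → ι → ℝ) (ρ : ι → ℝ) : Setoid Ω := Setoid.ker fun a m => ⌊Y a m / ρ m⌋

lemma part_le {Y : Ω → ι → ℝ} {ρ : ι → ℝ} (hρ : ∀ m, 0 < ρ m) {a b : Ω} (h : part Y ρ a b)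
    (m : ι) : |Y a m - Y b m| ≤ ρ m := by
  have h1 : ⌊Y a m / ρ m⌋ = ⌊Y b m / ρ m⌋ := congrFun h m
  have h2 := Int.abs_sub_lt_one_of_floor_eq_floor h1
  rw [← sub_div, abs_div, abs_of_pos (hρ m), div_lt_one (hρ m)] at h2
  exact h2.le

lemma card_floor_le {x : ℝ} {D : ℝ} (hD : 0 ≤ D) :
    ((Finset.Icc ⌊x - D⌋ ⌊x + D⌋).card : ℝ) ≤ 2 * D + 3 := by
  rw [Int.card_Icc]
  have h1 : (0 : ℤ) ≤ ⌊x + D⌋ + 1 - ⌊x - D⌋ := by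
    have : ⌊x - D⌋ ≤ ⌊x + D⌋ := Int.floor_le_floor (by linarith)
    linarith
  have h2 : ((⌊x + D⌋ + 1 - ⌊x - D⌋).toNat : ℝ) = ((⌊x + D⌋ + 1 - ⌊x - D⌋ : ℤ) : ℝ) := by
    exact_mod_cast congrArg (Int.cast : ℤ → ℝ) (Int.toNat_of_nonneg h1)
  rw [h2]
  push_cast
  have := Int.floor_le (x + D)
  have := Int.lt_floor_add_one (x - D)
  linarith

lemma K_le_part [Nonempty Ω] {s : Setoid Ω} {Y : Ω → ι → ℝ} {ρ : ι → ℝ} (hρ : ∀ m, 0 < ρ m)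
    {D : ℝ} (hD : 0 ≤ D) (h : ∀ a b, s a b → ∀ m, |Y a m - Y b m| ≤ D * ρ m) :
    K s ≤ K (s ⊓ part Y ρ) + Fintype.card ι * Real.log (2 * D + 3) := by
  rw [← Real.log_pow]
  refine K_le_inf (s := s) (fun a m => ⌊Y a m / ρ m⌋) fun a => ?_
  have hsub : Finset.image (fun a m => ⌊Y a m / ρ m⌋) (Finset.univ.filter fun b => s a b) ⊆
      Fintype.piFinset fun m => Finset.Icc ⌊Y a m / ρ m - D⌋ ⌊Y a m / ρ m + D⌋ := by
    intro v hv
    obtain ⟨b, hb, rfl⟩ := Finset.mem_image.mp hv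
    simp only [Finset.mem_filter, Finset.mem_univ, true_and] at hb
    rw [Fintype.mem_piFinset]
    intro m
    have h1 := abs_le.mp (h a b hb m)
    have h2 : Y a m / ρ m - D ≤ Y b m / ρ m := by
      rw [sub_le_iff_le_add, div_le_iff₀ (hρ m), add_mul, div_mul_cancel₀ _ (hρ m).ne']
      linarith
    have h3 : Y b m / ρ m ≤ Y a m / ρ m + D := by
      rw [div_le_iff₀ (hρ m), add_mul, div_mul_cancel₀ _ (hρ m).ne']
      linarith
    exact Finset.mem_Icc.mpr ⟨Int.floor_le_floor h2, Int.floor_le_floor h3⟩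
  calc _ ≤ (((Fintype.piFinset fun m =>
        Finset.Icc ⌊Y a m / ρ m - D⌋ ⌊Y a m / ρ m + D⌋).card : ℕ) : ℝ) := by
        rw [Nat.cast_le]
        convert Finset.card_le_card hsub
    _ ≤ _ := by
        rw [Fintype.card_piFinset]
        push_cast
        rw [← Finset.card_univ, ← Finset.prod_const]
        exact Finset.prod_le_prod (fun _ _ => Nat.cast_nonneg _) fun m _ => card_floor_le hD

/-- Transfer: if `s` controls `Y` at scale `ρ`, and `s ⊓ part Y ρ ≤ t`. -/
lemma K_le_of_part [Nonempty Ω] {s t : Setoid Ω} {Y : Ω → ι → ℝ} {ρ : ι → ℝ}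
    (hρ : ∀ m, 0 < ρ m) {D : ℝ} (hD : 0 ≤ D)
    (h : ∀ a b, s a b → ∀ m, |Y a m - Y b m| ≤ D * ρ m) (ht : s ⊓ part Y ρ ≤ t) :
    K s ≤ K t + Fintype.card ι * Real.log (2 * D + 3) :=
  (K_le_part hρ hD h).trans (add_le_add_left (K_mono ht) _)

lemma shearer_compl {k : Finset ι → ℝ} (hk : ∀ S T, k S + k T ≤ k (S ∪ T) + k (S ∩ T))
    (S : Finset ι) :
    ∑ p ∈ S, k {p}ᶜ + k Finset.univ ≤ k Sᶜ + S.card * k Finset.univ := by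
  induction S using Finset.induction_on with
  | empty => simp
  | insert p S hp ih =>
    rw [Finset.sum_insert hp, Finset.card_insert_of_notMem hp]
    have h := hk {p}ᶜ Sᶜ
    have h1 : ({p} : Finset ι)ᶜ ∪ Sᶜ = Finset.univ := by
      rw [← Finset.compl_inter, Finset.singleton_inter_of_notMem hp, Finset.compl_empty]
    have h2 : ({p} : Finset ι)ᶜ ∩ Sᶜ = (insert p S)ᶜ := by
      rw [← Finset.compl_union, ← Finset.insert_eq]
    rw [h1, h2] at h
    push_cast
    linarith

lemma shearer_single {k : Finset ι → ℝ} (hk : ∀ S T, k S + k T ≤ k (S ∪ T) + k (S ∩ T))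
    (S : Finset ι) :
    ∑ p ∈ S, k {p} + k ∅ ≤ k S + S.card * k ∅ := by
  induction S using Finset.induction_on with
  | empty => simp
  | insert p S hp ih =>
    rw [Finset.sum_insert hp, Finset.card_insert_of_notMem hp]
    have h := hk {p} S
    rw [Finset.singleton_inter_of_notMem hp, ← Finset.insert_eq] at h
    push_cast
    linarith

lemma supermod_inf (X : Setoid Ω) (β : ι → Setoid Ω) (S T : Finset ι) :
    K (X ⊓ S.inf β) + K (X ⊓ T.inf β) ≤ K (X ⊓ (S ∪ T).inf β) + K (X ⊓ (S ∩ T).inf β) := by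
  have h := K_supermod (F := X ⊓ S.inf β) (G := X ⊓ T.inf β) (H := X ⊓ (S ∩ T).inf β)
    (inf_le_inf_left _ (Finset.inf_mono Finset.inter_subset_left))
    (inf_le_inf_left _ (Finset.inf_mono Finset.inter_subset_right))
  rwa [← inf_inf_distrib_left, ← Finset.inf_union] at h

/-- Joint entropy bound for partitions controlling all but one block of a coordinate system. -/
lemma sum_K_blocks [Nonempty Ω] [Nonempty ι] {η : Type*} [Fintype η] (X : Setoid Ω)
    (Z : ι → Setoid Ω)
    (b : Ω → ι → κ → ℝ) (x : Ω → η → ℝ) {ρ D : ℝ} (hρ : 0 < ρ) (hD : 0 ≤ D)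
    (h1 : ∀ p a a', Z p a a' → ∀ q, q ≠ p → ∀ m, |b a q m - b a' q m| ≤ D * ρ)
    (h2 : ∀ a a', (∀ q m, |b a q m - b a' q m| ≤ ρ) → ∀ m, |x a m - x a' m| ≤ D * ρ) :
    ∑ p, K (X ⊓ Z p) ≤ K X + (Fintype.card ι - 1) * K (part x fun _ => ρ) +
      (Fintype.card ι * (Fintype.card ι * Fintype.card κ) +
        Fintype.card ι * Fintype.card η) * Real.log (2 * D + 3) := by
  have hlog : 0 ≤ Real.log (2 * D + 3) := Real.log_nonneg (by linarith)
  set β : ι → Setoid Ω := fun q => part (fun a m => b a q m) fun _ => ρ with hβ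
  set k : Finset ι → ℝ := fun S => K (X ⊓ S.inf β) with hk
  have hsh := shearer_compl (k := k) (supermod_inf X β) Finset.univ
  have e0 : k (Finset.univ : Finset ι)ᶜ = K X := by simp [hk]
  rw [e0, Finset.card_univ] at hsh
  have hu : k Finset.univ ≤ K (part x fun _ => ρ) + Fintype.card η * Real.log (2 * D + 3) := by
    refine K_le_of_part (Y := x) (ρ := fun _ => ρ) (fun _ => hρ) hD (fun a a' h => ?_)
      inf_le_right
    refine h2 a a' fun q m => ?_
    have : β q a a' := (Finset.inf_le (Finset.mem_univ q) : Finset.univ.inf β ≤ β q) h.2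
    exact part_le (fun _ => hρ) this m
  have hp : ∀ p, K (X ⊓ Z p) ≤ k {p}ᶜ +
      (Fintype.card ι * Fintype.card κ) * Real.log (2 * D + 3) := by
    intro p
    have := K_le_of_part (s := X ⊓ Z p) (t := X ⊓ ({p}ᶜ : Finset ι).inf β)
      (Y := fun a (qm : ι × κ) => if qm.1 = p then 0 else b a qm.1 qm.2) (ρ := fun _ => ρ)
      (fun _ => hρ) hD ?_ ?_
    · simpa [Fintype.card_prod] using this
    · rintro a a' ⟨-, h⟩ ⟨q, m⟩
      by_cases hq : q = p
      · simp only [hq, if_true, sub_self, abs_zero]; positivity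
      · simp only [hq, if_false]; exact h1 p a a' h q hq m
    · refine le_inf (inf_le_left.trans inf_le_left) ?_
      refine Finset.le_inf fun q hq => ?_
      rintro a a' ⟨-, h⟩
      refine funext fun m => ?_
      have h3 := congrFun h (q, m)
      have hq' : q ≠ p := by simpa using hq
      simpa [hq'] using h3
  calc ∑ p, K (X ⊓ Z p) ≤ ∑ p, (k {p}ᶜ +
        (Fintype.card ι * Fintype.card κ) * Real.log (2 * D + 3)) :=
        Finset.sum_le_sum fun p _ => hp p
    _ = ∑ p, k {p}ᶜ + Fintype.card ι * ((Fintype.card ι * Fintype.card κ) *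
        Real.log (2 * D + 3)) := by
        rw [Finset.sum_add_distrib]; simp
    _ ≤ _ := by
        have h1 : (1 : ℝ) ≤ Fintype.card ι := by exact_mod_cast Fintype.card_pos
        have h2 : (0 : ℝ) ≤ Fintype.card η * Real.log (2 * D + 3) := by positivity
        nlinarith [mul_le_mul_of_nonneg_left hu (sub_nonneg.mpr h1)]

/-- Entropy bound for pairs of partitions sharing a common controlled vector. -/
lemma sum_K_pairs [Nonempty Ω] {η : Type*} [Fintype η] (X : Setoid Ω) (Y Y' : ι → Setoid Ω)
    (V : Ω → ι → κ → ℝ) (x : Ω → η → ℝ) {ρ D : ℝ} (hρ : 0 < ρ) (hD : 0 ≤ D)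
    (h1 : ∀ p a a', Y p a a' → ∀ m, |V a p m - V a' p m| ≤ D * ρ)
    (h1' : ∀ p a a', Y' p a a' → ∀ m, |V a p m - V a' p m| ≤ D * ρ)
    (h2 : ∀ p a a', Y p a a' → Y' p a a' → ∀ m, |x a m - x a' m| ≤ D * ρ)
    (h3 : ∀ a a', (∀ q m, |V a q m - V a' q m| ≤ ρ) → ∀ m, |x a m - x a' m| ≤ D * ρ) :
    ∑ p, (K (X ⊓ Y p) + K (X ⊓ Y' p)) ≤
      (Fintype.card ι + 1) * K (part x fun _ => ρ) + (Fintype.card ι - 1) * K X +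
      (Fintype.card ι * (2 * Fintype.card κ + Fintype.card η) + Fintype.card η) *
        Real.log (2 * D + 3) := by
  set Λ := Real.log (2 * D + 3) with hΛ
  set β : ι → Setoid Ω := fun q => part (fun a m => V a q m) fun _ => ρ with hβ
  set k : Finset ι → ℝ := fun S => K (X ⊓ S.inf β) with hk
  have hsh := shearer_single (k := k) (supermod_inf X β) Finset.univ
  have e0 : k ∅ = K X := by simp [hk]
  rw [e0, Finset.card_univ] at hsh
  have hu : k Finset.univ ≤ K (part x fun _ => ρ) + Fintype.card η * Λ := by
    refine K_le_of_part (Y := x) (ρ := fun _ => ρ) (fun _ => hρ) hD (fun a a' h => ?_)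
      inf_le_right
    refine h3 a a' fun q m => ?_
    have : β q a a' := (Finset.inf_le (Finset.mem_univ q) : Finset.univ.inf β ≤ β q) h.2
    exact part_le (fun _ => hρ) this m
  have hp : ∀ p, K (X ⊓ Y p) + K (X ⊓ Y' p) ≤ K (part x fun _ => ρ) + k {p} +
      (2 * Fintype.card κ + Fintype.card η) * Λ := by
    intro p
    have a1 : K (X ⊓ Y p) ≤ K (X ⊓ Y p ⊓ β p) + Fintype.card κ * Λ :=
      K_le_part (fun _ => hρ) hD fun a a' h => h1 p a a' h.2
    have a2 : K (X ⊓ Y' p) ≤ K (X ⊓ Y' p ⊓ β p) + Fintype.card κ * Λ :=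
      K_le_part (fun _ => hρ) hD fun a a' h => h1' p a a' h.2
    have a3 := K_supermod (F := X ⊓ Y p ⊓ β p) (G := X ⊓ Y' p ⊓ β p) (H := X ⊓ β p)
      (inf_le_inf_right _ inf_le_left) (inf_le_inf_right _ inf_le_left)
    have a4 : K (X ⊓ Y p ⊓ β p ⊓ (X ⊓ Y' p ⊓ β p)) ≤
        K (part x fun _ => ρ) + Fintype.card η * Λ :=
      K_le_of_part (Y := x) (ρ := fun _ => ρ) (fun _ => hρ) hD
        (fun a a' h => h2 p a a' h.1.1.2 h.2.1.2) inf_le_right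
    have a5 : k {p} = K (X ⊓ β p) := by simp [hk]
    rw [a5]
    linarith
  calc _ ≤ ∑ p, (K (part x fun _ => ρ) + k {p} +
        (2 * Fintype.card κ + Fintype.card η) * Λ) := Finset.sum_le_sum fun p _ => hp p
    _ = Fintype.card ι * K (part x fun _ => ρ) + ∑ p, k {p} +
        Fintype.card ι * ((2 * Fintype.card κ + Fintype.card η) * Λ) := by
        rw [Finset.sum_add_distrib, Finset.sum_add_distrib]; simp
    _ ≤ _ := by linarith

/-- Removing one layer of a nested partition. -/
lemma K_layer [Nonempty Ω] {G Y : Setoid Ω} {X : Setoid Ω} {c : ℝ}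
    (h : K X ≤ K (X ⊓ G) + c) :
    K (G ⊓ Y) ≤ K G + (K (X ⊓ Y) - K X) + c := by
  have h1 := K_supermod (F := G ⊓ Y) (G := X ⊓ G) (H := G) inf_le_left inf_le_right
  have h2 : K (G ⊓ Y ⊓ (X ⊓ G)) ≤ K (X ⊓ Y) :=
    K_mono (le_inf (inf_le_right.trans inf_le_left) (inf_le_left.trans inf_le_right))
  linarith

/-- Subadditivity of the information given by a family of partitions. -/
lemma sum_K_inf (X : Setoid Ω) (Y : ι → Setoid Ω) :
    ∑ p, K (X ⊓ Y p) ≤ K (X ⊓ Finset.univ.inf Y) + (Fintype.card ι - 1) * K X := by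
  have hsh := shearer_single (k := fun S => K (X ⊓ S.inf Y)) (supermod_inf X Y) Finset.univ
  simp only [Finset.inf_singleton, Finset.inf_empty, inf_top_eq, Finset.card_univ] at hsh
  linarith

end Entropy

namespace Sublevel

/-- A one-variable polynomial with large leading coefficient is small only on a small set. -/
lemma volume_poly_le (p : Polynomial ℝ) {σ η : ℝ} (hσ : 0 < σ) (hη : 0 < η)
    (hlc : σ ≤ |p.leadingCoeff|) :
    volume {t : ℝ | t ∈ Set.Icc (-1 : ℝ) 1 ∧ |p.eval t| ≤ η} ≤
      ENNReal.ofReal ((2 * p.natDegree + 2) * (η / σ) ^ (1 / ((p.natDegree : ℝ) + 1))) := by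
  set d := p.natDegree with hd
  set x : ℝ := (η / σ) ^ (1 / ((d : ℝ) + 1)) with hx
  have hr : 0 < η / σ := by positivity
  have hxpos : 0 < x := Real.rpow_pos_of_pos hr _
  by_cases h1 : 1 ≤ η / σ
  · have hx1 : 1 ≤ x := Real.one_le_rpow h1 (by positivity)
    calc _ ≤ volume (Set.Icc (-1 : ℝ) 1) := measure_mono fun t ht => ht.1
      _ = ENNReal.ofReal 2 := by rw [Real.volume_Icc]; norm_num
      _ ≤ _ := ENNReal.ofReal_le_ofReal (by nlinarith [(Nat.cast_nonneg d : (0:ℝ) ≤ d)])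
  push Not at h1
  have hx1 : x < 1 := Real.rpow_lt_one hr.le h1 (by positivity)
  have hxp : x ^ (d + 1) = η / σ := by
    rw [hx, ← Real.rpow_natCast, ← Real.rpow_mul hr.le]
    push_cast
    rw [one_div, inv_mul_cancel₀ (by positivity), Real.rpow_one]
  set q := p.map (algebraMap ℝ ℂ) with hq
  have hsplit : q.Splits := IsAlgClosed.splits q
  have heval : ∀ t : ℝ, |p.eval t| =
      |p.leadingCoeff| * (q.roots.map fun z => ‖(t : ℂ) - z‖).prod := by
    intro t
    have e1 : ‖q.eval (t : ℂ)‖ = |p.eval t| := by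
      have : q.eval (t : ℂ) = ((p.eval t : ℝ) : ℂ) := by
        rw [hq, show (t : ℂ) = algebraMap ℝ ℂ t from rfl, Polynomial.eval_map_algebraMap,
          Polynomial.aeval_algebraMap_apply_eq_algebraMap_eval]
        rfl
      rw [this, Complex.norm_real, Real.norm_eq_abs]
    rw [← e1, hsplit.eval_eq_prod_roots]
    rw [norm_mul, hq, Polynomial.leadingCoeff_map]
    congr 1
    · simp
    · rw [show ∀ z : ℂ, ‖z‖ = (normHom : ℂ →*₀ ℝ) z from fun _ => rfl, map_multiset_prod,
        Multiset.map_map]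
      rfl
  have hcard : q.roots.card = d := by
    rw [← hsplit.natDegree_eq_card_roots, hq, Polynomial.natDegree_map]
  have hsub : {t : ℝ | t ∈ Set.Icc (-1 : ℝ) 1 ∧ |p.eval t| ≤ η} ⊆
      ⋃ z ∈ q.roots.toFinset, Set.Icc (z.re - x) (z.re + x) := by
    rintro t ⟨-, ht⟩
    by_contra hcon
    simp only [Set.mem_iUnion, Multiset.mem_toFinset, not_exists] at hcon
    have hge : x ^ q.roots.card ≤ (q.roots.map fun z => ‖(t : ℂ) - z‖).prod := by
      have := Multiset.prod_map_le_prod_map₀ (s := q.roots) (fun _ => x)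
        (fun z => ‖(t : ℂ) - z‖) (fun _ _ => hxpos.le) (fun z hz => ?_)
      · simpa using this
      · have h2 := hcon z hz
        have h3 : x < |t - z.re| := by
          by_contra h4
          have := abs_le.mp (not_lt.mp h4)
          exact h2 ⟨by linarith, by linarith⟩
        refine h3.le.trans ?_
        have := Complex.abs_re_le_norm ((t : ℂ) - z)
        simpa using this
    rw [hcard] at hge
    rw [heval] at ht
    have : σ * x ^ d ≤ η := (mul_le_mul hlc hge (by positivity) (by positivity)).trans ht
    have h5 : σ * x ^ (d + 1) = η := by rw [hxp]; field_simp
    have h6 : 0 < σ * x ^ d := by positivity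
    rw [pow_succ] at h5
    nlinarith
  calc _ ≤ volume (⋃ z ∈ q.roots.toFinset, Set.Icc (z.re - x) (z.re + x)) := measure_mono hsub
    _ ≤ ∑ z ∈ q.roots.toFinset, volume (Set.Icc (z.re - x) (z.re + x)) :=
        measure_biUnion_finset_le _ _
    _ = q.roots.toFinset.card * ENNReal.ofReal (2 * x) := by
        have : ∀ z : ℂ, volume (Set.Icc (z.re - x) (z.re + x)) = ENNReal.ofReal (2 * x) := by
          intro z; rw [Real.volume_Icc]; congr 1; ring
        simp [this]
    _ = ENNReal.ofReal (q.roots.toFinset.card * (2 * x)) := by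
        rw [ENNReal.ofReal_mul (Nat.cast_nonneg _), ENNReal.ofReal_natCast]
    _ ≤ _ := by
        refine ENNReal.ofReal_le_ofReal ?_
        have : (q.roots.toFinset.card : ℝ) ≤ d := by
          rw [← hcard]; exact_mod_cast Multiset.toFinset_card_le _
        nlinarith

/-- the cube `[-1,1]^ι` -/
def cube (ι : Type*) : Set (ι → ℝ) := {x | ∀ i, x i ∈ Set.Icc (-1 : ℝ) 1}

lemma cube_eq (ι : Type*) : cube ι = Set.univ.pi fun _ => Set.Icc (-1 : ℝ) 1 := by
  ext x
  simp only [cube, Set.mem_pi, Set.mem_univ, forall_true_left]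
  rfl

lemma isClosed_cube (ι : Type*) : IsClosed (cube ι) := by
  rw [cube_eq]; exact isClosed_set_pi fun _ _ => isClosed_Icc

lemma volume_cube (n : ℕ) : volume (cube (Fin n)) = ENNReal.ofReal (2 ^ n) := by
  rw [cube_eq, volume_pi_pi]
  simp only [Real.volume_Icc, Finset.prod_const, Finset.card_univ, Fintype.card_fin]
  rw [← ENNReal.ofReal_pow (by norm_num)]
  norm_num

/-- Sublevel sets of nonzero polynomials in the cube have power-small volume. -/
lemma volume_mvPoly_le (n : ℕ) (f : MvPolynomial (Fin n) ℝ) (hf : f ≠ 0) :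
    ∃ C c : ℝ, 0 < C ∧ 0 < c ∧ ∀ θ : ℝ, 0 < θ → θ ≤ 1 →
      volume {x | x ∈ cube (Fin n) ∧ |MvPolynomial.eval x f| ≤ θ} ≤
        ENNReal.ofReal (C * θ ^ c) := by
  induction n with
  | zero =>
    obtain ⟨a, rfl⟩ : ∃ a, f = MvPolynomial.C a := ⟨_, MvPolynomial.eq_C_of_isEmpty f⟩
    have ha : a ≠ 0 := fun h => hf (by rw [h, map_zero])
    have hapos : 0 < |a| := abs_pos.mpr ha
    refine ⟨1 / |a|, 1, by positivity, one_pos, fun θ hθ _ => ?_⟩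
    by_cases h : |a| ≤ θ
    · refine (measure_mono fun x hx => hx.1).trans ?_
      rw [volume_cube]
      refine ENNReal.ofReal_le_ofReal ?_
      rw [Real.rpow_one, pow_zero, one_div, inv_mul_eq_div, one_le_div hapos]
      exact h
    · have : {x | x ∈ cube (Fin 0) ∧ |MvPolynomial.eval x (MvPolynomial.C a)| ≤ θ} = ∅ := by
        ext x; simp [h]
      rw [this, measure_empty]
      exact zero_le
  | succ n ih =>
    set P := MvPolynomial.finSuccEquiv ℝ n f with hP
    have hP0 : P ≠ 0 := by
      rw [hP]; simpa using hf
    obtain ⟨C, c, hC, hc, hCc⟩ := ih P.leadingCoeff (Polynomial.leadingCoeff_ne_zero.mpr hP0)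
    set g := P.leadingCoeff with hg
    set d := P.natDegree with hd
    set c' : ℝ := min c (1 / ((d : ℝ) + 1)) / 2 with hc'
    have hmin : 0 < min c (1 / ((d : ℝ) + 1)) := lt_min hc (by positivity)
    refine ⟨2 * C + 2 ^ n * (2 * d + 2), c', by positivity, by positivity, fun θ hθ hθ1 => ?_⟩
    set τ := Real.sqrt θ with hτ
    have hτ0 : 0 < τ := Real.sqrt_pos.mpr hθ
    have hτ1 : τ ≤ 1 := Real.sqrt_le_one.mpr hθ1
    have hττ : θ / τ = τ := by
      rw [div_eq_iff hτ0.ne', hτ, Real.mul_self_sqrt hθ.le]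
    set Sl : Set (ℝ × (Fin n → ℝ)) := {ty | ty.1 ∈ Set.Icc (-1 : ℝ) 1 ∧ ty.2 ∈ cube (Fin n) ∧
      |MvPolynomial.eval (Fin.cons ty.1 ty.2 : Fin (n + 1) → ℝ) f| ≤ θ} with hSl
    have hclosed : IsClosed Sl := by
      have e : Sl = Prod.fst ⁻¹' Set.Icc (-1 : ℝ) 1 ∩ (Prod.snd ⁻¹' cube (Fin n) ∩
          {ty | |MvPolynomial.eval (Fin.cons ty.1 ty.2 : Fin (n + 1) → ℝ) f| ≤ θ}) := by
        ext; simp [hSl]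
      rw [e]
      refine (isClosed_Icc.preimage continuous_fst).inter
        (((isClosed_cube _).preimage continuous_snd).inter ?_)
      refine isClosed_le (Continuous.abs ?_) continuous_const
      refine (MvPolynomial.continuous_eval f).comp ?_
      refine continuous_pi fun i => ?_
      refine Fin.cases ?_ (fun j => ?_) i
      · simpa using continuous_fst
      · simp only [Fin.cons_succ]
        exact (continuous_apply j).comp continuous_snd
    have hpre : {x | x ∈ cube (Fin (n + 1)) ∧ |MvPolynomial.eval x f| ≤ θ} =
        (MeasurableEquiv.piFinSuccAbove (fun _ : Fin (n + 1) => ℝ) 0) ⁻¹' Sl := by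
      ext x
      have hcons : (Fin.cons (x 0) (fun j => x (Fin.succ j)) : Fin (n + 1) → ℝ) = x :=
        Fin.cons_self_tail x
      change (x ∈ cube (Fin (n + 1)) ∧ |MvPolynomial.eval x f| ≤ θ) ↔
        (x 0 ∈ Set.Icc (-1 : ℝ) 1 ∧ (fun j => x (Fin.succ j)) ∈ cube (Fin n) ∧
          |MvPolynomial.eval (Fin.cons (x 0) (fun j => x (Fin.succ j)) : Fin (n + 1) → ℝ) f| ≤ θ)
      rw [hcons, ← and_assoc]
      refine and_congr_left fun _ => ?_
      exact Fin.forall_fin_succ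
    rw [hpre, (volume_preserving_piFinSuccAbove (fun _ => ℝ) 0).measure_preimage_equiv]
    rw [Measure.volume_eq_prod, Measure.prod_apply_symm hclosed.measurableSet]
    set B : Set (Fin n → ℝ) := {y | y ∈ cube (Fin n) ∧ |MvPolynomial.eval y g| ≤ τ} with hB
    set k := ENNReal.ofReal ((2 * d + 2) * τ ^ (1 / ((d : ℝ) + 1))) with hk
    calc ∫⁻ y, volume ((fun x => (x, y)) ⁻¹' Sl)
        ≤ ∫⁻ y, (B.indicator (fun _ => ENNReal.ofReal 2) y +
            (cube (Fin n)).indicator (fun _ => k) y) := by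
          refine lintegral_mono fun y => ?_
          by_cases hy : y ∈ cube (Fin n)
          · by_cases hyB : y ∈ B
            · rw [Set.indicator_of_mem hyB]
              refine le_trans ?_ (le_self_add)
              refine (measure_mono (t := Set.Icc (-1 : ℝ) 1) fun t ht => ht.1).trans ?_
              rw [Real.volume_Icc]; norm_num
            · rw [Set.indicator_of_mem hy]
              refine le_trans ?_ (le_add_self)
              have hgy : τ < |MvPolynomial.eval y g| := by
                by_contra h; exact hyB ⟨hy, not_lt.mp h⟩
              have hgy0 : MvPolynomial.eval y P.leadingCoeff ≠ 0 := by
                intro h; rw [← hg] at h; rw [h, abs_zero] at hgy; linarith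
              have h1 := volume_poly_le (P.map (MvPolynomial.eval y)) (σ := τ) (η := θ) hτ0 hθ
                (by rw [Polynomial.leadingCoeff_map_of_leadingCoeff_ne_zero _ hgy0]; exact hgy.le)
              rw [Polynomial.natDegree_map_of_leadingCoeff_ne_zero _ hgy0, hττ] at h1
              refine (measure_mono fun t ht => ?_).trans h1
              refine ⟨ht.1, ?_⟩
              rw [← MvPolynomial.eval_eq_eval_mv_eval']
              exact ht.2.2
          · have : (fun x => (x, y)) ⁻¹' Sl = ∅ := by
              ext t; simp [hSl, hy]
            rw [this, measure_empty]; exact zero_le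
      _ ≤ ENNReal.ofReal 2 * volume B + k * volume (cube (Fin n)) := by
          rw [lintegral_add_right _ (measurable_const.indicator (isClosed_cube _).measurableSet)]
          exact add_le_add (lintegral_indicator_const_le _ _) (lintegral_indicator_const_le _ _)
      _ ≤ ENNReal.ofReal 2 * ENNReal.ofReal (C * τ ^ c) + k * ENNReal.ofReal (2 ^ n) := by
          rw [volume_cube]
          gcongr
          exact hCc τ hτ0 hτ1
      _ = ENNReal.ofReal (2 * (C * τ ^ c) +
            (2 * d + 2) * τ ^ (1 / ((d : ℝ) + 1)) * 2 ^ n) := by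
          rw [hk, ← ENNReal.ofReal_mul (by norm_num), ← ENNReal.ofReal_mul (by positivity),
            ← ENNReal.ofReal_add (by positivity) (by positivity)]
      _ ≤ _ := by
          refine ENNReal.ofReal_le_ofReal ?_
          have hθτ : θ ^ c' = τ ^ (min c (1 / ((d : ℝ) + 1))) := by
            rw [hτ, Real.sqrt_eq_rpow, ← Real.rpow_mul hθ.le, hc']
            congr 1; ring
          have h1 : τ ^ c ≤ θ ^ c' := by
            rw [hθτ]; exact Real.rpow_le_rpow_of_exponent_ge hτ0 hτ1 (min_le_left _ _)
          have h2 : τ ^ (1 / ((d : ℝ) + 1)) ≤ θ ^ c' := by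
            rw [hθτ]; exact Real.rpow_le_rpow_of_exponent_ge hτ0 hτ1 (min_le_right _ _)
          have h3 : 0 < (2 : ℝ) ^ n := by positivity
          have h4 : (0 : ℝ) ≤ 2 * d + 2 := by positivity
          calc _ ≤ 2 * (C * θ ^ c') + (2 * d + 2) * θ ^ c' * 2 ^ n := by gcongr
            _ = _ := by ring

/-- Real-valued functions on tuples of points of the plane which are polynomial. -/
def IsPoly {n : ℕ} (f : (Fin n → ℝ × ℝ) → ℝ) : Prop :=
  ∃ p : MvPolynomial (Fin n ⊕ Fin n) ℝ,
    ∀ U, f U = MvPolynomial.eval (Sum.elim (fun i => (U i).1) fun i => (U i).2) p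

namespace IsPoly

variable {n : ℕ} {f g : (Fin n → ℝ × ℝ) → ℝ}

lemma const (a : ℝ) : IsPoly (n := n) fun _ => a := ⟨MvPolynomial.C a, fun U => by simp⟩

lemma fst (i : Fin n) : IsPoly fun U => (U i).1 :=
  ⟨MvPolynomial.X (Sum.inl i), fun U => by simp⟩

lemma snd (i : Fin n) : IsPoly fun U => (U i).2 :=
  ⟨MvPolynomial.X (Sum.inr i), fun U => by simp⟩

lemma add (hf : IsPoly f) (hg : IsPoly g) : IsPoly fun U => f U + g U := by
  obtain ⟨p, hp⟩ := hf
  obtain ⟨q, hq⟩ := hg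
  exact ⟨p + q, fun U => by simp only [hp, hq, map_add]⟩

lemma mul (hf : IsPoly f) (hg : IsPoly g) : IsPoly fun U => f U * g U := by
  obtain ⟨p, hp⟩ := hf
  obtain ⟨q, hq⟩ := hg
  exact ⟨p * q, fun U => by simp only [hp, hq, map_mul]⟩

lemma neg (hf : IsPoly f) : IsPoly fun U => -f U := by
  simpa using (const (-1)).mul hf

lemma sum {ι : Type*} (s : Finset ι) {F : ι → (Fin n → ℝ × ℝ) → ℝ} (h : ∀ i ∈ s, IsPoly (F i)) :
    IsPoly fun U => ∑ i ∈ s, F i U := by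
  induction s using Finset.induction_on with
  | empty => simpa using const (0 : ℝ)
  | insert a s ha ih =>
    simp_rw [Finset.sum_insert ha]
    exact (h a (Finset.mem_insert_self _ _)).add
      (ih fun i hi => h i (Finset.mem_insert_of_mem hi))

lemma prod {ι : Type*} (s : Finset ι) {F : ι → (Fin n → ℝ × ℝ) → ℝ} (h : ∀ i ∈ s, IsPoly (F i)) :
    IsPoly fun U => ∏ i ∈ s, F i U := by
  induction s using Finset.induction_on with
  | empty => simpa using const (1 : ℝ)
  | insert a s ha ih =>
    simp_rw [Finset.prod_insert ha]
    exact (h a (Finset.mem_insert_self _ _)).mul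
      (ih fun i hi => h i (Finset.mem_insert_of_mem hi))

lemma det {ι : Type*} [Fintype ι] [DecidableEq ι] {M : (Fin n → ℝ × ℝ) → Matrix ι ι ℝ}
    (h : ∀ i j, IsPoly fun U => M U i j) : IsPoly fun U => (M U).det := by
  simp_rw [Matrix.det_apply']
  exact sum _ fun σ _ => (const _).mul (prod _ fun i _ => h _ _)

lemma adjugate {ι : Type*} [Fintype ι] [DecidableEq ι] {M : (Fin n → ℝ × ℝ) → Matrix ι ι ℝ}
    (h : ∀ i j, IsPoly fun U => M U i j) (i j : ι) : IsPoly fun U => (M U).adjugate i j := by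
  simp_rw [Matrix.adjugate_apply]
  refine det fun a b => ?_
  by_cases hab : a = j
  · subst hab; simpa using const _
  · simpa [Matrix.updateRow_ne hab] using h a b

lemma comp_perm (hf : IsPoly f) {m : ℕ} (e : Fin n → Fin m) :
    IsPoly fun U : Fin m → ℝ × ℝ => f fun i => U (e i) := by
  obtain ⟨p, hp⟩ := hf
  refine ⟨MvPolynomial.rename (Sum.map e e) p, fun U => ?_⟩
  simp only [hp, MvPolynomial.eval_rename]
  congr 2
  ext x
  cases x <;> rfl

lemma continuous (hf : IsPoly f) : Continuous f := by
  obtain ⟨p, hp⟩ := hf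
  rw [funext hp]
  refine (MvPolynomial.continuous_eval p).comp (continuous_pi fun i => ?_)
  cases i <;> simp <;> fun_prop

end IsPoly

end Sublevel

namespace Sublevel

/-- product measure on tuples of points of the parameter square -/
noncomputable def tupMeas (n : ℕ) : Measure (Fin n → ℝ × ℝ) :=
  Measure.pi fun _ => volume.restrict uSq

lemma isCompact_uSq : IsCompact uSq := isCompact_Icc.prod isCompact_Icc

lemma measurableSet_uSq : MeasurableSet uSq := isCompact_uSq.isClosed.measurableSet

lemma volume_uSq : volume uSq = 4 := by
  unfold uSq
  rw [Measure.volume_eq_prod, Measure.prod_prod, Real.volume_Icc,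
    ← ENNReal.ofReal_mul (by norm_num)]
  norm_num

lemma tupMeas_eq (n : ℕ) : tupMeas n = volume.restrict (Set.univ.pi fun _ => uSq) := by
  unfold tupMeas
  rw [volume_pi, Measure.restrict_pi_pi]

/-- flattening a tuple of points of the plane -/
noncomputable def flat (n : ℕ) : (Fin n → ℝ × ℝ) ≃ᵐ (Fin (n + n) → ℝ) :=
  ((MeasurableEquiv.arrowProdEquivProdArrow ℝ ℝ (Fin n)).trans
    (MeasurableEquiv.sumPiEquivProdPi (fun _ : Fin n ⊕ Fin n => ℝ)).symm).trans
    (MeasurableEquiv.piCongrLeft (fun _ : Fin (n + n) => ℝ) finSumFinEquiv)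

lemma flat_apply (n : ℕ) (U : Fin n → ℝ × ℝ) (x : Fin n ⊕ Fin n) :
    flat n U (finSumFinEquiv x) = (Sum.elim (fun i => (U i).1) fun i => (U i).2) x := by
  simp only [flat, MeasurableEquiv.trans_apply]
  rw [MeasurableEquiv.coe_piCongrLeft, Equiv.piCongrLeft_apply_apply]
  cases x <;> rfl

lemma measurePreserving_flat (n : ℕ) : MeasurePreserving (flat n) volume volume :=
  ((volume_measurePreserving_arrowProdEquivProdArrow ℝ ℝ (Fin n)).trans
    (volume_measurePreserving_sumPiEquivProdPi_symm (fun _ : Fin n ⊕ Fin n => ℝ))).trans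
    (volume_measurePreserving_piCongrLeft (fun _ : Fin (n + n) => ℝ) finSumFinEquiv)

lemma IsPoly.tupMeas_sublevel_le {n : ℕ} {f : (Fin n → ℝ × ℝ) → ℝ} (hf : IsPoly f)
    (h0 : ∃ U, f U ≠ 0) :
    ∃ C c : ℝ, 0 < C ∧ 0 < c ∧ ∀ θ : ℝ, 0 < θ → θ ≤ 1 →
      tupMeas n {U | |f U| ≤ θ} ≤ ENNReal.ofReal (C * θ ^ c) := by
  obtain ⟨p, hp⟩ := hf
  have hev : ∀ U, f U = MvPolynomial.eval (flat n U) (MvPolynomial.rename finSumFinEquiv p) := by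
    intro U
    rw [hp, MvPolynomial.eval_rename]
    congr 2
    exact funext fun x => (flat_apply n U x).symm
  have hq : MvPolynomial.rename finSumFinEquiv p ≠ 0 := by
    intro h
    obtain ⟨U, hU⟩ := h0
    rw [hev, h, map_zero] at hU
    exact hU rfl
  obtain ⟨C, c, hC, hc, h⟩ := volume_mvPoly_le _ _ hq
  refine ⟨C, c, hC, hc, fun θ hθ hθ1 => ?_⟩
  refine le_trans ?_ (h θ hθ hθ1)
  rw [tupMeas_eq, Measure.restrict_apply' (MeasurableSet.univ_pi fun _ => measurableSet_uSq),
    ← (measurePreserving_flat n).measure_preimage_equiv]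
  refine measure_mono ?_
  rintro U ⟨hU, hU'⟩
  refine ⟨fun i => ?_, ?_⟩
  · obtain ⟨x, rfl⟩ := finSumFinEquiv.surjective i
    rw [flat_apply]
    cases x with
    | inl i => exact (hU' i trivial).1
    | inr i => exact (hU' i trivial).2
  · rw [← hev]; exact hU

end Sublevel

namespace Jet

section Algebra

variable {R S : Type*} [CommRing R] [CommRing S]

/-- The matrix taking the coefficients of a polynomial in the span of
`1, r, s, r², rs, s², nr, ns, n²`, with `n = a(r² + s²) + brs`, to those of its translate. -/
def jet (a b : R) (u : R × R) : Matrix (Fin 9) (Fin 9) R :=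
  let r := u.1
  let s := u.2
  let n := a * (r ^ 2 + s ^ 2) + b * r * s
  let p := 2 * a * r + b * s
  let q := b * r + 2 * a * s
  !![1, r, s, r ^ 2, r * s, s ^ 2, n * r, n * s, n ^ 2;
     0, 1, 0, 2 * r, s, 0, n + r * p, s * p, 2 * n * p;
     0, 0, 1, 0, r, 2 * s, r * q, n + s * q, 2 * n * q;
     0, 0, 0, 1, 0, 0, p + r * a, s * a, p ^ 2 + 2 * n * a;
     0, 0, 0, 0, 1, 0, q + r * b, p + s * b, 2 * p * q + 2 * n * b;
     0, 0, 0, 0, 0, 1, r * a, q + s * a, q ^ 2 + 2 * n * a;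
     0, 0, 0, 0, 0, 0, 1, 0, 2 * p;
     0, 0, 0, 0, 0, 0, 0, 1, 2 * q;
     0, 0, 0, 0, 0, 0, 0, 0, 1]

lemma jet_mulVec (a b : R) (u : R × R) (z : Fin 9 → R) :
    let r := u.1
    let s := u.2
    let n := a * (r ^ 2 + s ^ 2) + b * r * s
    let p := 2 * a * r + b * s
    let q := b * r + 2 * a * s
    jet a b u *ᵥ z = ![
      z 0 + r * z 1 + s * z 2 + (r ^ 2) * z 3 + (r * s) * z 4 + (s ^ 2) * z 5 +
        (n * r) * z 6 + (n * s) * z 7 + (n ^ 2) * z 8,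
      z 1 + (2 * r) * z 3 + s * z 4 + (n + r * p) * z 6 + (s * p) * z 7 + (2 * n * p) * z 8,
      z 2 + r * z 4 + (2 * s) * z 5 + (r * q) * z 6 + (n + s * q) * z 7 + (2 * n * q) * z 8,
      z 3 + (p + r * a) * z 6 + (s * a) * z 7 + (p ^ 2 + 2 * n * a) * z 8,
      z 4 + (q + r * b) * z 6 + (p + s * b) * z 7 + (2 * p * q + 2 * n * b) * z 8,
      z 5 + (r * a) * z 6 + (q + s * a) * z 7 + (q ^ 2 + 2 * n * a) * z 8,
      z 6 + (2 * p) * z 8,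
      z 7 + (2 * q) * z 8,
      z 8] := by
  ext i
  simp only [mulVec, dotProduct, Fin.sum_univ_succ]
  fin_cases i <;> simp [jet, -mul_eq_mul_left_iff] <;> ring

lemma jet_neg_mulVec (a b : R) (u : R × R) (z : Fin 9 → R) :
    jet a b (-u) *ᵥ (jet a b u *ᵥ z) = z := by
  rw [jet_mulVec, jet_mulVec]
  ext i
  fin_cases i <;> simp <;> ring

/-- the linear map attached to an invariant bilinear form of the jets -/
def dual (i : Fin 2) (z : Fin 9 → R) : Fin 9 → R :=
  if i = 0 then ![4 * z 8, -2 * z 7, -2 * z 6, 4 * z 5, z 4, 4 * z 3, -2 * z 2, -2 * z 1, 4 * z 0]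
  else ![16 * z 8, -4 * z 6, -4 * z 7, 3 * z 3 - z 5, 2 * z 4, 3 * z 5 - z 3, -4 * z 1, -4 * z 2,
    16 * z 0]

/-- the jets for the quadratic form `rs` when `i = 0` and `r² + s²` when `i = 1` -/
abbrev J (i : Fin 2) (u : R × R) : Matrix (Fin 9) (Fin 9) R :=
  jet (if i = 0 then 0 else 1) (if i = 0 then 1 else 0) u

set_option maxHeartbeats 1000000 in
lemma dual_invariant (i : Fin 2) (u : R × R) (x z : Fin 9 → R) :
    (J i u *ᵥ x) ⬝ᵥ dual i (J i u *ᵥ z) = x ⬝ᵥ dual i z := by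
  obtain ⟨r, s⟩ := u
  rw [J, jet_mulVec, jet_mulVec]
  fin_cases i <;> simp [dual, dotProduct, Fin.sum_univ_succ] <;> ring

end Algebra

section Defs

variable {R S : Type*} [CommRing R] [CommRing S]

lemma comp_vecCons {α β : Type*} {n : ℕ} (f : α → β) (x : α) (v : Fin n → α) :
    f ∘ vecCons x v = vecCons (f x) (f ∘ v) :=
  Fin.comp_cons f x v

lemma comp_nil {α β : Type*} (f : α → β) (v : Fin 0 → α) : f ∘ v = ![] :=
  Subsingleton.elim _ _

lemma jet_map (f : R →+* S) (a b : R) (u : R × R) :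
    (jet a b u).map f = jet (f a) (f b) (f u.1, f u.2) := by
  ext i j
  revert j
  have h2 : f 2 = 2 := map_ofNat f 2
  refine congrFun ?_
  fin_cases i <;>
    (refine (comp_vecCons f _ _).trans ?_; simp [jet, comp_vecCons, comp_nil, h2]; rfl)

lemma J_map (f : R →+* S) (i : Fin 2) (u : R × R) (m k : Fin 9) :
    f (J i u m k) = J i (f u.1, f u.2) m k := by
  have := congrFun (congrFun (jet_map f (if i = 0 then 0 else 1) (if i = 0 then 1 else 0) u) m) k
  rw [Matrix.map_apply] at this
  rw [J, J, this]
  split_ifs <;> simp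

/-- the jets of order two at `u` followed by those of order one at `v` -/
def pairMat (i : Fin 2) (u v : R × R) : Matrix (Fin 9) (Fin 9) R :=
  Matrix.of fun j k => J i (![u, u, u, u, u, u, v, v, v] j) (![0, 1, 2, 3, 4, 5, 0, 1, 2] j) k

/-- three vectors vanishing to second order at each of two points, for three pairs of points -/
def tripleMat (i : Fin 2) (U : Fin 6 → R × R) : Matrix (Fin 9) (Fin 9) R :=
  Matrix.of fun m c => (pairMat i (U (![0, 0, 0, 2, 2, 2, 4, 4, 4] c))
    (U (![1, 1, 1, 3, 3, 3, 5, 5, 5] c))).adjugate m (![3, 4, 5, 3, 4, 5, 3, 4, 5] c)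

/-- the translates of the last basis vector -/
def topMat (i : Fin 2) (U : Fin 9 → R × R) : Matrix (Fin 9) (Fin 9) R :=
  Matrix.of fun m j => J i (-(U j)) m 8

/-- evaluation at seven points and the two derivatives at the first of them -/
def evalMat (i : Fin 2) (U : Fin 7 → R × R) : Matrix (Fin 9) (Fin 9) R :=
  Matrix.of fun j k => J i (U (![0, 1, 2, 3, 4, 5, 6, 0, 0] j)) (![0, 0, 0, 0, 0, 0, 0, 1, 2] j) k

lemma pairMat_map (f : R →+* S) (i : Fin 2) (u v : R × R) :
    (pairMat i u v).map f = pairMat i (f u.1, f u.2) (f v.1, f v.2) := by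
  ext j k
  simp only [Matrix.map_apply, pairMat, Matrix.of_apply, J_map]
  congr 1
  fin_cases j <;> rfl

lemma tripleMat_map (f : R →+* S) (i : Fin 2) (U : Fin 6 → R × R) :
    (tripleMat i U).map f = tripleMat i fun k => (f (U k).1, f (U k).2) := by
  ext m c
  simp only [Matrix.map_apply, tripleMat, Matrix.of_apply]
  rw [← pairMat_map]
  exact congrFun (congrFun (f.map_adjugate _) m) _

lemma topMat_map (f : R →+* S) (i : Fin 2) (U : Fin 9 → R × R) :
    (topMat i U).map f = topMat i fun k => (f (U k).1, f (U k).2) := by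
  ext m c
  simp [topMat, J_map]

lemma evalMat_map (f : R →+* S) (i : Fin 2) (U : Fin 7 → R × R) :
    (evalMat i U).map f = evalMat i fun k => (f (U k).1, f (U k).2) := by
  ext m c
  simp only [Matrix.map_apply, evalMat, Matrix.of_apply, J_map]

end Defs

lemma det_ne_zero_of_mul_eq {M N : Matrix (Fin 9) (Fin 9) ℤ} {d : ℤ} (hd : d ≠ 0)
    (h : M * N = d • (1 : Matrix (Fin 9) (Fin 9) ℤ)) : M.det ≠ 0 := by
  intro h0
  have := congrArg Matrix.det h
  rw [Matrix.det_mul, h0, zero_mul, Matrix.det_smul, Matrix.det_one, mul_one] at this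
  exact pow_ne_zero _ hd this.symm

lemma adjugate_eq_of_mul_eq_one {M N : Matrix (Fin 9) (Fin 9) ℤ} (h : M * N = 1) :
    M.adjugate = M.det • N := by
  calc M.adjugate = M.adjugate * (M * N) := by rw [h, mul_one]
    _ = M.det • N := by rw [← mul_assoc, Matrix.adjugate_mul, Matrix.smul_mul, one_mul]

lemma det_map_ne_zero {M : Matrix (Fin 9) (Fin 9) ℤ} (h : M.det ≠ 0) :
    (M.map (Int.castRingHom ℝ)).det ≠ 0 := by
  have : (M.map (Int.castRingHom ℝ)).det = Int.castRingHom ℝ M.det :=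
    ((Int.castRingHom ℝ).map_det M).symm
  rw [this]
  simpa using h

lemma det_pairMat_ne_zero_of {i : Fin 2} {u v : ℤ × ℤ} {N : Matrix (Fin 9) (Fin 9) ℤ}
    (h : pairMat i u v * N = 1) : (pairMat i u v).det ≠ 0 :=
  det_ne_zero_of_mul_eq one_ne_zero (h.trans (one_smul _ _).symm)

lemma det_tripleMat_ne_zero_of {i : Fin 2} {U : Fin 6 → ℤ × ℤ}
    {N : Fin 9 → Matrix (Fin 9) (Fin 9) ℤ} {N' : Matrix (Fin 9) (Fin 9) ℤ} {d : ℤ} (hd : d ≠ 0)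
    (h : ∀ c, pairMat i (U (![0, 0, 0, 2, 2, 2, 4, 4, 4] c))
      (U (![1, 1, 1, 3, 3, 3, 5, 5, 5] c)) * N c = 1)
    (h' : (Matrix.of fun m c => N c m (![3, 4, 5, 3, 4, 5, 3, 4, 5] c)) * N' =
      d • (1 : Matrix (Fin 9) (Fin 9) ℤ)) :
    (tripleMat i U).det ≠ 0 := by
  have hT : tripleMat i U = (Matrix.of fun m c => N c m (![3, 4, 5, 3, 4, 5, 3, 4, 5] c)) *
      Matrix.diagonal fun c => (pairMat i (U (![0, 0, 0, 2, 2, 2, 4, 4, 4] c))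
        (U (![1, 1, 1, 3, 3, 3, 5, 5, 5] c))).det := by
    ext m c
    rw [Matrix.mul_diagonal, tripleMat, Matrix.of_apply, adjugate_eq_of_mul_eq_one (h c),
      Matrix.smul_apply, Matrix.of_apply, smul_eq_mul, mul_comm]
  rw [hT, Matrix.det_mul, Matrix.det_diagonal]
  exact mul_ne_zero (det_ne_zero_of_mul_eq hd h')
    (Finset.prod_ne_zero_iff.2 fun c _ => det_pairMat_ne_zero_of (h c))

set_option maxRecDepth 100000 in
lemma exists_det_pairMat (i : Fin 2) : ∃ u v : ℤ × ℤ, (pairMat i u v).det ≠ 0 := by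
  fin_cases i
  · exact ⟨(-2, 0), (-3, -1), det_pairMat_ne_zero_of
      (N := !![1, 2, 0, 4, 0, 0, 0, 0, 0;
       0, 1, 0, 4, 0, 0, 0, 0, 0;
       8, -8, -3, 8, 6, 0, -8, 0, -4;
       0, 0, 0, 1, 0, 0, 0, 0, 0;
       8, -8, -4, 8, 5, 0, -8, 0, -4;
       16, -10, -12, 4, 6, 9, -16, -6, -4;
       2, -2, -1, 2, 1, 0, -2, 0, -1;
       14, -9, -10, 4, 5, 6, -14, -5, -4;
       3, -2, -2, 1, 1, 1, -3, -1, -1]) (by decide +kernel)⟩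
  · exact ⟨(0, 2), (1, 2), det_pairMat_ne_zero_of
      (N := !![49, 32, 6, 16, 8, 4, -48, 16, -8;
       -16, -11, 0, -8, -2, 0, 16, -4, 0;
       -96, -64, -11, -32, -12, -4, 96, -32, 12;
       24, 16, 2, 9, 2, 0, -24, 8, -2;
       16, 12, 0, 8, 1, 0, -16, 4, 0;
       72, 48, 6, 24, 6, 1, -72, 24, -6;
       -4, -3, 0, -2, 0, 0, 4, -1, 0;
       -24, -16, -1, -8, -1, 0, 24, -8, 1;
       3, 2, 0, 1, 0, 0, -3, 1, 0]) (by decide +kernel)⟩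

set_option maxRecDepth 100000 in
lemma exists_det_tripleMat (i : Fin 2) : ∃ U : Fin 6 → ℤ × ℤ, (tripleMat i U).det ≠ 0 := by
  fin_cases i
  · exact ⟨![(-2, 0), (-3, -1), (-2, 2), (-1, 1), (-2, 1), (-3, 0)],
      det_tripleMat_ne_zero_of (d := 4)
      (N := fun c => ![!![1, 2, 0, 4, 0, 0, 0, 0, 0;
       0, 1, 0, 4, 0, 0, 0, 0, 0;
       8, -8, -3, 8, 6, 0, -8, 0, -4;
       0, 0, 0, 1, 0, 0, 0, 0, 0;
       8, -8, -4, 8, 5, 0, -8, 0, -4;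
       16, -10, -12, 4, 6, 9, -16, -6, -4;
       2, -2, -1, 2, 1, 0, -2, 0, -1;
       14, -9, -10, 4, 5, 6, -14, -5, -4;
       3, -2, -2, 1, 1, 1, -3, -1, -1],
       !![17, 10, -10, 4, -4, 4, -16, 8, -8;
       24, 13, -16, 4, -6, 8, -24, 12, -8;
       -24, -16, 13, -8, 6, -4, 24, -8, 12;
       8, 4, -6, 1, -2, 4, -8, 4, -2;
       -32, -20, 20, -8, 9, -8, 32, -12, 12;
       8, 6, -4, 4, -2, 1, -8, 2, -4;
       -10, -6, 7, -2, 3, -4, 10, -4, 3;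
       10, 7, -6, 4, -3, 2, -10, 3, -4;
       3, 2, -2, 1, -1, 1, -3, 1, -1],
       !![9, 0, -9, 0, 0, 9, -8, -6, 0;
       6, 0, -6, 0, 0, 6, -6, -5, 0;
       -24, 12, 21, 0, -6, -18, 24, 12, 4;
       1, 0, -1, 0, 0, 1, -1, -1, 0;
       -20, 10, 16, 0, -5, -12, 20, 10, 4;
       16, -10, -12, 4, 6, 9, -16, -6, -4;
       -4, 2, 3, 0, -1, -2, 4, 2, 1;
       14, -9, -10, 4, 5, 6, -14, -5, -4;
       3, -2, -2, 1, 1, 1, -3, -1, -1]] (![0, 0, 0, 1, 1, 1, 2, 2, 2] c))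
      (N' := !![0, -1, 1, 6, -3, 0, 9, 0, 0;
       0, 2, -2, -8, 6, -4, -16, 10, -24;
       2, -4, 3, 8, -6, 4, 12, -8, 16;
       20, -35, 15, 62, -29, 0, 55, 0, 0;
       12, -22, 8, 40, -16, 0, 32, 0, 0;
       2, -4, 1, 8, -2, 0, 4, 0, 0;
       -4, 8, -4, -20, 8, 4, -16, -12, 36;
       -4, 4, -2, 0, 2, -4, 0, 10, -24;
       -4, 8, -4, -16, 8, 0, -16, 0, 0])
      (by decide) (by decide +kernel) (by decide +kernel)⟩
  · exact ⟨![(0, 2), (1, 2), (1, 1), (1, 0), (2, 1), (2, 2)], det_tripleMat_ne_zero_of (d := 24)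
      (N := fun c => ![!![49, 32, 6, 16, 8, 4, -48, 16, -8;
       -16, -11, 0, -8, -2, 0, 16, -4, 0;
       -96, -64, -11, -32, -12, -4, 96, -32, 12;
       24, 16, 2, 9, 2, 0, -24, 8, -2;
       16, 12, 0, 8, 1, 0, -16, 4, 0;
       72, 48, 6, 24, 6, 1, -72, 24, -6;
       -4, -3, 0, -2, 0, 0, 4, -1, 0;
       -24, -16, -1, -8, -1, 0, 24, -8, 1;
       3, 2, 0, 1, 0, 0, -3, 1, 0],
       !![5, 1, -3, 1, -1, 1, -4, -2, -2;
       -16, -3, 10, -2, 3, -4, 16, 4, 6;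
       -8, -2, 5, 0, 1, -2, 8, 2, 4;
       20, 3, -13, 1, -3, 6, -20, -3, -7;
       16, 2, -10, 0, -1, 4, -16, -2, -6;
       12, 1, -7, 0, -1, 3, -12, -1, -5;
       -12, -1, 8, 0, 1, -4, 12, 1, 4;
       -8, 0, 5, 0, 0, -2, 8, 0, 3;
       3, 0, -2, 0, 0, 1, -3, 0, -1],
       !![96, 8, 64, 4, 12, 36, -95, -10, 30;
       -136, -12, -92, -4, -14, -48, 136, 13, -44;
       -88, -4, -60, 0, -6, -36, 88, 4, -27;
       82, 6, 55, 1, 6, 28, -82, -6, 27;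
       64, 2, 44, 0, 3, 24, -64, -2, 20;
       54, 2, 37, 0, 2, 21, -54, -2, 17;
       -24, -1, -16, 0, -1, -8, 24, 1, -8;
       -16, 0, -11, 0, 0, -6, 16, 0, -5;
       3, 0, 2, 0, 0, 1, -3, 0, 1]] (![0, 0, 0, 1, 1, 1, 2, 2, 2] c))
      (N' := !![-8, -12, -14, -16, -21, -24, -51, -69, -158;
       24, 36, 48, 48, 66, 96, 174, 258, 588;
       -8, -12, -38, -16, -45, -96, -123, -237, -518;
       26, 51, 29, 100, 54, 12, 210, 84, 392;
       4, 6, 10, 8, 24, 24, 72, 84, 280;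
       2, 3, 5, 4, 6, 12, 18, 36, 104;
       46, 57, 73, 68, 87, 108, 201, 249, 550;
       -36, -54, -54, -72, -78, -72, -186, -186, -444;
       6, 9, 9, 12, 15, 12, 33, 33, 78])
      (by decide) (by decide +kernel) (by decide +kernel)⟩

set_option maxRecDepth 100000 in
lemma exists_det_topMat (i : Fin 2) : ∃ U : Fin 9 → ℤ × ℤ, (topMat i U).det ≠ 0 := by
  fin_cases i
  · exact ⟨![(0, 2), (1, -1), (1, -2), (0, -1), (-1, 1), (-2, 0), (-1, -1), (-1, 0), (0, 0)],
      det_ne_zero_of_mul_eq (d := 48)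
      (N := !![-8, 0, 4, 8, 0, 0, -4, 0, 0;
       -24, 12, 24, 0, -12, 0, 0, 0, 0;
       12, -6, -6, 0, 3, 0, 0, 0, 0;
       -16, 0, -16, 16, 0, 0, 16, 0, 0;
       12, 6, -6, 0, -3, 0, 0, 0, 0;
       12, -6, -18, 0, 9, 24, 0, -12, 0;
       12, 6, 6, 0, 3, 0, 0, 0, 0;
       -60, 6, 54, 0, -27, -48, 0, 48, 0;
       60, -18, -42, -24, 27, 24, -12, -36, 48])
      (by decide) (by decide +kernel)⟩
  · exact ⟨![(1, 2), (2, -1), (2, 0), (2, 1), (1, 0), (1, -2), (0, 2), (0, 1), (1, 1)],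
      det_ne_zero_of_mul_eq (d := 192)
      (N := !![-72, -48, -24, -21, -6, 51, 48, 96, 96;
       48, 12, 12, -30, -12, -30, -84, -84, -96;
       -144, -60, -36, 42, 0, 90, 156, 180, 96;
       96, 48, 24, 6, 12, -66, -48, -96, 0;
       48, 24, 0, -12, 0, -36, -48, 0, 192;
       -8, 0, 0, 9, 6, 9, 24, 24, 32;
       48, 36, 12, 18, 0, -30, -36, -60, -96;
       -48, -36, -12, 0, 0, 24, 108, 60, 288;
       32, 24, 24, -12, 0, -12, -120, -120, -320])
      (by decide) (by decide +kernel)⟩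

set_option maxRecDepth 100000 in
lemma exists_det_evalMat (i : Fin 2) : ∃ U : Fin 7 → ℤ × ℤ, (evalMat i U).det ≠ 0 := by
  fin_cases i
  · exact ⟨![(1, 1), (0, -1), (-1, -1), (-1, 0), (0, 2), (1, 2), (2, 1)],
      det_ne_zero_of_mul_eq (d := 12)
      (N := !![0, 4, 0, 0, -4, 0, 12, -24, 0;
       0, 0, 0, -6, 0, 6, 0, 0, -12;
       0, -6, 0, 0, 0, 0, 6, -12, 0;
       0, -4, 0, 6, 4, 6, -12, 24, -12;
       21, 0, 3, 0, 0, -12, -12, 18, 18;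
       0, 2, 0, 0, 4, 0, -6, 12, 0;
       3, 6, -3, 0, 0, -12, 6, -6, 18;
       3, 0, -3, 6, 0, 6, -12, 18, -6;
       -15, -2, 3, -6, -4, 6, 18, -30, -6])
      (by decide) (by decide +kernel)⟩
  · exact ⟨![(0, -1), (-2, 2), (-1, 2), (0, 0), (1, -2), (0, 1), (1, 0)],
      det_ne_zero_of_mul_eq (d := 8)
      (N := !![0, 0, 0, 8, 0, 0, 0, 0, 0;
       -396, -38, 107, 598, -28, -316, 73, -6, -274;
       52, 6, -17, -86, 4, 52, -11, 2, 38;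
       470, 46, -129, -718, 32, 378, -79, 10, 322;
       -408, -40, 112, 616, -28, -328, 76, -16, -280;
       66, 6, -17, -102, 4, 54, -11, 2, 42;
       -12, -2, 5, 18, 0, -12, 3, -2, -6;
       -56, -6, 17, 86, -4, -48, 11, -2, -38;
       -62, -6, 17, 94, -4, -50, 11, -2, -42])
      (by decide) (by decide +kernel)⟩

end Jet

namespace Sublevel

/-- the ring of polynomial functions of `n` points of the plane -/
def polyFun (n : ℕ) : Subring ((Fin n → ℝ × ℝ) → ℝ) where
  carrier := {f | IsPoly f}
  mul_mem' := IsPoly.mul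
  one_mem' := IsPoly.const 1
  add_mem' := IsPoly.add
  zero_mem' := IsPoly.const 0
  neg_mem' := IsPoly.neg

/-- evaluation of a polynomial function -/
def polyEval {n : ℕ} (U : Fin n → ℝ × ℝ) : polyFun n →+* ℝ :=
  (Pi.evalRingHom (fun _ => ℝ) U).comp (polyFun n).subtype

/-- the tuples of points of the square -/
def tuples (n : ℕ) : Set (Fin n → ℝ × ℝ) := {U | ∀ k, U k ∈ uSq}

lemma exists_bound {n : ℕ} {ι : Type*} [Finite ι] {f : ι → (Fin n → ℝ × ℝ) → ℝ}
    (h : ∀ a, IsPoly (f a)) : ∃ C : ℝ, 1 ≤ C ∧ ∀ a, ∀ U ∈ tuples n, |f a U| ≤ C := by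
  cases nonempty_fintype ι
  have hc : IsCompact (tuples n) := by
    have : tuples n = Set.univ.pi fun _ => uSq := by ext U; simp [tuples]
    rw [this]
    exact isCompact_univ_pi fun _ => isCompact_uSq
  have : ∀ a, ∃ C : ℝ, ∀ U ∈ tuples n, |f a U| ≤ C := by
    intro a
    obtain ⟨C, hC⟩ := hc.exists_bound_of_continuousOn (h a).continuous.continuousOn
    exact ⟨C, hC⟩
  choose C hC using this
  have h0 : 0 ≤ ∑ a, |C a| := Finset.sum_nonneg fun a _ => abs_nonneg (C a)
  refine ⟨1 + ∑ a, |C a|, by linarith, fun a U hU => ?_⟩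
  have := Finset.single_le_sum (f := fun a => |C a|) (fun a _ => abs_nonneg _) (Finset.mem_univ a)
  linarith [hC a U hU, le_abs_self (C a)]

end Sublevel

namespace Jet
open Sublevel

section Poly

variable {n : ℕ}

lemma isPoly_J (i : Fin 2) {f g : (Fin n → ℝ × ℝ) → ℝ} (hf : Sublevel.IsPoly f)
    (hg : Sublevel.IsPoly g)
    (m k : Fin 9) : Sublevel.IsPoly fun U => J i (f U, g U) m k := by
  have h : (fun U => J i (f U, g U) m k) =
      (J i ((⟨f, hf⟩, ⟨g, hg⟩) : polyFun n × polyFun n) m k : polyFun n).1 := by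
    ext U
    exact (J_map (polyEval U) i ((⟨f, hf⟩, ⟨g, hg⟩) : polyFun n × polyFun n) m k).symm
  rw [h]
  exact Subtype.prop _

lemma isPoly_J_apply (i : Fin 2) (a : Fin n) (m k : Fin 9) :
    Sublevel.IsPoly fun U => J i (U a) m k := isPoly_J i (.fst a) (.snd a) m k

lemma isPoly_J_neg_apply (i : Fin 2) (a : Fin n) (m k : Fin 9) :
    Sublevel.IsPoly fun U => J i (-(U a)) m k :=
  isPoly_J i (Sublevel.IsPoly.fst a).neg (Sublevel.IsPoly.snd a).neg m k

lemma isPoly_pairMat (i : Fin 2) (a b : Fin n) (m k : Fin 9) :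
    Sublevel.IsPoly fun U => pairMat i (U a) (U b) m k := by
  simp only [pairMat, Matrix.of_apply]
  have h : ∀ c : Fin n, Sublevel.IsPoly fun U : Fin n → ℝ × ℝ =>
      J i (U c) (![0, 1, 2, 3, 4, 5, 0, 1, 2] m) k := fun c => isPoly_J_apply i c _ k
  have h' : ∃ c : Fin n, ∀ U : Fin n → ℝ × ℝ,
      (![U a, U a, U a, U a, U a, U a, U b, U b, U b] : Fin 9 → ℝ × ℝ) m = U c := by
    by_cases hm : m < 6
    · exact ⟨a, fun U => by revert hm; revert m; simp [Fin.forall_fin_succ]⟩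
    · exact ⟨b, fun U => by revert hm; revert m; simp [Fin.forall_fin_succ]⟩
  obtain ⟨c, hc⟩ := h'
  simp only [hc]
  exact h c

lemma isPoly_adjugate_pairMat (i : Fin 2) (a b : Fin n) (m k : Fin 9) :
    Sublevel.IsPoly fun U => (pairMat i (U a) (U b)).adjugate m k :=
  Sublevel.IsPoly.adjugate (M := fun U : Fin n → ℝ × ℝ => pairMat i (U a) (U b))
    (fun m k => isPoly_pairMat i a b m k) m k

lemma isPoly_tripleMat (i : Fin 2) (m k : Fin 9) : Sublevel.IsPoly fun U => tripleMat i U m k := by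
  simp only [tripleMat, Matrix.of_apply]
  exact isPoly_adjugate_pairMat i _ _ m _

lemma isPoly_topMat (i : Fin 2) (m k : Fin 9) : Sublevel.IsPoly fun U => topMat i U m k :=
  isPoly_J_neg_apply i k m 8

lemma isPoly_evalMat (i : Fin 2) (m k : Fin 9) : Sublevel.IsPoly fun U => evalMat i U m k :=
  isPoly_J_apply i _ _ k

end Poly

/-- the tuples at which none of the relevant determinants is small -/
structure Good (i : Fin 2) (θ : ℝ) (U : Fin 9 → ℝ × ℝ) : Prop where
  pair : ∀ a b, a ≠ b → θ < |(pairMat i (U a) (U b)).det|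
  triple : ∀ e : Fin 6 ↪ Fin 9, θ < |(tripleMat i (U ∘ e)).det|
  top : θ < |(topMat i U).det|
  eval : ∀ e : Fin 7 ↪ Fin 9, θ < |(evalMat i (U ∘ e)).det|

lemma exists_comp_of_embedding {n : ℕ} {g : (Fin n → ℝ × ℝ) → ℝ} (e : Fin n ↪ Fin 9)
    (h : ∃ U, g U ≠ 0) : ∃ U : Fin 9 → ℝ × ℝ, g (U ∘ e) ≠ 0 := by
  obtain ⟨U, hU⟩ := h
  refine ⟨Function.extend e U 0, ?_⟩
  rwa [show Function.extend e U 0 ∘ e = U from funext fun k => e.injective.extend_apply U 0 k]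

lemma tupMeas_not_good_le (i : Fin 2) : ∃ C c : ℝ, 0 < C ∧ 0 < c ∧ ∀ θ : ℝ, 0 < θ → θ ≤ 1 →
    tupMeas 9 {U | ¬ Good i θ U} ≤ ENNReal.ofReal (C * θ ^ c) := by
  let ι := {p : Fin 9 × Fin 9 // p.1 ≠ p.2} ⊕ (Fin 6 ↪ Fin 9) ⊕ Unit ⊕ (Fin 7 ↪ Fin 9)
  let f : ι → (Fin 9 → ℝ × ℝ) → ℝ := fun x U => match x with
    | .inl p => (pairMat i (U p.1.1) (U p.1.2)).det
    | .inr (.inl e) => (tripleMat i (U ∘ e)).det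
    | .inr (.inr (.inl _)) => (topMat i U).det
    | .inr (.inr (.inr e)) => (evalMat i (U ∘ e)).det
  have hf : ∀ x, Sublevel.IsPoly (f x) := by
    rintro (p | e | _ | e)
    · exact Sublevel.IsPoly.det fun m k => isPoly_pairMat i _ _ m k
    · exact (Sublevel.IsPoly.det fun m k => isPoly_tripleMat i m k).comp_perm e
    · exact Sublevel.IsPoly.det fun m k => isPoly_topMat i m k
    · exact (Sublevel.IsPoly.det fun m k => isPoly_evalMat i m k).comp_perm e
  have h0 : ∀ x, ∃ U, f x U ≠ 0 := by
    rintro (⟨⟨a, b⟩, hab⟩ | e | _ | e)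
    · obtain ⟨u, v, h⟩ := exists_det_pairMat i
      refine ⟨fun k => if k = a then (u.1, u.2) else (v.1, v.2), ?_⟩
      have := det_map_ne_zero h
      rw [pairMat_map] at this
      have hba : b ≠ a := Ne.symm hab
      simpa [f, hba] using this
    · obtain ⟨P, h⟩ := exists_det_tripleMat i
      have := det_map_ne_zero h
      rw [tripleMat_map] at this
      exact exists_comp_of_embedding (g := fun U => (tripleMat i U).det) e ⟨_, this⟩
    · obtain ⟨P, h⟩ := exists_det_topMat i
      have := det_map_ne_zero h
      rw [topMat_map] at this
      exact ⟨_, this⟩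
    · obtain ⟨P, h⟩ := exists_det_evalMat i
      have := det_map_ne_zero h
      rw [evalMat_map] at this
      exact exists_comp_of_embedding (g := fun U => (evalMat i U).det) e ⟨_, this⟩
  choose C c hC hc hle using fun x => (hf x).tupMeas_sublevel_le (h0 x)
  have : Nonempty ι := ⟨.inr (.inr (.inl ()))⟩
  obtain ⟨x0, hx0⟩ := Finite.exists_min c
  refine ⟨∑ x, C x, c x0, Finset.sum_pos (fun x _ => hC x) Finset.univ_nonempty, hc x0,
    fun θ h0 h1 => ?_⟩
  have hsub : {U | ¬ Good i θ U} ⊆ ⋃ x, {U | |f x U| ≤ θ} := by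
    intro U hU
    by_contra hcon
    simp only [Set.mem_iUnion, not_exists] at hcon
    refine hU ⟨fun a b hab => ?_, fun e => ?_, ?_, fun e => ?_⟩
    · exact not_le.1 (hcon (.inl ⟨(a, b), hab⟩))
    · exact not_le.1 (hcon (.inr (.inl e)))
    · exact not_le.1 (hcon (.inr (.inr (.inl ()))))
    · exact not_le.1 (hcon (.inr (.inr (.inr e))))
  refine (measure_mono hsub).trans ((measure_iUnion_le _).trans ?_)
  rw [tsum_fintype, Finset.sum_mul, ENNReal.ofReal_sum_of_nonneg
    fun x _ => mul_nonneg (hC x).le (Real.rpow_nonneg h0.le _)]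
  refine Finset.sum_le_sum fun x _ => (hle x θ h0 h1).trans (ENNReal.ofReal_le_ofReal ?_)
  exact mul_le_mul_of_nonneg_left (Real.rpow_le_rpow_of_exponent_ge h0 h1 (hx0 x)) (hC x).le

section Control

lemma abs_dotProduct_le {C ρ : ℝ} {c y : Fin 9 → ℝ} (hc : ∀ k, |c k| ≤ C)
    (hy : ∀ k, c k = 0 ∨ |y k| ≤ ρ) (hρ : 0 ≤ ρ) (hC : 0 ≤ C) : |c ⬝ᵥ y| ≤ 9 * C * ρ := by
  calc |c ⬝ᵥ y| ≤ ∑ k, |c k * y k| := Finset.abs_sum_le_sum_abs _ _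
    _ ≤ ∑ k : Fin 9, C * ρ := by
        refine Finset.sum_le_sum fun k _ => ?_
        rcases hy k with h | h
        · rw [h, zero_mul, abs_zero]; positivity
        · rw [abs_mul]
          exact mul_le_mul (hc k) h (abs_nonneg _) hC
    _ = 9 * C * ρ := by simp; ring

/-- solving a linear equation with a determinant bounded below -/
lemma abs_le_of_det_mul {C ρ θ d x : ℝ} {c y : Fin 9 → ℝ} (hθ : 0 < θ) (hd : θ < |d|)
    (hc : ∀ k, |c k| ≤ C) (hy : ∀ k, c k = 0 ∨ |y k| ≤ ρ) (hρ : 0 ≤ ρ) (hC : 0 ≤ C)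
    (h : d * x = c ⬝ᵥ y) : |x| ≤ 9 * C / θ * ρ := by
  have h1 := abs_dotProduct_le hc hy hρ hC
  rw [← h, abs_mul] at h1
  have h2 : θ * |x| ≤ 9 * C * ρ := (mul_le_mul_of_nonneg_right hd.le (abs_nonneg _)).trans h1
  rw [div_mul_eq_mul_div, le_div_iff₀ hθ]
  linarith

lemma abs_le_of_mulVec {M : Matrix (Fin 9) (Fin 9) ℝ} {C ρ θ : ℝ} {z : Fin 9 → ℝ} (hθ : 0 < θ)
    (hd : θ < |M.det|) (hC : 0 ≤ C) (hM : ∀ a b, |M.adjugate a b| ≤ C) (hρ : 0 ≤ ρ)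
    (hz : ∀ k, |(M *ᵥ z) k| ≤ ρ) (m : Fin 9) : |z m| ≤ 9 * C / θ * ρ := by
  refine abs_le_of_det_mul (c := M.adjugate m) (y := M *ᵥ z) hθ hd (hM m) (fun k => .inr (hz k))
    hρ hC ?_
  have : M.adjugate *ᵥ (M *ᵥ z) = M.det • z := by
    rw [Matrix.mulVec_mulVec, Matrix.adjugate_mul, Matrix.smul_mulVec, Matrix.one_mulVec]
  exact (congrFun this m).symm

lemma abs_le_of_adjugate_mulVec {M : Matrix (Fin 9) (Fin 9) ℝ} {C ρ θ : ℝ} {z : Fin 9 → ℝ}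
    (hθ : 0 < θ) (hd : θ < |M.det|) (hC : 0 ≤ C) (hM : ∀ a b, |M a b| ≤ C) (hρ : 0 ≤ ρ)
    (hz : ∀ k, |(M.adjugate *ᵥ z) k| ≤ ρ) (m : Fin 9) : |z m| ≤ 9 * C / θ * ρ := by
  refine abs_le_of_det_mul (c := M m) (y := M.adjugate *ᵥ z) hθ hd (hM m) (fun k => .inr (hz k))
    hρ hC ?_
  have : M *ᵥ (M.adjugate *ᵥ z) = M.det • z := by
    rw [Matrix.mulVec_mulVec, Matrix.mul_adjugate, Matrix.smul_mulVec, Matrix.one_mulVec]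
  exact (congrFun this m).symm

variable (i : Fin 2)

lemma exists_jet_bound : ∃ C : ℝ, 1 ≤ C ∧ ∀ u ∈ uSq, ∀ ρ, 0 ≤ ρ → ∀ z : Fin 9 → ℝ,
    (∀ m, |z m| ≤ ρ) → ∀ m, |(J i u *ᵥ z) m| ≤ C * ρ := by
  obtain ⟨C, hC, h⟩ := exists_bound (n := 1) (ι := Fin 9 × Fin 9)
    (f := fun p (U : Fin 1 → ℝ × ℝ) => J i (U 0) p.1 p.2) fun p => isPoly_J_apply i 0 p.1 p.2
  refine ⟨9 * C, by linarith, fun u hu ρ hρ z hz m => ?_⟩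
  exact abs_dotProduct_le (fun k => h (m, k) (fun _ => u) fun _ => hu) (fun k => .inr (hz k)) hρ
    (by linarith)

lemma forall_pair_rows {α : Type*} {y : α → Fin 9 → ℝ} {P : ℝ → Prop} {u v : α}
    (h1 : ∀ m < 6, P (y u m)) (h2 : ∀ m < 3, P (y v m)) (j : Fin 9) :
    P (y (![u, u, u, u, u, u, v, v, v] j) (![0, 1, 2, 3, 4, 5, 0, 1, 2] j)) := by
  fin_cases j
  exacts [h1 0 (by decide), h1 1 (by decide), h1 2 (by decide), h1 3 (by decide),
    h1 4 (by decide), h1 5 (by decide), h2 0 (by decide), h2 1 (by decide), h2 2 (by decide)]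

lemma forall_eval_rows {α : Type*} {y : α → Fin 9 → ℝ} {P : ℝ → Prop} {U : Fin 7 → α}
    (h1 : ∀ k, P (y (U k) 0)) (h2 : P (y (U 0) 1)) (h3 : P (y (U 0) 2)) (j : Fin 9) :
    P (y (U (![0, 1, 2, 3, 4, 5, 6, 0, 0] j)) (![0, 0, 0, 0, 0, 0, 0, 1, 2] j)) := by
  fin_cases j
  exacts [h1 0, h1 1, h1 2, h1 3, h1 4, h1 5, h1 6, h2, h3]

lemma exists_pair_bound : ∃ C : ℝ, 1 ≤ C ∧ ∀ u ∈ uSq, ∀ v ∈ uSq, ∀ θ ρ : ℝ, 0 < θ → 0 ≤ ρ →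
    θ < |(pairMat i u v).det| → ∀ z : Fin 9 → ℝ, (∀ m < 6, |(J i u *ᵥ z) m| ≤ ρ) →
    (∀ m < 3, |(J i v *ᵥ z) m| ≤ ρ) → ∀ m, |z m| ≤ C / θ * ρ := by
  obtain ⟨C, hC, h⟩ := exists_bound (n := 2) (ι := Fin 9 × Fin 9)
    (f := fun p (U : Fin 2 → ℝ × ℝ) => (pairMat i (U 0) (U 1)).adjugate p.1 p.2) fun p =>
      Sublevel.IsPoly.adjugate (fun m k => isPoly_pairMat i _ _ m k) _ _
  refine ⟨9 * C, by linarith, fun u hu v hv θ ρ hθ hρ hd z h1 h2 => ?_⟩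
  refine abs_le_of_mulVec hθ hd (by linarith) (fun a b => h (a, b) ![u, v] fun k => ?_) hρ
    fun k => ?_
  · fin_cases k <;> assumption
  · exact forall_pair_rows (y := fun u => J i u *ᵥ z) (P := fun x => |x| ≤ ρ) h1 h2 k

lemma exists_eval_bound : ∃ C : ℝ, 1 ≤ C ∧ ∀ U ∈ tuples 7, ∀ θ ρ : ℝ, 0 < θ → 0 ≤ ρ →
    θ < |(evalMat i U).det| → ∀ z : Fin 9 → ℝ, (∀ k, |(J i (U k) *ᵥ z) 0| ≤ ρ) →
    |(J i (U 0) *ᵥ z) 1| ≤ ρ → |(J i (U 0) *ᵥ z) 2| ≤ ρ → ∀ m, |z m| ≤ C / θ * ρ := by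
  obtain ⟨C, hC, h⟩ := exists_bound (n := 7) (ι := Fin 9 × Fin 9)
    (f := fun p U => (evalMat i U).adjugate p.1 p.2) fun p =>
      Sublevel.IsPoly.adjugate (fun m k => isPoly_evalMat i m k) _ _
  refine ⟨9 * C, by linarith, fun U hU θ ρ hθ hρ hd z h1 h2 h3 => ?_⟩
  refine abs_le_of_mulVec hθ hd (by linarith) (fun a b => h (a, b) U hU) hρ fun k => ?_
  exact forall_eval_rows (y := fun u => J i u *ᵥ z) (P := fun x => |x| ≤ ρ) h1 h2 h3 k

lemma mulVec_eq_mul_jet (M : Matrix (Fin 9) (Fin 9) ℝ) (u : ℝ × ℝ) (z : Fin 9 → ℝ) :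
    M *ᵥ z = (M * J i (-u)) *ᵥ (J i u *ᵥ z) := by
  rw [← Matrix.mulVec_mulVec, jet_neg_mulVec]

lemma exists_top_bound : ∃ C : ℝ, 1 ≤ C ∧ ∀ U ∈ tuples 9,
    (∀ p ρ, 0 ≤ ρ → ∀ z : Fin 9 → ℝ, (∀ m < 8, |(J i (U p) *ᵥ z) m| ≤ ρ) →
      ∀ q, q ≠ p → |((topMat i U).adjugate *ᵥ z) q| ≤ C * ρ) ∧
    ∀ θ ρ : ℝ, 0 < θ → 0 ≤ ρ → θ < |(topMat i U).det| → ∀ z : Fin 9 → ℝ,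
      (∀ q, |((topMat i U).adjugate *ᵥ z) q| ≤ ρ) → ∀ m, |z m| ≤ C / θ * ρ := by
  obtain ⟨C, hC, h⟩ := exists_bound (n := 9) (ι := Fin 9 × Fin 9)
    (f := fun p U => topMat i U p.1 p.2) fun p => isPoly_topMat i _ _
  obtain ⟨C', hC', h'⟩ := exists_bound (n := 9) (ι := Fin 9 × Fin 9 × Fin 9)
    (f := fun p U => ((topMat i U).adjugate * J i (-(U p.1))) p.2.1 p.2.2) fun p => by
      simp only [Matrix.mul_apply]
      exact Sublevel.IsPoly.sum _ fun k _ =>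
        (Sublevel.IsPoly.adjugate (fun m k => isPoly_topMat i m k) _ _).mul
        (isPoly_J_neg_apply i _ _ _)
  refine ⟨9 * max C C', by linarith [le_max_left C C'], fun U hU => ⟨fun p ρ hρ z hz q hqp => ?_,
    fun θ ρ hθ hρ hd z hz m => ?_⟩⟩
  · rw [mulVec_eq_mul_jet i _ (U p)]
    refine abs_dotProduct_le (fun k => (h' (p, q, k) U hU).trans (le_max_right _ _)) (fun k => ?_)
      hρ (by linarith [le_max_left C C'])
    by_cases hk : k < 8
    · exact .inr (hz k hk)
    · have hk8 : k = 8 := by omega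
      left
      have : ((topMat i U).adjugate * topMat i U) q p = 0 := by
        rw [Matrix.adjugate_mul, Matrix.smul_apply, Matrix.one_apply_ne hqp, smul_zero]
      rw [hk8]
      exact this
  · exact abs_le_of_adjugate_mulVec hθ hd (by linarith [le_max_left C C'])
      (fun a b => (h (a, b) U hU).trans (le_max_left _ _)) hρ hz m

/-- the first point of each pair -/
def fstPt : Fin 3 → Fin 6 := ![0, 2, 4]

/-- the second point of each pair -/
def sndPt : Fin 3 → Fin 6 := ![1, 3, 5]

/-- the column attached to a pair and to one of its three vectors -/
def col : Fin 3 → Fin 3 → Fin 9 := ![![0, 1, 2], ![3, 4, 5], ![6, 7, 8]]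

lemma exists_col (c : Fin 9) : ∃ p k, col p k = c := by
  revert c; decide

lemma col_ne : ∀ p k q l, q ≠ p → col q k ≠ col p l := by decide

lemma tripleMat_col (U : Fin 6 → ℝ × ℝ) (p k : Fin 3) (m : Fin 9) :
    tripleMat i U m (col p k) =
      (pairMat i (U (fstPt p)) (U (sndPt p))).adjugate m (![3, 4, 5] k) := by
  have h1 : ∀ p k, (![0, 0, 0, 2, 2, 2, 4, 4, 4] : Fin 9 → Fin 6) (col p k) = fstPt p := by decide
  have h2 : ∀ p k, (![1, 1, 1, 3, 3, 3, 5, 5, 5] : Fin 9 → Fin 6) (col p k) = sndPt p := by decide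
  have h3 : ∀ p k, (![3, 4, 5, 3, 4, 5, 3, 4, 5] : Fin 9 → Fin 9) (col p k) = ![3, 4, 5] k := by
    decide
  rw [tripleMat, Matrix.of_apply, h1, h2, h3]

lemma pairMat_row (u v : ℝ × ℝ) (j : Fin 9) : pairMat i u v j =
    J i (![u, u, u, u, u, u, v, v, v] j) (![0, 1, 2, 3, 4, 5, 0, 1, 2] j) := rfl

lemma pairMat_row_fst (u v : ℝ × ℝ) {m : Fin 9} (hm : m < 3) :
    m ∉ Set.range ![3, 4, 5] ∧ pairMat i u v m = J i u m := by
  rw [pairMat_row]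
  have : m = 0 ∨ m = 1 ∨ m = 2 := by revert hm; revert m; decide
  rcases this with rfl | rfl | rfl <;> simp

lemma pairMat_row_snd (u v : ℝ × ℝ) {m : Fin 9} (hm : m < 3) :
    m + 6 ∉ Set.range ![3, 4, 5] ∧ pairMat i u v (m + 6) = J i v m := by
  rw [pairMat_row]
  have : m = 0 ∨ m = 1 ∨ m = 2 := by revert hm; revert m; decide
  rcases this with rfl | rfl | rfl <;> simp

lemma pair_row_cases (u v : ℝ × ℝ) {j : Fin 9} (hj : ¬∃ l, j = ![3, 4, 5] l) :
    (∃ m < 3, pairMat i u v j = J i u m) ∨ ∃ m < 3, pairMat i u v j = J i v m := by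
  by_cases h : j < 3
  · exact .inl ⟨j, h, (pairMat_row_fst i u v h).2⟩
  · right
    have : ∃ m : Fin 9, m < 3 ∧ j = m + 6 := by revert hj h; revert j; decide
    obtain ⟨m, hm, rfl⟩ := this
    exact ⟨m, hm, (pairMat_row_snd i u v hm).2⟩

lemma exists_triple_bound : ∃ C : ℝ, 1 ≤ C ∧ ∀ U ∈ tuples 6,
    (∀ p, ∀ θ ρ : ℝ, 0 < θ → 0 ≤ ρ → θ < |(pairMat i (U (fstPt p)) (U (sndPt p))).det| →
      ∀ z : Fin 9 → ℝ, (∀ m < 3, |(J i (U (fstPt p)) *ᵥ z) m| ≤ ρ) →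
      (∀ m < 3, |(J i (U (sndPt p)) *ᵥ z) m| ≤ ρ) →
      ∀ q, q ≠ p → ∀ k, |((tripleMat i U).adjugate *ᵥ z) (col q k)| ≤ C / θ * ρ) ∧
    ∀ θ ρ : ℝ, 0 < θ → 0 ≤ ρ → θ < |(tripleMat i U).det| → ∀ z : Fin 9 → ℝ,
      (∀ q, |((tripleMat i U).adjugate *ᵥ z) q| ≤ ρ) → ∀ m, |z m| ≤ C / θ * ρ := by
  obtain ⟨C, hC, h⟩ := exists_bound (n := 6) (ι := Fin 9 × Fin 9)
    (f := fun p U => tripleMat i U p.1 p.2) fun p => isPoly_tripleMat i _ _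
  obtain ⟨C', hC', h'⟩ := exists_bound (n := 6) (ι := Fin 3 × Fin 9 × Fin 9)
    (f := fun p U => ((tripleMat i U).adjugate *
      (pairMat i (U (fstPt p.1)) (U (sndPt p.1))).adjugate) p.2.1 p.2.2) fun p => by
      simp only [Matrix.mul_apply]
      exact Sublevel.IsPoly.sum _ fun k _ =>
        (Sublevel.IsPoly.adjugate (fun m k => isPoly_tripleMat i m k) _ _).mul
        (Sublevel.IsPoly.adjugate (fun m k => isPoly_pairMat i _ _ m k) _ _)
  refine ⟨9 * max C C', by linarith [le_max_left C C'],
    fun U hU => ⟨fun p θ ρ hθ hρ hd z h1 h2 q hqp k => ?_, fun θ ρ hθ hρ hd z hz m => ?_⟩⟩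
  · set G := pairMat i (U (fstPt p)) (U (sndPt p)) with hG
    refine abs_le_of_det_mul (c := ((tripleMat i U).adjugate * G.adjugate) (col q k))
      (y := G *ᵥ z) hθ hd (fun j => (h' (p, col q k, j) U hU).trans (le_max_right _ _))
      (fun j => ?_) hρ (by linarith [le_max_left C C']) ?_
    · have h0 : ∀ l, ((tripleMat i U).adjugate * G.adjugate) (col q k) (![3, 4, 5] l) = 0 := by
        intro l
        have : ((tripleMat i U).adjugate * tripleMat i U) (col q k) (col p l) = 0 := by
          rw [Matrix.adjugate_mul, Matrix.smul_apply, Matrix.one_apply_ne (col_ne _ _ _ _ hqp),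
            smul_zero]
        rw [← this, Matrix.mul_apply, Matrix.mul_apply]
        exact Finset.sum_congr rfl fun m _ => by rw [tripleMat_col]
      by_cases hj : ∃ l, j = ![3, 4, 5] l
      · obtain ⟨l, rfl⟩ := hj
        exact .inl (h0 l)
      · right
        rcases pair_row_cases i (U (fstPt p)) (U (sndPt p)) hj with ⟨m, hm, h⟩ | ⟨m, hm, h⟩
        · have : (G *ᵥ z) j = (J i (U (fstPt p)) *ᵥ z) m := by
            rw [Matrix.mulVec, Matrix.mulVec, hG, h]
          rw [this]
          exact h1 m hm
        · have : (G *ᵥ z) j = (J i (U (sndPt p)) *ᵥ z) m := by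
            rw [Matrix.mulVec, Matrix.mulVec, hG, h]
          rw [this]
          exact h2 m hm
    · have : ((tripleMat i U).adjugate * G.adjugate) *ᵥ (G *ᵥ z) =
          G.det • ((tripleMat i U).adjugate *ᵥ z) := by
        rw [Matrix.mulVec_mulVec, Matrix.mul_assoc, Matrix.adjugate_mul, Matrix.mul_smul,
          Matrix.mul_one, Matrix.smul_mulVec]
      exact (congrFun this _).symm
  · exact abs_le_of_adjugate_mulVec hθ hd (by linarith [le_max_left C C'])
      (fun a b => (h (a, b) U hU).trans (le_max_left _ _)) hρ hz m

lemma abs_dual_le {ρ : ℝ} {z : Fin 9 → ℝ} (hρ : 0 ≤ ρ) (hz : ∀ m < 6, |z m| ≤ ρ) (m : Fin 9)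
    (hm : 3 ≤ m) : |dual i z m| ≤ 16 * ρ := by
  have h0 := hz 0 (by decide)
  have h1 := hz 1 (by decide)
  have h2 := hz 2 (by decide)
  have h3 := hz 3 (by decide)
  have h4 := hz 4 (by decide)
  have h5 := hz 5 (by decide)
  clear hz
  fin_cases i <;> fin_cases m <;> first
    | exact absurd hm (by decide)
    | (simp [dual, abs_mul]; linarith)
    | (simp [dual]; rw [abs_le] at *; constructor <;> linarith)

lemma abs_le_of_dual {ρ : ℝ} {z : Fin 9 → ℝ} (hz : ∀ m, |dual i z m| ≤ ρ) (m : Fin 9) :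
    |z m| ≤ ρ := by
  have h := fun m => abs_le.1 (hz m)
  have h0 := h 0
  have h1 := h 1
  have h2 := h 2
  have h3 := h 3
  have h4 := h 4
  have h5 := h 5
  have h6 := h 6
  have h7 := h 7
  have h8 := h 8
  clear h
  rw [abs_le]
  fin_cases i <;> simp [dual] at h0 h1 h2 h3 h4 h5 h6 h7 h8 <;> fin_cases m <;> simp <;>
    constructor <;> linarith

lemma exists_dual_bound : ∃ C : ℝ, 1 ≤ C ∧ ∀ U ∈ tuples 6,
    (∀ p, ∀ a, a = fstPt p ∨ a = sndPt p → ∀ ρ : ℝ, 0 ≤ ρ → ∀ z : Fin 9 → ℝ,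
      (∀ m < 6, |(J i (U a) *ᵥ z) m| ≤ ρ) →
      ∀ k, |((tripleMat i U)ᵀ *ᵥ dual i z) (col p k)| ≤ C * ρ) ∧
    ∀ θ ρ : ℝ, 0 < θ → 0 ≤ ρ → θ < |(tripleMat i U).det| → ∀ z : Fin 9 → ℝ,
      (∀ q, |((tripleMat i U)ᵀ *ᵥ dual i z) q| ≤ ρ) → ∀ m, |z m| ≤ C / θ * ρ := by
  obtain ⟨C, hC, h⟩ := exists_bound (n := 6) (ι := Fin 9 × Fin 9)
    (f := fun p U => (tripleMat i U).adjugate p.1 p.2) fun p =>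
      Sublevel.IsPoly.adjugate (fun m k => isPoly_tripleMat i m k) _ _
  obtain ⟨C', hC', h'⟩ := exists_bound (n := 6) (ι := Fin 6 × Fin 9 × Fin 9)
    (f := fun p U => (J i (U p.1) * tripleMat i U) p.2.1 p.2.2) fun p => by
      simp only [Matrix.mul_apply]
      exact Sublevel.IsPoly.sum _ fun k _ => (isPoly_J_apply i _ _ _).mul (isPoly_tripleMat i _ _)
  have hm := le_max_left C C'
  refine ⟨144 * max C C', by linarith, fun U hU => ⟨fun p a ha ρ hρ z hz k => ?_,
    fun θ ρ hθ hρ hd z hz m => ?_⟩⟩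
  · have hV : ((tripleMat i U)ᵀ *ᵥ dual i z) (col p k) =
        (fun m => (J i (U a) * tripleMat i U) m (col p k)) ⬝ᵥ dual i (J i (U a) *ᵥ z) := by
      have := dual_invariant i (U a) (fun m => tripleMat i U m (col p k)) z
      exact this.symm
    have h0 : ∀ m < 3, (J i (U a) * tripleMat i U) m (col p k) = 0 := by
      set G := pairMat i (U (fstPt p)) (U (sndPt p)) with hG
      have key : ∀ j, j ≠ ![3, 4, 5] k → (G * G.adjugate) j (![3, 4, 5] k) = 0 := fun j hj => by
        rw [Matrix.mul_adjugate, Matrix.smul_apply, Matrix.one_apply_ne hj, smul_zero]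
      have key2 : ∀ j, (∑ l, G j l * tripleMat i U l (col p k)) =
          (G * G.adjugate) j (![3, 4, 5] k) := fun j => by
        rw [Matrix.mul_apply]
        exact Finset.sum_congr rfl fun m _ => by rw [tripleMat_col]
      intro m hm
      rw [Matrix.mul_apply]
      have hex : ∃ j, j ≠ ![3, 4, 5] k ∧ G j = J i (U a) m := by
        rcases ha with rfl | rfl
        · obtain ⟨h1, h2⟩ := pairMat_row_fst i (U (fstPt p)) (U (sndPt p)) hm
          exact ⟨m, fun h => h1 ⟨k, h.symm⟩, h2⟩
        · obtain ⟨h1, h2⟩ := pairMat_row_snd i (U (fstPt p)) (U (sndPt p)) hm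
          exact ⟨m + 6, fun h => h1 ⟨k, h.symm⟩, h2⟩
      obtain ⟨j, hj, hGj⟩ := hex
      rw [← hGj, key2, key j hj]
    rw [hV]
    have := abs_dotProduct_le (c := fun m => (J i (U a) * tripleMat i U) m (col p k))
      (y := dual i (J i (U a) *ᵥ z)) (C := max C C') (ρ := 16 * ρ)
      (fun m => (h' (a, m, col p k) U hU).trans (le_max_right _ _)) (fun m => ?_)
      (by linarith) (by linarith)
    · linarith
    · by_cases hm : m < 3
      · exact .inl (h0 m hm)
      · exact .inr (abs_dual_le i hρ hz m (not_lt.1 hm))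
  · refine abs_le_of_dual i (fun m => ?_) m
    have := abs_le_of_mulVec (M := (tripleMat i U)ᵀ) (C := max C C') hθ
      (by rwa [Matrix.det_transpose]) (by linarith)
      (fun a b => by
        rw [← Matrix.adjugate_transpose, Matrix.transpose_apply]
        exact (h (b, a) U hU).trans (le_max_left _ _)) hρ hz m
    refine this.trans (mul_le_mul_of_nonneg_right ?_ hρ)
    gcongr
    linarith

end Control

end Jet

section Markov

/-- Markov's inequality for the number of sets of a finite family containing a point -/
lemma measure_lt_card_le {X ι : Type*} [MeasurableSpace X] (μ : Measure X) (s : Finset ι)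
    (S : ι → Set X) {c : ℝ} (hc : 0 < c) :
    μ {x | c < ((s.filter fun a => x ∈ S a).card : ℝ)} ≤ (∑ a ∈ s, μ (S a)) / ENNReal.ofReal c := by
  let f : X → ENNReal := fun x => ∑ a ∈ s, (toMeasurable μ (S a)).indicator 1 x
  have hf : Measurable f := Finset.measurable_fun_sum _ fun a _ =>
    measurable_one.indicator (measurableSet_toMeasurable _ _)
  have hI : ∫⁻ x, f x ∂μ = ∑ a ∈ s, μ (S a) := by
    rw [lintegral_finsetSum _ fun a _ => measurable_one.indicator (measurableSet_toMeasurable _ _)]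
    exact Finset.sum_congr rfl fun a _ => by
      rw [lintegral_indicator_one (measurableSet_toMeasurable _ _), measure_toMeasurable]
  rw [← hI]
  refine (measure_mono fun x hx => ?_).trans (meas_ge_le_lintegral_div hf.aemeasurable
    (ε := ENNReal.ofReal c) (by simpa using hc) ENNReal.ofReal_ne_top)
  change c < _ at hx
  change ENNReal.ofReal c ≤ f x
  calc ENNReal.ofReal c ≤ ENNReal.ofReal ((s.filter fun a => x ∈ S a).card : ℝ) :=
        ENNReal.ofReal_le_ofReal hx.le
    _ = ((s.filter fun a => x ∈ S a).card : ENNReal) := ENNReal.ofReal_natCast _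
    _ ≤ f x := by
        rw [Finset.card_filter, Nat.cast_sum]
        refine Finset.sum_le_sum fun a _ => ?_
        split_ifs with h
        · rw [Set.indicator_of_mem (subset_toMeasurable _ _ h)]; simp
        · simp

end Markov

section SmallValues

/-- A function with a large derivative wherever it is small is small on a small set only. -/
lemma volume_small_le {f g : ℝ → ℝ} {K τ ρ : ℝ} (hτ : 0 < τ) (hK : τ ≤ K) (hρ : 0 ≤ ρ)
    (h : ∀ t ∈ Set.Icc (-1 : ℝ) 1, ∀ t' ∈ Set.Icc (-1 : ℝ) 1,
      |f t' - f t - g t * (t' - t)| ≤ K * (t' - t) ^ 2) :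
    volume {t ∈ Set.Icc (-1 : ℝ) 1 | |f t| ≤ ρ ∧ τ ≤ |g t|} ≤
      ENNReal.ofReal (20 * K * ρ / τ ^ 2) := by
  have hK0 : 0 < K := hτ.trans_le hK
  set S := {t ∈ Set.Icc (-1 : ℝ) 1 | |f t| ≤ ρ ∧ τ ≤ |g t|} with hS
  let w := τ / (2 * K)
  have hw : 0 < w := by positivity
  let n := ⌊2 / w⌋₊ + 1
  have hcov : S ⊆ ⋃ k ∈ Finset.range n, S ∩ {t | ⌊(t + 1) / w⌋₊ = k} := by
    intro t ht
    simp only [Set.mem_iUnion, Finset.mem_range]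
    refine ⟨⌊(t + 1) / w⌋₊, ?_, ht, rfl⟩
    have : ⌊(t + 1) / w⌋₊ ≤ ⌊2 / w⌋₊ := Nat.floor_mono (by
      gcongr; linarith [ht.1.2])
    omega
  have hpiece : ∀ k, volume (S ∩ {t | ⌊(t + 1) / w⌋₊ = k}) ≤ ENNReal.ofReal (4 * ρ / τ) := by
    intro k
    refine (Real.volume_le_diam _).trans (Metric.ediam_le fun t ht t' ht' => ?_)
    rw [edist_dist, Real.dist_eq]
    refine ENNReal.ofReal_le_ofReal ?_
    obtain ⟨⟨h1, h2, h3⟩, h4⟩ := ht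
    obtain ⟨⟨h1', h2', h3'⟩, h4'⟩ := ht'
    have h4 : ⌊(t + 1) / w⌋₊ = k := h4
    have h4' : ⌊(t' + 1) / w⌋₊ = k := h4'
    have key := h t h1 t' h1'
    rw [abs_sub_comm]
    have e1 : |t' - t| ≤ w := by
      have a1 := Nat.floor_le (a := (t + 1) / w) (div_nonneg (by linarith [h1.1]) hw.le)
      have a2 := Nat.lt_floor_add_one ((t + 1) / w)
      have b1 := Nat.floor_le (a := (t' + 1) / w) (div_nonneg (by linarith [h1'.1]) hw.le)
      have b2 := Nat.lt_floor_add_one ((t' + 1) / w)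
      rw [h4] at a1 a2
      rw [h4'] at b1 b2
      rw [le_div_iff₀ hw] at a1 b1
      rw [div_lt_iff₀ hw] at a2 b2
      rw [abs_le]
      constructor <;> linarith
    have e2 : |g t * (t' - t)| ≤ 2 * ρ + K * (t' - t) ^ 2 := by
      rw [abs_le] at key h2 h2' ⊢
      constructor <;> linarith
    have e3 : K * (t' - t) ^ 2 ≤ τ / 2 * |t' - t| := by
      rw [← sq_abs]
      have : K * |t' - t| ≤ τ / 2 := by
        calc K * |t' - t| ≤ K * w := by gcongr
          _ = τ / 2 := by simp only [w]; field_simp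
      nlinarith [abs_nonneg (t' - t)]
    have e4 : τ * |t' - t| ≤ |g t * (t' - t)| := by
      rw [abs_mul]; gcongr
    rw [le_div_iff₀ hτ]
    linarith
  calc volume S ≤ ∑ k ∈ Finset.range n, volume (S ∩ {t | ⌊(t + 1) / w⌋₊ = k}) :=
        (measure_mono hcov).trans (measure_biUnion_finset_le _ _)
    _ ≤ ∑ k ∈ Finset.range n, ENNReal.ofReal (4 * ρ / τ) := Finset.sum_le_sum fun k _ => hpiece k
    _ = ENNReal.ofReal (n * (4 * ρ / τ)) := by
        rw [Finset.sum_const, Finset.card_range, nsmul_eq_mul, ENNReal.ofReal_mul (by positivity),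
          ENNReal.ofReal_natCast]
    _ ≤ _ := by
        refine ENNReal.ofReal_le_ofReal ?_
        have hn : (n : ℝ) ≤ 5 * K / τ := by
          have := Nat.floor_le (a := 2 / w) (by positivity)
          have h2 : 2 / w = 4 * K / τ := by simp only [w]; field_simp; ring
          have h3 : 1 ≤ K / τ := (one_le_div hτ).2 hK
          have : (n : ℝ) = ⌊2 / w⌋₊ + 1 := by simp [n]
          rw [this, mul_div_assoc]
          rw [mul_div_assoc] at h2
          linarith
        calc (n : ℝ) * (4 * ρ / τ) ≤ 5 * K / τ * (4 * ρ / τ) := by gcongr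
          _ = 20 * K * ρ / τ ^ 2 := by field_simp; ring

lemma volume_le_of_fst_fibre {A : Set (ℝ × ℝ)} (hA : MeasurableSet A) (hAs : A ⊆ uSq) {c : ℝ}
    (h : ∀ s ∈ Set.Icc (-1 : ℝ) 1, volume ((fun t => (t, s)) ⁻¹' A) ≤ ENNReal.ofReal c) :
    volume A ≤ ENNReal.ofReal (2 * c) := by
  rw [Measure.volume_eq_prod, Measure.prod_apply_symm hA]
  calc ∫⁻ s, volume ((fun t => (t, s)) ⁻¹' A)
      ≤ ∫⁻ s, (Set.Icc (-1 : ℝ) 1).indicator (fun _ => ENNReal.ofReal c) s := by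
        refine lintegral_mono fun s => ?_
        by_cases hs : s ∈ Set.Icc (-1 : ℝ) 1
        · simpa [Set.indicator_of_mem hs] using h s hs
        · have : (fun t => (t, s)) ⁻¹' A = ∅ :=
            Set.eq_empty_of_forall_notMem fun t ht => hs (hAs ht).2
          simp [this]
    _ = ENNReal.ofReal (2 * c) := by
        rw [lintegral_indicator measurableSet_Icc, setLIntegral_const, Real.volume_Icc, mul_comm,
          ← ENNReal.ofReal_mul (by norm_num)]
        norm_num

lemma volume_le_of_snd_fibre {A : Set (ℝ × ℝ)} (hA : MeasurableSet A) (hAs : A ⊆ uSq) {c : ℝ}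
    (h : ∀ t ∈ Set.Icc (-1 : ℝ) 1, volume (Prod.mk t ⁻¹' A) ≤ ENNReal.ofReal c) :
    volume A ≤ ENNReal.ofReal (2 * c) := by
  rw [Measure.volume_eq_prod, Measure.prod_apply hA]
  calc ∫⁻ t, volume (Prod.mk t ⁻¹' A)
      ≤ ∫⁻ t, (Set.Icc (-1 : ℝ) 1).indicator (fun _ => ENNReal.ofReal c) t := by
        refine lintegral_mono fun s => ?_
        by_cases hs : s ∈ Set.Icc (-1 : ℝ) 1
        · simpa [Set.indicator_of_mem hs] using h s hs
        · have : Prod.mk s ⁻¹' A = ∅ :=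
            Set.eq_empty_of_forall_notMem fun t ht => hs (hAs ht).1
          simp [this]
    _ = ENNReal.ofReal (2 * c) := by
        rw [lintegral_indicator measurableSet_Icc, setLIntegral_const, Real.volume_Icc, mul_comm,
          ← ENNReal.ofReal_mul (by norm_num)]
        norm_num

end SmallValues

namespace Jet

variable (i : Fin 2)

lemma continuous_J_mulVec (z : Fin 9 → ℝ) (m : Fin 9) :
    Continuous fun u : ℝ × ℝ => (J i u *ᵥ z) m := by
  have h : ∀ k, Continuous fun u : ℝ × ℝ => J i u m k := fun k =>
    (isPoly_J_apply (n := 1) i 0 m k).continuous.comp (continuous_pi fun _ => continuous_id)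
  simp only [mulVec, dotProduct]
  exact continuous_finsetSum _ fun k _ => (h k).mul continuous_const

/-- second order Taylor bound in each variable for a jet -/
lemma taylor_bound (z : Fin 9 → ℝ) (a b r s t : ℝ) (ha : |a| ≤ 1) (hb : |b| ≤ 1) (hr : |r| ≤ 1)
    (hs : |s| ≤ 1) (ht : |t| ≤ 1) :
    |(jet a b (t, s) *ᵥ z) 0 - (jet a b (r, s) *ᵥ z) 0 - (jet a b (r, s) *ᵥ z) 1 * (t - r)| ≤
        50 * ‖z‖ * (t - r) ^ 2 ∧
    |(jet a b (s, t) *ᵥ z) 0 - (jet a b (s, r) *ᵥ z) 0 - (jet a b (s, r) *ᵥ z) 2 * (t - r)| ≤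
        50 * ‖z‖ * (t - r) ^ 2 := by
  have hz : ∀ m, |z m| ≤ ‖z‖ := fun m => norm_le_pi_norm z m
  have hmul : ∀ {x y X Y : ℝ}, |x| ≤ X → |y| ≤ Y → |x * y| ≤ X * Y := fun {x y X Y} hx hy => by
    rw [abs_mul]; exact mul_le_mul hx hy (abs_nonneg _) ((abs_nonneg _).trans hx)
  have hadd : ∀ {x y X Y : ℝ}, |x| ≤ X → |y| ≤ Y → |x + y| ≤ X + Y := fun {x y X Y} hx hy =>
    (abs_add_le _ _).trans (add_le_add hx hy)
  have h2 : |(2 : ℝ)| ≤ 2 := by norm_num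
  have hn : |a * (r * r + s * s) + b * (r * s)| ≤ 3 := by
    simpa using (hadd (hmul ha (hadd (hmul hr hr) (hmul hs hs))) (hmul hb (hmul hr hs))).trans
      (by norm_num)
  have hp : |2 * (a * r) + b * s| ≤ 3 := by
    simpa using (hadd (hmul h2 (hmul ha hr)) (hmul hb hs)).trans (by norm_num)
  have hh : |t - r| ≤ 2 := by
    rw [abs_le] at *; constructor <;> linarith
  set n := a * (r * r + s * s) + b * (r * s) with hn'
  set p := 2 * (a * r) + b * s with hp'
  have hA : |p + a * r + a * (t - r)| ≤ 6 :=
    (hadd (hadd hp (hmul ha hr)) (hmul ha hh)).trans (by norm_num)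
  have hB : |a * s| ≤ 1 := (hmul ha hs).trans (by norm_num)
  have hD : |p * p + 2 * (n * a) + 2 * (p * a) * (t - r) + a * (t - r) * (a * (t - r))| ≤ 31 :=
    (hadd (hadd (hadd (hmul hp hp) (hmul h2 (hmul hn ha))) (hmul (hmul h2 (hmul hp ha)) hh))
      (hmul (hmul ha hh) (hmul ha hh))).trans (by norm_num)
  have hfin : ∀ k l m q : Fin 9, |z k + z l * (p + a * r + a * (t - r)) + z m * (a * s) +
      z q * (p * p + 2 * (n * a) + 2 * (p * a) * (t - r) + a * (t - r) * (a * (t - r)))| *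
      (t - r) ^ 2 ≤ 50 * ‖z‖ * (t - r) ^ 2 := fun k l m q => by
    refine mul_le_mul_of_nonneg_right ?_ (sq_nonneg _)
    refine (hadd (hadd (hadd (hz k) (hmul (hz l) hA)) (hmul (hz m) hB)) (hmul (hz q) hD)).trans ?_
    nlinarith [norm_nonneg z]
  have habs : ∀ x : ℝ, |x| * (t - r) ^ 2 = |x * (t - r) ^ 2| := fun x => by
    rw [abs_mul, abs_of_nonneg (sq_nonneg (t - r))]
  constructor
  · refine le_trans (le_of_eq ?_) (hfin 3 6 7 8)
    rw [habs]
    congr 1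
    rw [jet_mulVec, jet_mulVec]
    simp only [cons_val_zero, cons_val_one, hp', hn']
    ring
  · refine le_trans (le_of_eq ?_) (hfin 5 7 6 8)
    rw [habs]
    congr 1
    rw [jet_mulVec, jet_mulVec]
    simp only [cons_val_zero, cons_val_two, tail_cons, head_cons, hp', hn']
    ring

lemma taylor_J (z : Fin 9 → ℝ) {r s t : ℝ} (hr : |r| ≤ 1) (hs : |s| ≤ 1) (ht : |t| ≤ 1) :
    |(J i (t, s) *ᵥ z) 0 - (J i (r, s) *ᵥ z) 0 - (J i (r, s) *ᵥ z) 1 * (t - r)| ≤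
        50 * ‖z‖ * (t - r) ^ 2 ∧
    |(J i (s, t) *ᵥ z) 0 - (J i (s, r) *ᵥ z) 0 - (J i (s, r) *ᵥ z) 2 * (t - r)| ≤
        50 * ‖z‖ * (t - r) ^ 2 :=
  taylor_bound z _ _ r s t (by split_ifs <;> norm_num) (by split_ifs <;> norm_num) hr hs ht

lemma volume_small_eval_le (z : Fin 9 → ℝ) (hz : z ≠ 0) {θ ρ : ℝ} (hθ : 0 < θ) (hθ1 : θ ≤ 1)
    (hρ : 0 ≤ ρ) :
    volume {u ∈ uSq | |(J i u *ᵥ z) 0| ≤ ρ ∧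
      (θ * ‖z‖ ≤ |(J i u *ᵥ z) 1| ∨ θ * ‖z‖ ≤ |(J i u *ᵥ z) 2|)} ≤
      ENNReal.ofReal (4000 * ρ / (θ ^ 2 * ‖z‖)) := by
  have hz0 : 0 < ‖z‖ := norm_pos_iff.2 hz
  have hτ : 0 < θ * ‖z‖ := by positivity
  have hK : θ * ‖z‖ ≤ 50 * ‖z‖ := by nlinarith
  have hc : 20 * (50 * ‖z‖) * ρ / (θ * ‖z‖) ^ 2 = 1000 * ρ / (θ ^ 2 * ‖z‖) := by
    field_simp; ring
  have hm : ∀ m, MeasurableSet {u ∈ uSq | |(J i u *ᵥ z) 0| ≤ ρ ∧ θ * ‖z‖ ≤ |(J i u *ᵥ z) m|} := by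
    intro m
    refine Sublevel.measurableSet_uSq.inter (IsClosed.measurableSet ?_)
    exact (isClosed_le (continuous_J_mulVec i z 0).abs continuous_const).inter
      (isClosed_le continuous_const (continuous_J_mulVec i z m).abs)
  have h1 := volume_le_of_fst_fibre (hm 1) (fun u hu => hu.1)
    (c := 1000 * ρ / (θ ^ 2 * ‖z‖)) fun s hs => by
      rw [← hc]
      refine (measure_mono fun t ht => ?_).trans
        (volume_small_le (f := fun t => (J i (t, s) *ᵥ z) 0)
        (g := fun t => (J i (t, s) *ᵥ z) 1) hτ hK hρ fun t ht t' ht' =>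
          (taylor_J i z (abs_le.2 ht) (abs_le.2 hs) (abs_le.2 ht')).1)
      exact ⟨ht.1.1, ht.2⟩
  have h2 := volume_le_of_snd_fibre (hm 2) (fun u hu => hu.1)
    (c := 1000 * ρ / (θ ^ 2 * ‖z‖)) fun s hs => by
      rw [← hc]
      refine (measure_mono fun t ht => ?_).trans
        (volume_small_le (f := fun t => (J i (s, t) *ᵥ z) 0)
        (g := fun t => (J i (s, t) *ᵥ z) 2) hτ hK hρ fun t ht t' ht' =>
          (taylor_J i z (abs_le.2 ht) (abs_le.2 hs) (abs_le.2 ht')).2)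
      exact ⟨ht.1.2, ht.2⟩
  refine (measure_mono (t := {u ∈ uSq | |(J i u *ᵥ z) 0| ≤ ρ ∧ θ * ‖z‖ ≤ |(J i u *ᵥ z) 1|} ∪
    {u ∈ uSq | |(J i u *ᵥ z) 0| ≤ ρ ∧ θ * ‖z‖ ≤ |(J i u *ᵥ z) 2|}) ?_).trans
      ((measure_union_le _ _).trans ((add_le_add h1 h2).trans ?_))
  · rintro u ⟨hu, h, h' | h'⟩
    exacts [.inl ⟨hu, h, h'⟩, .inr ⟨hu, h, h'⟩]
  · rw [← ENNReal.ofReal_add (by positivity) (by positivity)]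
    refine ENNReal.ofReal_le_ofReal (le_of_eq ?_)
    ring

end Jet

namespace Sublevel

lemma tupMeas_forall_mem_le {m n : ℕ} (e : Fin m ↪ Fin n) (A : Set (ℝ × ℝ)) :
    tupMeas n {U | ∀ k, U (e k) ∈ A} ≤ 4 ^ n * (volume.restrict uSq A) ^ m := by
  have h : {U : Fin n → ℝ × ℝ | ∀ k, U (e k) ∈ A} ⊆
      Set.univ.pi fun j => if j ∈ Finset.univ.map e then A else Set.univ := by
    intro U hU j _
    dsimp only
    split_ifs with hj
    · obtain ⟨k, -, rfl⟩ := Finset.mem_map.1 hj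
      exact hU k
    · trivial
  refine (measure_mono h).trans ?_
  have hle : ∀ j : Fin n, (volume.restrict uSq)
      (if j ∈ Finset.univ.map e then A else Set.univ) ≤
      4 * (if j ∈ Finset.univ.map e then volume.restrict uSq A else 1) := by
    intro j
    split_ifs
    · exact le_mul_of_one_le_left zero_le (by norm_num)
    · rw [Measure.restrict_apply_univ, volume_uSq]; simp
  rw [tupMeas, Measure.pi_pi]
  refine (Finset.prod_le_prod' fun j _ => hle j).trans (le_of_eq ?_)
  rw [Finset.prod_mul_distrib, Finset.prod_const, Finset.card_univ, Fintype.card_fin,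
    Finset.prod_ite_mem, Finset.univ_inter, Finset.prod_const, Finset.card_map, Finset.card_univ,
    Fintype.card_fin]

lemma tupMeas_inter_tuples (n : ℕ) (S : Set (Fin n → ℝ × ℝ)) :
    tupMeas n (S ∩ tuples n) = tupMeas n S := by
  have h : tuples n = Set.univ.pi fun _ => uSq := by ext U; simp [tuples]
  have hm : MeasurableSet (Set.univ.pi fun _ : Fin n => uSq) :=
    MeasurableSet.univ_pi fun _ => measurableSet_uSq
  rw [tupMeas_eq, h, Measure.restrict_apply' hm, Measure.restrict_apply' hm, Set.inter_assoc,
    Set.inter_self]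

end Sublevel

namespace Jet

variable (i : Fin 2)

lemma exists_eval_measure_bound : ∃ C : ℝ, 1 ≤ C ∧ ∀ θ ρ : ℝ, 0 < θ → θ ≤ 1 → 0 < ρ →
    ∀ e : Fin 7 ↪ Fin 9, ∀ z : Fin 9 → ℝ,
    Sublevel.tupMeas 9 {U | Good i θ U ∧ ∀ k, |(J i (U (e k)) *ᵥ z) 0| ≤ ρ} ≤
      ENNReal.ofReal (C / θ ^ 14 * (ρ / max ‖z‖ ρ) ^ 7) := by
  obtain ⟨C₁, hC₁, h⟩ := exists_eval_bound i
  have hC₁0 : 0 < C₁ := by linarith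
  refine ⟨4 ^ 9 * (4000 * C₁ ^ 2) ^ 7, ?_, fun θ ρ hθ hθ1 hρ e z => ?_⟩
  · have : (1 : ℝ) ≤ C₁ ^ 2 := by nlinarith
    have : (1 : ℝ) ≤ (4000 * C₁ ^ 2) ^ 7 := one_le_pow₀ (by nlinarith)
    nlinarith
  have hmax : 0 < max ‖z‖ ρ := lt_max_of_lt_right hρ
  by_cases hz : C₁ / θ * ρ < ‖z‖
  · have hz0 : z ≠ 0 := by
      rintro rfl
      rw [norm_zero] at hz
      exact absurd hz (not_lt.2 (by positivity))
    have hmz : max ‖z‖ ρ = ‖z‖ := by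
      refine max_eq_left (le_trans ?_ hz.le)
      have : 1 ≤ C₁ / θ := (one_le_div hθ).2 (hθ1.trans hC₁)
      nlinarith
    have hz1 : 0 < ‖z‖ := norm_pos_iff.2 hz0
    set A := {u ∈ uSq | |(J i u *ᵥ z) 0| ≤ ρ ∧
      (θ / C₁ * ‖z‖ ≤ |(J i u *ᵥ z) 1| ∨ θ / C₁ * ‖z‖ ≤ |(J i u *ᵥ z) 2|)} with hA
    have hAm : volume.restrict uSq A ≤ ENNReal.ofReal (4000 * ρ / ((θ / C₁) ^ 2 * ‖z‖)) :=
      (Measure.restrict_apply_le _ _).trans (volume_small_eval_le i z hz0 (by positivity)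
        ((div_le_one hC₁0).2 (hθ1.trans hC₁)) hρ.le)
    rw [← Sublevel.tupMeas_inter_tuples]
    refine (measure_mono ?_).trans ((Sublevel.tupMeas_forall_mem_le e A).trans ?_)
    · rintro U ⟨⟨hg, hU⟩, hUt⟩ k
      refine ⟨hUt _, hU k, ?_⟩
      by_contra! hlt
      let e' : Fin 7 ↪ Fin 9 := (Equiv.swap 0 k).toEmbedding.trans e
      have he0 : e' 0 = e k := by simp [e']
      obtain ⟨η, hη, h1, h2⟩ : ∃ η < θ / C₁ * ‖z‖, |(J i (U (e k)) *ᵥ z) 1| ≤ η ∧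
          |(J i (U (e k)) *ᵥ z) 2| ≤ η :=
        ⟨_, max_lt hlt.1 hlt.2, le_max_left _ _, le_max_right _ _⟩
      have hb := h (U ∘ e') (fun k => hUt _) θ (max ρ η) hθ (hρ.le.trans (le_max_left _ _))
        (hg.eval e') z (fun j => (hU _).trans (le_max_left _ _))
        (by rw [Function.comp_apply, he0]; exact h1.trans (le_max_right _ _))
        (by rw [Function.comp_apply, he0]; exact h2.trans (le_max_right _ _))
      have hzn : ‖z‖ ≤ C₁ / θ * max ρ η := (pi_norm_le_iff_of_nonneg (mul_nonneg (by positivity)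
        (hρ.le.trans (le_max_left _ _)))).2 hb
      refine absurd hzn (not_le.2 ?_)
      rcases max_choice ρ η with hm | hm <;> rw [hm]
      · exact hz
      · calc C₁ / θ * η < C₁ / θ * (θ / C₁ * ‖z‖) := by gcongr
          _ = ‖z‖ := by field_simp
    · calc (4 : ENNReal) ^ 9 * (volume.restrict uSq A) ^ 7
          ≤ 4 ^ 9 * (ENNReal.ofReal (4000 * ρ / ((θ / C₁) ^ 2 * ‖z‖))) ^ 7 := by gcongr
        _ = ENNReal.ofReal (4 ^ 9 * (4000 * ρ / ((θ / C₁) ^ 2 * ‖z‖)) ^ 7) := by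
            rw [ENNReal.ofReal_mul (by positivity), ENNReal.ofReal_pow (by positivity),
              ENNReal.ofReal_pow (by positivity), ENNReal.ofReal_ofNat]
        _ ≤ _ := by
            refine ENNReal.ofReal_le_ofReal (le_of_eq ?_)
            rw [hmz]
            field_simp
  · have hle : max ‖z‖ ρ ≤ C₁ / θ * ρ := by
      refine max_le (not_lt.1 hz) ?_
      have : 1 ≤ C₁ / θ := (one_le_div hθ).2 (hθ1.trans hC₁)
      nlinarith
    have hq : θ / C₁ ≤ ρ / max ‖z‖ ρ := by
      rw [le_div_iff₀ hmax]
      calc θ / C₁ * max ‖z‖ ρ ≤ θ / C₁ * (C₁ / θ * ρ) := by gcongr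
        _ = ρ := by field_simp
    calc Sublevel.tupMeas 9 _ ≤ Sublevel.tupMeas 9 {U | ∀ k, U (e k) ∈ Set.univ} :=
          measure_mono fun U _ k => Set.mem_univ _
      _ ≤ 4 ^ 9 * (volume.restrict uSq Set.univ) ^ 7 := Sublevel.tupMeas_forall_mem_le e _
      _ = ENNReal.ofReal (4 ^ 9 * 4 ^ 7) := by
          rw [Measure.restrict_apply_univ, Sublevel.volume_uSq]
          norm_num
      _ ≤ _ := by
          refine ENNReal.ofReal_le_ofReal ?_
          have h7 : (θ / C₁) ^ 7 ≤ (ρ / max ‖z‖ ρ) ^ 7 := by gcongr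
          have : 4 ^ 9 * (4000 * C₁ ^ 2) ^ 7 / θ ^ 14 * (θ / C₁) ^ 7 =
              4 ^ 9 * 4000 ^ 7 * (C₁ / θ) ^ 7 := by field_simp
          have h1 : 1 ≤ (C₁ / θ) ^ 7 := one_le_pow₀ ((one_le_div hθ).2 (hθ1.trans hC₁))
          calc (4 : ℝ) ^ 9 * 4 ^ 7 ≤ 4 ^ 9 * 4000 ^ 7 * 1 := by norm_num
            _ ≤ 4 ^ 9 * 4000 ^ 7 * (C₁ / θ) ^ 7 := by gcongr
            _ = _ := this.symm
            _ ≤ _ := by gcongr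

/-- The energy of exponent `α` controls the energy of exponent `7` truncated at a larger scale. -/
lemma sum_truncated_energy_le {E : Type*} [NormedAddCommGroup E] (G : Finset E) {α ρ R Υ : ℝ}
    (hρ : 0 < ρ) (hR : ρ ≤ R) (x : E)
    (h : ∑ y ∈ G, (max ‖y - x‖ ρ) ^ (-α) ≤ Υ) :
    ∑ y ∈ G.filter (fun y => ‖y - x‖ ≤ R), (ρ / max ‖y - x‖ ρ) ^ 7 ≤
      ρ ^ min α 7 * R ^ (α - min α 7) * Υ := by
  have hR0 : 0 < R := hρ.trans_le hR
  refine le_trans ?_ (mul_le_mul_of_nonneg_left h (by positivity))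
  rw [Finset.mul_sum]
  refine le_trans (Finset.sum_le_sum fun y hy => ?_)
    (Finset.sum_le_sum_of_subset_of_nonneg (Finset.filter_subset (fun y => ‖y - x‖ ≤ R) G)
      fun y _ _ => by positivity)
  rw [Finset.mem_filter] at hy
  set d := max ‖y - x‖ ρ
  have hd : 0 < d := lt_max_of_lt_right hρ
  have hdR : d ≤ R := max_le hy.2 hR
  have hρd : ρ / d ≤ 1 := (div_le_one hd).2 (le_max_right _ _)
  calc (ρ / d) ^ 7 = (ρ / d) ^ (7 : ℝ) := by norm_cast
    _ ≤ (ρ / d) ^ min α 7 := Real.rpow_le_rpow_of_exponent_ge (by positivity) hρd (min_le_right _ _)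
    _ = ρ ^ min α 7 * (d ^ (α - min α 7) * d ^ (-α)) := by
        rw [← Real.rpow_add hd, Real.div_rpow hρ.le hd.le, div_eq_mul_inv, ← Real.rpow_neg hd.le]
        congr 2; ring
    _ ≤ ρ ^ min α 7 * (R ^ (α - min α 7) * d ^ (-α)) := by
        gcongr
        exact sub_nonneg.2 (min_le_left _ _)
    _ = _ := by ring

/-- For most good tuples, few pairs of close points have jets agreeing at seven of the points. -/
lemma exists_pair_count_bound : ∃ C : ℝ, 1 ≤ C ∧ ∀ θ ρ R α Υ lam : ℝ, 0 < θ → θ ≤ 1 → 0 < ρ →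
    ρ ≤ R → 0 < lam → ∀ G : Finset (Fin 9 → ℝ),
    (∀ x ∈ G, ∑ y ∈ G, (max ‖y - x‖ ρ) ^ (-α) ≤ Υ) → ∀ e : Fin 7 ↪ Fin 9,
    Sublevel.tupMeas 9 {U | Good i θ U ∧ lam < (((G ×ˢ G).filter fun p => ‖p.2 - p.1‖ ≤ R ∧
      ∀ k, |(J i (U (e k)) *ᵥ (p.2 - p.1)) 0| ≤ ρ).card : ℝ)} ≤
    ENNReal.ofReal (C / θ ^ 14 * (G.card * (ρ ^ min α 7 * R ^ (α - min α 7) * Υ)) / lam) := by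
  obtain ⟨C, hC, h⟩ := exists_eval_measure_bound i
  refine ⟨C, hC, fun θ ρ R α Υ lam hθ hθ1 hρ hR hlam G hG e => ?_⟩
  let s := (G ×ˢ G).filter fun p => ‖p.2 - p.1‖ ≤ R
  let S : (Fin 9 → ℝ) × (Fin 9 → ℝ) → Set (Fin 9 → ℝ × ℝ) := fun p =>
    {U | Good i θ U ∧ ∀ k, |(J i (U (e k)) *ᵥ (p.2 - p.1)) 0| ≤ ρ}
  have hM := measure_lt_card_le (Sublevel.tupMeas 9) s S hlam
  refine (measure_mono ?_).trans (hM.trans ?_)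
  · rintro U ⟨hg, hU⟩
    change lam < _
    convert hU using 3
    ext p
    simp only [s, S, Finset.mem_filter, and_assoc]
    refine and_congr_right fun _ => and_congr_right fun _ => ?_
    change (Good i θ U ∧ _) ↔ _
    exact and_iff_right hg
  · rw [ENNReal.ofReal_div_of_pos hlam]
    refine ENNReal.div_le_div_right ?_ _
    calc ∑ p ∈ s, Sublevel.tupMeas 9 (S p)
        ≤ ∑ p ∈ s, ENNReal.ofReal (C / θ ^ 14 * (ρ / max ‖p.2 - p.1‖ ρ) ^ 7) :=
          Finset.sum_le_sum fun p _ => h θ ρ hθ hθ1 hρ e _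
      _ = ENNReal.ofReal (∑ p ∈ s, C / θ ^ 14 * (ρ / max ‖p.2 - p.1‖ ρ) ^ 7) :=
          (ENNReal.ofReal_sum_of_nonneg fun p _ => by positivity).symm
      _ ≤ _ := by
          refine ENNReal.ofReal_le_ofReal ?_
          rw [← Finset.mul_sum]
          refine mul_le_mul_of_nonneg_left ?_ (by positivity)
          calc ∑ p ∈ s, (ρ / max ‖p.2 - p.1‖ ρ) ^ 7
              = ∑ x ∈ G, ∑ y ∈ G.filter (fun y => ‖y - x‖ ≤ R), (ρ / max ‖y - x‖ ρ) ^ 7 := by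
                rw [Finset.sum_filter, Finset.sum_product]
                exact Finset.sum_congr rfl fun x _ => (Finset.sum_filter _ _).symm
            _ ≤ ∑ x ∈ G, ρ ^ min α 7 * R ^ (α - min α 7) * Υ :=
                Finset.sum_le_sum fun x hx => sum_truncated_energy_le G hρ hR x (hG x hx)
            _ = _ := by rw [Finset.sum_const, nsmul_eq_mul]


open Entropy

variable {Ω : Type} [Fintype Ω] (i : Fin 2) (x : Ω → Fin 9 → ℝ)

/-- the partition according to the position at a given scale -/
noncomputable def pos (ρ : ℝ) : Setoid Ω := part x fun _ => ρ

/-- the partition according to the first `k` entries of the jet at `u`, at scale `ρ` -/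
noncomputable def rows (u : ℝ × ℝ) (k : Fin 9) (ρ : ℝ) : Setoid Ω :=
  part (fun a (m : {m : Fin 9 // m < k}) => (J i u *ᵥ x a) m) fun _ => ρ

/-- the partition according to all entries of the jet at `u`, at separate scales -/
noncomputable def box (u : ℝ × ℝ) (s : Fin 9 → ℝ) : Setoid Ω := part (fun a => J i u *ᵥ x a) s

variable {i x}

lemma pos_le {ρ : ℝ} (hρ : 0 < ρ) {a b : Ω} (h : pos x ρ a b) (m : Fin 9) :
    |(x a - x b) m| ≤ ρ := part_le (fun _ => hρ) h m

lemma rows_le {u : ℝ × ℝ} {k : Fin 9} {ρ : ℝ} (hρ : 0 < ρ) {a b : Ω} (h : rows i x u k ρ a b)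
    (m : Fin 9) (hm : m < k) : |(J i u *ᵥ (x a - x b)) m| ≤ ρ := by
  rw [mulVec_sub]
  exact part_le (fun _ => hρ) h ⟨m, hm⟩

lemma box_le {u : ℝ × ℝ} {s : Fin 9 → ℝ} (hs : ∀ m, 0 < s m) {a b : Ω} (h : box i x u s a b)
    (m : Fin 9) : |(J i u *ᵥ (x a - x b)) m| ≤ s m := by
  rw [mulVec_sub]
  exact part_le hs h m

lemma log_nonneg_of_nonneg {D : ℝ} (hD : 0 ≤ D) : 0 ≤ Real.log (2 * D + 3) :=
  Real.log_nonneg (by linarith)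

lemma K_le_pos [Nonempty Ω] {s : Setoid Ω} {ρ D : ℝ} (hρ : 0 < ρ) (hD : 0 ≤ D)
    (h : ∀ a b, s a b → ∀ m, |(x a - x b) m| ≤ D * ρ) :
    K s ≤ K (s ⊓ pos x ρ) + 9 * Real.log (2 * D + 3) := by
  simpa [pos] using K_le_part (s := s) (Y := x) (ρ := fun _ => ρ) (fun _ => hρ) hD h

lemma K_le_rows [Nonempty Ω] {s : Setoid Ω} {u : ℝ × ℝ} {k : Fin 9} {ρ D : ℝ} (hρ : 0 < ρ)
    (hD : 0 ≤ D) (h : ∀ a b, s a b → ∀ m < k, |(J i u *ᵥ (x a - x b)) m| ≤ D * ρ) :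
    K s ≤ K (s ⊓ rows i x u k ρ) + 9 * Real.log (2 * D + 3) := by
  refine (K_le_part (s := s) (Y := fun a (m : {m : Fin 9 // m < k}) => (J i u *ᵥ x a) m)
    (ρ := fun _ => ρ) (fun _ => hρ) hD fun a b hab m => ?_).trans ?_
  · have := h a b hab m m.2
    rwa [mulVec_sub] at this
  · have hc : (Fintype.card {m : Fin 9 // m < k} : ℝ) ≤ 9 := by
      exact_mod_cast (Fintype.card_subtype_le _).trans_eq (Fintype.card_fin 9)
    have := mul_le_mul_of_nonneg_right hc (log_nonneg_of_nonneg hD)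
    unfold rows
    linarith

lemma log_control_le {C θ : ℝ} (hC : 1 ≤ C) (hθ : 0 < θ) (hθ1 : θ ≤ 1) :
    Real.log (2 * (C / θ) + 3) ≤ (1 + Real.log (5 * C)) * (1 + Real.log θ⁻¹) := by
  have h1 : 1 ≤ C / θ := (one_le_div hθ).2 (hθ1.trans hC)
  have h2 : 0 ≤ Real.log (5 * C) := Real.log_nonneg (by linarith)
  have h3 : 0 ≤ Real.log θ⁻¹ := Real.log_nonneg ((one_le_inv₀ hθ).2 hθ1)
  calc Real.log (2 * (C / θ) + 3) ≤ Real.log (5 * C * θ⁻¹) := by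
        refine Real.log_le_log (by linarith) ?_
        rw [mul_assoc, ← div_eq_mul_inv]
        linarith
    _ = Real.log (5 * C) + Real.log θ⁻¹ := Real.log_mul (by positivity) (by positivity)
    _ ≤ _ := by nlinarith

lemma neg_mem_uSq {u : ℝ × ℝ} (hu : u ∈ uSq) : -u ∈ uSq := by
  obtain ⟨⟨h1, h2⟩, h3, h4⟩ := hu
  exact ⟨⟨by simpa using h2, by simpa using neg_le_neg h1⟩, by simpa using h4,
    by simpa using neg_le_neg h3⟩

/-- the scales of the entries of a jet -/
def boxScale (q : Fin 5 → ℝ) : Fin 9 → ℝ := ![q 0, q 1, q 1, q 2, q 2, q 2, q 3, q 3, q 4]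

lemma boxScale_pos {q : Fin 5 → ℝ} (hq : ∀ j, 0 < q j) (m : Fin 9) : 0 < boxScale q m := by
  fin_cases m
  exacts [hq 0, hq 1, hq 1, hq 2, hq 2, hq 2, hq 3, hq 3, hq 4]

lemma boxScale_le {q : Fin 5 → ℝ} (hq : Monotone q) :
    (∀ m, boxScale q m ≤ q 4) ∧ (∀ m < 8, boxScale q m ≤ q 3) ∧ (∀ m < 6, boxScale q m ≤ q 2) ∧
      (∀ m < 3, boxScale q m ≤ q 1) ∧ ∀ m < 1, boxScale q m ≤ q 0 := by
  have h01 : q 0 ≤ q 1 := hq (by decide)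
  have h12 : q 1 ≤ q 2 := hq (by decide)
  have h23 : q 2 ≤ q 3 := hq (by decide)
  have h34 : q 3 ≤ q 4 := hq (by decide)
  have h : boxScale q = ![q 0, q 1, q 1, q 2, q 2, q 2, q 3, q 3, q 4] := rfl
  rw [h]
  refine ⟨?_, ?_, ?_, ?_, ?_⟩
  · simp only [Fin.forall_fin_succ, Fin.forall_fin_zero]; simp; refine ⟨?_, ?_, ?_, ?_⟩ <;> linarith
  all_goals
    simp only [Fin.forall_fin_succ, Fin.forall_fin_zero]; simp [Fin.lt_def]
  all_goals first | linarith | (refine ⟨?_, ?_, ?_⟩ <;> linarith) | (refine ⟨?_, ?_⟩ <;> linarith)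

variable (i) in
/-- telescoping a fine box through the layers of coarser information that control each other -/
lemma exists_K_box_le : ∃ C : ℝ, 0 ≤ C ∧ ∀ (Ω : Type) [Fintype Ω] [Nonempty Ω]
    (x : Ω → Fin 9 → ℝ) (q : Fin 5 → ℝ), (∀ j, 0 < q j) → Monotone q → ∀ u ∈ uSq,
    K (box i x u (boxScale q)) ≤ K (pos x (q 4) ⊓ rows i x u 8 (q 3)) +
      (K (pos x (q 3) ⊓ rows i x u 6 (q 2)) - K (pos x (q 3))) +
      (K (pos x (q 2) ⊓ rows i x u 3 (q 1)) - K (pos x (q 2))) +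
      (K (pos x (q 1) ⊓ rows i x u 1 (q 0)) - K (pos x (q 1))) + C := by
  obtain ⟨C, hC, hJ⟩ := exists_jet_bound i
  have hC0 : 0 ≤ C := by linarith
  have hL := log_nonneg_of_nonneg hC0
  refine ⟨200 * Real.log (2 * C + 3), by positivity, ?_⟩
  intro Ω _ _ x q hq hqm u hu
  have hinv : ∀ z, J i (-u) *ᵥ (J i u *ᵥ z) = z := fun z => jet_neg_mulVec _ _ u z
  have hmono : ∀ {j k : Fin 5}, j ≤ k → q j ≤ C * q k := fun {j k} hjk => by
    nlinarith [hqm hjk, hq k]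
  obtain ⟨b4, b3, b2, b1, b0⟩ := boxScale_le hqm
  set B := box i x u (boxScale q)
  have hB : ∀ a b, B a b → ∀ m, |(J i u *ᵥ (x a - x b)) m| ≤ boxScale q m :=
    fun a b h => box_le (boxScale_pos hq) h
  have hle : ∀ {x y : ℝ}, x ≤ y → 0 < y → x ≤ C * y := fun {x y} h h' => by nlinarith
  have s1 : K B ≤ K (B ⊓ pos x (q 4)) + 9 * Real.log (2 * C + 3) :=
    K_le_pos (hq 4) hC0 fun a b hab m => by
      have := hJ (-u) (neg_mem_uSq hu) (q 4) (hq 4).le (J i u *ᵥ (x a - x b))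
        (fun m => (hB a b hab m).trans (b4 m)) m
      rwa [hinv] at this
  have hBr : ∀ {s : Setoid Ω}, s ≤ B → ∀ (k : Fin 9) (ρ : ℝ), 0 < ρ →
      (∀ m < k, boxScale q m ≤ ρ) →
      K s ≤ K (s ⊓ rows i x u k ρ) + 9 * Real.log (2 * C + 3) := fun {s} hs k ρ hρ hk =>
    K_le_rows hρ hC0 fun a b hab m hm => hle ((hB a b (hs hab) m).trans (hk m hm)) hρ
  have s2 := hBr (s := B ⊓ pos x (q 4)) inf_le_left 8 (q 3) (hq 3) b3
  have s3 := hBr (s := B ⊓ pos x (q 4) ⊓ rows i x u 8 (q 3)) (inf_le_left.trans inf_le_left)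
    6 (q 2) (hq 2) b2
  have s4 := hBr (s := B ⊓ pos x (q 4) ⊓ rows i x u 8 (q 3) ⊓ rows i x u 6 (q 2))
    (inf_le_left.trans (inf_le_left.trans inf_le_left)) 3 (q 1) (hq 1) b1
  have s5 := hBr (s := B ⊓ pos x (q 4) ⊓ rows i x u 8 (q 3) ⊓ rows i x u 6 (q 2) ⊓
    rows i x u 3 (q 1)) (inf_le_left.trans (inf_le_left.trans (inf_le_left.trans inf_le_left)))
    1 (q 0) (hq 0) b0
  have s6 : K (B ⊓ pos x (q 4) ⊓ rows i x u 8 (q 3) ⊓ rows i x u 6 (q 2) ⊓ rows i x u 3 (q 1) ⊓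
      rows i x u 1 (q 0)) ≤ K (pos x (q 4) ⊓ rows i x u 8 (q 3) ⊓ rows i x u 6 (q 2) ⊓
        rows i x u 3 (q 1) ⊓ rows i x u 1 (q 0)) := K_mono (by
    gcongr; exact inf_le_right)
  have hpr : ∀ {s : Setoid Ω} (j : Fin 5), s ≤ pos x (q j) → ∀ (k : Fin 9) (l : Fin 5), j ≤ l →
      K s ≤ K (s ⊓ rows i x u k (q l)) + 9 * Real.log (2 * C + 3) := fun {s} j hs k l hl =>
    K_le_rows (hq l) hC0 fun a b hab m _ => (hJ u hu (q j) (hq j).le _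
      (fun m => pos_le (hq j) (hs hab) m) m).trans (by gcongr; exact hqm hl)
  have hpp : ∀ (j l : Fin 5), j ≤ l →
      K (pos x (q j)) ≤ K (pos x (q j) ⊓ pos x (q l)) + 9 * Real.log (2 * C + 3) := fun j l hl =>
    K_le_pos (hq l) hC0 fun a b hab m => hle ((pos_le (hq j) hab m).trans (hqm hl)) (hq l)
  have hpr1 := fun (j k : Fin 5) (h : j ≤ k) =>
    hpr (s := pos x (q j) ⊓ pos x (q 4)) j inf_le_left 8 k h
  have hpr2 := fun (j k l : Fin 5) (h : j ≤ l) =>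
    hpr (s := pos x (q j) ⊓ pos x (q 4) ⊓ rows i x u 8 (q k)) j
      (inf_le_left.trans inf_le_left) 6 l h
  have hpr3 := fun (j k l n : Fin 5) (h : j ≤ n) =>
    hpr (s := pos x (q j) ⊓ pos x (q 4) ⊓ rows i x u 8 (q k) ⊓ rows i x u 6 (q l)) j
      (inf_le_left.trans (inf_le_left.trans inf_le_left)) 3 n h
  have l3 := K_layer (X := pos x (q 3)) (G := pos x (q 4) ⊓ rows i x u 8 (q 3))
    (Y := rows i x u 6 (q 2)) (c := 18 * Real.log (2 * C + 3)) (by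
      rw [← inf_assoc]
      linarith [hpp 3 4 (by decide), hpr1 3 3 (by decide)])
  have l2 := K_layer (X := pos x (q 2))
    (G := pos x (q 4) ⊓ rows i x u 8 (q 3) ⊓ rows i x u 6 (q 2))
    (Y := rows i x u 3 (q 1)) (c := 27 * Real.log (2 * C + 3)) (by
      rw [← inf_assoc, ← inf_assoc]
      linarith [hpp 2 4 (by decide), hpr1 2 3 (by decide), hpr2 2 3 2 (by decide)])
  have l1 := K_layer (X := pos x (q 1))
    (G := pos x (q 4) ⊓ rows i x u 8 (q 3) ⊓ rows i x u 6 (q 2) ⊓ rows i x u 3 (q 1))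
    (Y := rows i x u 1 (q 0)) (c := 36 * Real.log (2 * C + 3)) (by
      rw [← inf_assoc, ← inf_assoc, ← inf_assoc]
      linarith [hpp 1 4 (by decide), hpr1 1 3 (by decide), hpr2 1 3 2 (by decide),
        hpr3 1 3 2 1 (by decide)])
  linarith

variable (i) in
lemma exists_sum_rows_eight_le : ∃ C : ℝ, 0 ≤ C ∧ ∀ (Ω : Type) [Fintype Ω] [Nonempty Ω]
    (x : Ω → Fin 9 → ℝ) (X : Setoid Ω) (U : Fin 9 → ℝ × ℝ) (θ ρ : ℝ), 0 < θ → θ ≤ 1 → 0 < ρ →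
    U ∈ Sublevel.tuples 9 → Good i θ U →
    ∑ p, K (X ⊓ rows i x (U p) 8 ρ) ≤ K X + 8 * K (pos x ρ) + C * (1 + Real.log θ⁻¹) := by
  obtain ⟨C, hC, h⟩ := exists_top_bound i
  have hL : 0 ≤ Real.log (5 * C) := Real.log_nonneg (by linarith)
  refine ⟨162 * (1 + Real.log (5 * C)), by positivity, ?_⟩
  intro Ω _ _ x X U θ ρ hθ hθ1 hρ hU hg
  obtain ⟨h1, h2⟩ := h U hU
  have hD : C ≤ C / θ := le_div_self (by linarith) hθ hθ1
  have := sum_K_blocks (κ := Unit) X (fun p => rows i x (U p) 8 ρ)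
    (fun a q _ => ((topMat i U).adjugate *ᵥ x a) q) x hρ (D := C / θ) (by positivity)
    (fun p a a' haa q hq _ => by
      have := h1 p ρ hρ.le (x a - x a') (rows_le hρ haa) q hq
      rw [mulVec_sub] at this
      exact this.trans (by gcongr))
    (fun a a' haa => h2 θ ρ hθ hρ.le hg.top (x a - x a') fun q => by
      rw [mulVec_sub]
      exact haa q ())
  refine this.trans ?_
  have := log_control_le hC hθ hθ1
  norm_num [pos] at this ⊢
  linarith

lemma sum_fin_six (f : Fin 6 → ℝ) : ∑ k, f k = ∑ p, (f (fstPt p) + f (sndPt p)) := by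
  simp [Fin.sum_univ_succ, fstPt, sndPt]
  ring_nf

variable (i) in
lemma exists_sum_rows_three_le : ∃ C : ℝ, 0 ≤ C ∧ ∀ (Ω : Type) [Fintype Ω] [Nonempty Ω]
    (x : Ω → Fin 9 → ℝ) (X : Setoid Ω) (U : Fin 9 → ℝ × ℝ) (θ ρ : ℝ), 0 < θ → θ ≤ 1 → 0 < ρ →
    U ∈ Sublevel.tuples 9 → Good i θ U → ∀ e : Fin 6 ↪ Fin 9,
    ∑ k, K (X ⊓ rows i x (U (e k)) 3 ρ) ≤ 4 * K X + 2 * K (pos x ρ) +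
      C * (1 + Real.log θ⁻¹) := by
  obtain ⟨C, hC, h⟩ := exists_triple_bound i
  have hL : 0 ≤ Real.log (5 * C) := Real.log_nonneg (by linarith)
  refine ⟨54 * (1 + Real.log (5 * C)), by positivity, ?_⟩
  intro Ω _ _ x X U θ ρ hθ hθ1 hρ hU hg e
  obtain ⟨h1, h2⟩ := h (U ∘ e) fun k => hU _
  have hne : ∀ p : Fin 3, fstPt p ≠ sndPt p := by decide
  have := sum_K_blocks (κ := Fin 3) X (fun p => rows i x (U (e (fstPt p))) 3 ρ ⊓
    rows i x (U (e (sndPt p))) 3 ρ)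
    (fun a q k => ((tripleMat i (U ∘ e)).adjugate *ᵥ x a) (col q k)) x hρ (D := C / θ)
    (by positivity)
    (fun p a a' haa q hq k => by
      have := h1 p θ ρ hθ hρ.le (hg.pair _ _ (e.injective.ne (hne p))) (x a - x a')
        (rows_le hρ haa.1) (rows_le hρ haa.2) q hq k
      rwa [mulVec_sub] at this)
    (fun a a' haa => h2 θ ρ hθ hρ.le (hg.triple e) (x a - x a') fun c => by
      obtain ⟨q, k, rfl⟩ := exists_col c
      rw [mulVec_sub]
      exact haa q k)
  rw [sum_fin_six]
  have hs : ∀ p : Fin 3, K (X ⊓ rows i x (U (e (fstPt p))) 3 ρ) +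
      K (X ⊓ rows i x (U (e (sndPt p))) 3 ρ) ≤
      K (X ⊓ (rows i x (U (e (fstPt p))) 3 ρ ⊓ rows i x (U (e (sndPt p))) 3 ρ)) + K X :=
    fun p => by
      rw [inf_inf_distrib_left]
      exact K_supermod inf_le_left inf_le_left
  have hs' := Finset.sum_le_sum fun p (_ : p ∈ Finset.univ) => hs p
  rw [Finset.sum_add_distrib (g := fun _ => K X), Finset.sum_const] at hs'
  have hl := log_control_le hC hθ hθ1
  norm_num [pos] at this hl hs' ⊢
  linarith

lemma dual_sub (y z : Fin 9 → ℝ) : dual i (y - z) = dual i y - dual i z := by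
  unfold dual
  split_ifs <;> ext m <;> fin_cases m <;> simp <;> ring

variable (i) in
lemma exists_sum_rows_six_le : ∃ C : ℝ, 0 ≤ C ∧ ∀ (Ω : Type) [Fintype Ω] [Nonempty Ω]
    (x : Ω → Fin 9 → ℝ) (X : Setoid Ω) (U : Fin 9 → ℝ × ℝ) (θ ρ : ℝ), 0 < θ → θ ≤ 1 → 0 < ρ →
    U ∈ Sublevel.tuples 9 → Good i θ U → ∀ e : Fin 6 ↪ Fin 9,
    ∑ k, K (X ⊓ rows i x (U (e k)) 6 ρ) ≤ 4 * K (pos x ρ) + 2 * K X +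
      C * (1 + Real.log θ⁻¹) := by
  obtain ⟨C₁, hC₁, h⟩ := exists_dual_bound i
  obtain ⟨C₂, hC₂, h'⟩ := exists_pair_bound i
  set C := max C₁ C₂
  have hC : 1 ≤ C := hC₁.trans (le_max_left _ _)
  have hL : 0 ≤ Real.log (5 * C) := Real.log_nonneg (by linarith)
  refine ⟨54 * (1 + Real.log (5 * C)), by positivity, ?_⟩
  intro Ω _ _ x X U θ ρ hθ hθ1 hρ hU hg e
  obtain ⟨h1, h2⟩ := h (U ∘ e) fun k => hU _
  have hD : C ≤ C / θ := le_div_self (by linarith) hθ hθ1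
  have hD1 : C₁ ≤ C / θ := (le_max_left _ _).trans hD
  have hne : ∀ p : Fin 3, fstPt p ≠ sndPt p := by decide
  have hV : ∀ p k, ∀ a a' : Fin 6, a = fstPt p ∨ a = sndPt p → ∀ b b' : Ω,
      rows i x (U (e a)) 6 ρ b b' → |((tripleMat i (U ∘ e))ᵀ *ᵥ dual i (x b)) (col p k) -
        ((tripleMat i (U ∘ e))ᵀ *ᵥ dual i (x b')) (col p k)| ≤ C / θ * ρ := by
    intro p k a _ ha b b' hbb
    have := h1 p a ha ρ hρ.le (x b - x b') (rows_le hρ hbb) k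
    rw [dual_sub, mulVec_sub] at this
    exact this.trans (by gcongr)
  have := sum_K_pairs (κ := Fin 3) X (fun p => rows i x (U (e (fstPt p))) 6 ρ)
    (fun p => rows i x (U (e (sndPt p))) 6 ρ)
    (fun a q k => ((tripleMat i (U ∘ e))ᵀ *ᵥ dual i (x a)) (col q k)) x hρ (D := C / θ)
    (by positivity)
    (fun p a a' haa k => hV p k _ 0 (.inl rfl) a a' haa)
    (fun p a a' haa k => hV p k _ 0 (.inr rfl) a a' haa)
    (fun p a a' haa haa' m => (h' _ (hU _) _ (hU _) θ ρ hθ hρ.le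
      (hg.pair _ _ (e.injective.ne (hne p))) (x a - x a') (rows_le hρ haa)
      (fun m hm => rows_le hρ haa' m (hm.trans (by decide))) m).trans
        (by gcongr; exact le_max_right _ _))
    (fun a a' haa m => (h2 θ ρ hθ hρ.le (hg.triple e) (x a - x a') (fun c => by
      obtain ⟨q, k, rfl⟩ := exists_col c
      rw [dual_sub, mulVec_sub]
      exact haa q k) m).trans (by gcongr; exact le_max_left _ _))
  rw [sum_fin_six]
  have hl := log_control_le hC hθ hθ1
  norm_num [pos] at this hl ⊢
  linarith

/-- averaging an inequality for `m` indices over cyclic shifts -/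
lemma sum_le_of_embeddings {m : ℕ} (hm : m ≤ 9) {f : Fin 9 → ℝ} {B : ℝ}
    (h : ∀ e : Fin m ↪ Fin 9, ∑ k, f (e k) ≤ B) : m * ∑ p, f p ≤ 9 * B := by
  let e : Fin 9 → Fin m ↪ Fin 9 := fun j =>
    (Fin.castLEEmb hm).trans (Equiv.addRight j).toEmbedding
  have h1 : ∑ j, ∑ k, f (e j k) ≤ 9 * B := by
    refine (Finset.sum_le_sum fun j _ => h (e j)).trans (le_of_eq ?_)
    simp
  rw [Finset.sum_comm] at h1
  refine le_trans (le_of_eq ?_) h1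
  have : ∀ k, ∑ j, f (e j k) = ∑ p, f p := fun k =>
    Equiv.sum_comp (Equiv.addLeft (Fin.castLE hm k)) f
  simp [this]

variable (i) in
/-- the entropy inequality for the fine boxes at the points of a good tuple -/
lemma exists_sum_K_box_le : ∃ C : ℝ, 0 ≤ C ∧ ∀ (Ω : Type) [Fintype Ω] [Nonempty Ω]
    (x : Ω → Fin 9 → ℝ) (q : Fin 5 → ℝ), (∀ j, 0 < q j) → Monotone q →
    ∀ (U : Fin 9 → ℝ × ℝ) (θ B : ℝ), 0 < θ → θ ≤ 1 → U ∈ Sublevel.tuples 9 → Good i θ U →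
    (∀ e : Fin 7 ↪ Fin 9,
      K (pos x (q 1) ⊓ Finset.univ.inf fun k => rows i x (U (e k)) 1 (q 0)) ≤ B) →
    ∑ p, K (box i x (U p) (boxScale q)) ≤ K (pos x (q 4)) + 2 * K (pos x (q 3)) +
      3 * K (pos x (q 2)) + 12 / 7 * K (pos x (q 1)) + 9 / 7 * B + C * (1 + Real.log θ⁻¹) := by
  obtain ⟨C₀, hC₀, h₀⟩ := exists_K_box_le i
  obtain ⟨C₈, hC₈, h₈⟩ := exists_sum_rows_eight_le i
  obtain ⟨C₆, hC₆, h₆⟩ := exists_sum_rows_six_le i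
  obtain ⟨C₃, hC₃, h₃⟩ := exists_sum_rows_three_le i
  refine ⟨9 * C₀ + C₈ + 9 / 6 * C₆ + 9 / 6 * C₃, by positivity, ?_⟩
  intro Ω _ _ x q hq hqm U θ B hθ hθ1 hU hg hB
  have hl : 0 ≤ Real.log θ⁻¹ := Real.log_nonneg ((one_le_inv₀ hθ).2 hθ1)
  have a0 := Finset.sum_le_sum fun p (_ : p ∈ Finset.univ) => h₀ Ω x q hq hqm (U p) (hU p)
  have a8 := h₈ Ω x (pos x (q 4)) U θ (q 3) hθ hθ1 (hq 3) hU hg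
  have a6 := sum_le_of_embeddings (by norm_num)
    (f := fun p => K (pos x (q 3) ⊓ rows i x (U p) 6 (q 2))) fun e =>
    h₆ Ω x (pos x (q 3)) U θ (q 2) hθ hθ1 (hq 2) hU hg e
  have a3 := sum_le_of_embeddings (by norm_num)
    (f := fun p => K (pos x (q 2) ⊓ rows i x (U p) 3 (q 1))) fun e =>
    h₃ Ω x (pos x (q 2)) U θ (q 1) hθ hθ1 (hq 1) hU hg e
  have a1 := sum_le_of_embeddings (m := 7) (by norm_num)
    (f := fun p => K (pos x (q 1) ⊓ rows i x (U p) 1 (q 0))) (B := B + 6 * K (pos x (q 1)))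
    fun e => by
      have := sum_K_inf (pos x (q 1)) fun k => rows i x (U (e k)) 1 (q 0)
      have hB := hB e
      norm_num at this
      linarith
  simp only [Finset.sum_add_distrib, Finset.sum_sub_distrib, Finset.sum_const, Finset.card_univ,
    Fintype.card_fin, nsmul_eq_mul] at a0
  norm_num at a0 a6 a3 a1
  have hmul : 9 * C₀ ≤ 9 * C₀ * (1 + Real.log θ⁻¹) := by nlinarith
  rw [Real.log_inv] at a8
  norm_num at hmul ⊢
  linarith

end Jet

namespace Entropy

/-- grid cells through points with many near neighbours are few -/
lemma card_floor_image_mul_le {X : Type*} {n : ℕ} (Y : X → Fin n → ℝ) {s : Fin n → ℝ}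
    (hs : ∀ m, 0 < s m) (G A : Finset X) {M : ℝ}
    (h : ∀ w ∈ A, M ≤ ((G.filter fun y => ∀ m, |Y y m - Y w m| ≤ s m).card : ℝ)) :
    ((A.image fun w m => ⌊Y w m / s m⌋).card : ℝ) * M ≤ 3 ^ n * G.card := by
  set f : X → Fin n → ℤ := fun w m => ⌊Y w m / s m⌋ with hf
  let r : (Fin n → ℤ) → X → Prop := fun c y => ∀ m, c m ∈ Finset.Icc (f y m - 1) (f y m + 1)
  have h1 : ∀ c ∈ A.image f, M ≤ ((Finset.bipartiteAbove r G c).card : ℝ) := by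
    intro c hc
    obtain ⟨w, hw, rfl⟩ := Finset.mem_image.1 hc
    refine (h w hw).trans ?_
    norm_cast
    refine Finset.card_le_card fun y hy => ?_
    rw [Finset.mem_filter] at hy
    refine Finset.mem_filter.2 ⟨hy.1, fun m => ?_⟩
    have := hy.2 m
    rw [abs_le, neg_le_sub_iff_le_add, sub_le_iff_le_add] at this
    have hsm := hs m
    rw [Finset.mem_Icc, sub_le_iff_le_add]
    refine ⟨?_, ?_⟩
    · have : Y y m / s m ≤ Y w m / s m + 1 := by
        rw [div_add_one hsm.ne']; gcongr; linarith
      simpa [hf] using Int.floor_le_floor this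
    · have : Y w m / s m ≤ Y y m / s m + 1 := by
        rw [div_add_one hsm.ne']; gcongr; linarith
      simpa [hf] using Int.floor_le_floor this
  have h2 : ∀ y ∈ G, (Finset.bipartiteBelow r (A.image f) y).card ≤ 3 ^ n := by
    intro y _
    refine (Finset.card_le_card (t := Fintype.piFinset fun m =>
      Finset.Icc (f y m - 1) (f y m + 1)) fun c hc => ?_).trans ?_
    · exact Fintype.mem_piFinset.2 (Finset.mem_filter.1 hc).2
    · rw [Fintype.card_piFinset]
      have : ∀ m, (Finset.Icc (f y m - 1) (f y m + 1)).card = 3 := fun m => by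
        rw [Int.card_Icc]; omega
      simp [this]
  have h3 := Finset.sum_card_bipartiteAbove_eq_sum_card_bipartiteBelow r (s := A.image f) (t := G)
  calc ((A.image f).card : ℝ) * M ≤ ∑ c ∈ A.image f, ((Finset.bipartiteAbove r G c).card : ℝ) := by
        rw [← nsmul_eq_mul]; exact Finset.card_nsmul_le_sum _ _ _ h1
    _ = ((∑ y ∈ G, (Finset.bipartiteBelow r (A.image f) y).card : ℕ) : ℝ) := by
        rw [← h3]; push_cast; rfl
    _ ≤ _ := by
        have := Finset.sum_le_card_nsmul _ _ _ h2
        rw [smul_eq_mul, mul_comm] at this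
        exact_mod_cast this

end Entropy

namespace Sublevel

/-- points lying in many of the sets produce tuples lying simultaneously in many of the sets -/
lemma exists_tuple_not_mem {X : Type*} (G : Finset X) (S : X → Set (ℝ × ℝ))
    (hS : ∀ w, MeasurableSet (S w)) {τ b : ℝ} (hτ : 0 < τ) (hG : G.Nonempty)
    (B : Set (Fin 9 → ℝ × ℝ)) (hB : tupMeas 9 B ≤ ENNReal.ofReal b) (hb : b < 131072 * τ ^ 18)
    (hlarge : ENNReal.ofReal (4 * τ) <
      volume {u ∈ uSq | τ * G.card < ((G.filter fun w => u ∈ S w).card : ℝ)}) :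
    ∃ U ∈ tuples 9, U ∉ B ∧
      τ ^ 18 / 2 * G.card ≤ ((G.filter fun w => ∀ p, U p ∈ S w).card : ℝ) := by
  have hN : (0 : ℝ) < G.card := by exact_mod_cast hG.card_pos
  obtain ⟨ν, hν⟩ : ∃ ν, ν = (volume : Measure (ℝ × ℝ)).restrict uSq := ⟨_, rfl⟩
  have hνu : ν Set.univ = 4 := by rw [hν, Measure.restrict_apply_univ, volume_uSq]
  have : IsFiniteMeasure ν := ⟨by rw [hνu]; exact ENNReal.coe_lt_top⟩
  obtain ⟨σ, hσ, hσ0⟩ : ∃ σ : X → ℝ, (∀ w, ν (S w) = ENNReal.ofReal (σ w)) ∧ ∀ w, 0 ≤ σ w :=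
    ⟨fun w => (ν (S w)).toReal, fun w => (ENNReal.ofReal_toReal (measure_ne_top _ _)).symm,
      fun w => ENNReal.toReal_nonneg⟩
  have h1 : 4 * τ * (τ * G.card) ≤ ∑ w ∈ G, σ w := by
    have hM := measure_lt_card_le ν G S (c := τ * G.card) (by positivity)
    have h2 : volume {u ∈ uSq | τ * G.card < ((G.filter fun w => u ∈ S w).card : ℝ)} ≤
        ν {x | τ * G.card < ((G.filter fun w => x ∈ S w).card : ℝ)} := by
      rw [hν, Measure.restrict_apply' measurableSet_uSq]
      exact measure_mono fun u hu => ⟨hu.2, hu.1⟩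
    have h3 := (hlarge.trans_le h2).le.trans hM
    simp only [hσ] at h3
    rw [← ENNReal.ofReal_sum_of_nonneg fun w _ => hσ0 w,
      ← ENNReal.ofReal_div_of_pos (by positivity), ENNReal.ofReal_le_ofReal_iff
        (div_nonneg (Finset.sum_nonneg fun w _ => hσ0 w) (by positivity)),
      le_div_iff₀ (by positivity)] at h3
    exact h3
  have h2 : G.card * (4 * τ ^ 2) ^ 9 ≤ ∑ w ∈ G, σ w ^ 9 := by
    refine le_trans ?_ (pow_sum_div_card_le_sum_pow (fun w _ => hσ0 w) 8)
    rw [le_div_iff₀ (by positivity)]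
    calc (G.card : ℝ) * (4 * τ ^ 2) ^ 9 * G.card ^ 8 = (4 * τ * (τ * G.card)) ^ 9 := by ring
      _ ≤ _ := by gcongr
  set P : X → Set (Fin 9 → ℝ × ℝ) := fun w => Set.univ.pi fun _ => S w
  have hP : ∀ w, tupMeas 9 (P w) = ENNReal.ofReal (σ w ^ 9) := fun w => by
    rw [tupMeas, Measure.pi_pi]
    simp only [← hν, hσ, Finset.prod_const, Finset.card_univ, Fintype.card_fin]
    rw [ENNReal.ofReal_pow (hσ0 w)]
  have hPm : ∀ w, MeasurableSet (P w) := fun w => MeasurableSet.univ_pi fun _ => hS w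
  by_contra hcon
  push Not at hcon
  set B' := toMeasurable (tupMeas 9) B
  have hB' : tupMeas 9 B' ≤ ENNReal.ofReal b := by rwa [measure_toMeasurable]
  have hpt : ∀ U ∈ tuples 9, ∑ w ∈ G, (P w).indicator (fun _ => (1 : ENNReal)) U ≤
      ENNReal.ofReal (τ ^ 18 / 2 * G.card) + G.card * B'.indicator (fun _ => 1) U := by
    intro U hU
    have hsum : ∑ w ∈ G, (P w).indicator (fun _ => (1 : ENNReal)) U =
        ((G.filter fun w => ∀ p, U p ∈ S w).card : ENNReal) := by
      simp [Set.indicator_apply, P, Finset.sum_boole]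
    rw [hsum]
    by_cases hUB : U ∈ B
    · rw [Set.indicator_of_mem (subset_toMeasurable _ _ hUB), mul_one]
      refine le_add_left ?_
      exact_mod_cast Finset.card_filter_le _ _
    · refine le_add_right ?_
      rw [← ENNReal.ofReal_natCast]
      exact ENNReal.ofReal_le_ofReal (hcon U hU hUB).le
  have hsumle : ∑ w ∈ G, tupMeas 9 (P w) ≤
      ENNReal.ofReal (τ ^ 18 / 2 * G.card) * 4 ^ 9 + G.card * tupMeas 9 B' := by
    calc ∑ w ∈ G, tupMeas 9 (P w)
        = ∫⁻ U, ∑ w ∈ G, (P w).indicator (fun _ => (1 : ENNReal)) U ∂tupMeas 9 := by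
          rw [lintegral_finsetSum _ fun w _ => measurable_const.indicator (hPm w)]
          refine Finset.sum_congr rfl fun w _ => ?_
          rw [lintegral_indicator (hPm w)]
          simp
      _ ≤ ∫⁻ U, (ENNReal.ofReal (τ ^ 18 / 2 * G.card) +
            G.card * B'.indicator (fun _ => 1) U) ∂tupMeas 9 := by
          refine lintegral_mono_ae ?_
          have : ∀ᵐ U ∂tupMeas 9, U ∈ tuples 9 := by
            rw [ae_iff]
            have := tupMeas_inter_tuples 9 {U | ¬ U ∈ tuples 9}
            rw [← this]
            convert measure_empty (μ := tupMeas 9)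
            ext U
            simp
          filter_upwards [this] with U hU using hpt U hU
      _ = _ := by
          rw [lintegral_add_left measurable_const, lintegral_const,
            lintegral_const_mul _ (measurable_const.indicator (measurableSet_toMeasurable _ _)),
            lintegral_indicator (measurableSet_toMeasurable _ _)]
          congr 1
          · rw [tupMeas, Measure.pi_univ, ← hν, hνu]; simp
          · simp [B']
  simp only [hP] at hsumle
  have hb0 : 0 ≤ max b 0 := le_max_right _ _
  have h4 : ENNReal.ofReal (∑ w ∈ G, σ w ^ 9) ≤
      ENNReal.ofReal (τ ^ 18 / 2 * G.card * 4 ^ 9 + G.card * max b 0) := by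
    rw [ENNReal.ofReal_sum_of_nonneg fun w _ => pow_nonneg (hσ0 w) 9,
      ENNReal.ofReal_add (by positivity) (by positivity), ENNReal.ofReal_mul (by positivity),
      ENNReal.ofReal_mul (p := (G.card : ℝ)) (by positivity), ENNReal.ofReal_natCast,
      ENNReal.ofReal_pow (by norm_num)]
    refine hsumle.trans ?_
    gcongr
    · norm_num
    · exact hB'.trans (ENNReal.ofReal_le_ofReal (le_max_left _ _))
  rw [ENNReal.ofReal_le_ofReal_iff (by positivity)] at h4
  have h5 : max b 0 < 131072 * τ ^ 18 := max_lt hb (by positivity)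
  nlinarith

end Sublevel

namespace Jet

open Entropy

variable {i : Fin 2}

/-- the number of `y` near `w` in terms of an energy bound at `w` -/
lemma card_le_of_energy {G : Finset (Fin 9 → ℝ)} {ρ₀ ρ α Υ : ℝ} (hα : 0 ≤ α) (hρ₀ : 0 < ρ₀)
    (h : ρ₀ ≤ ρ) {w : Fin 9 → ℝ} (hE : ∑ y ∈ G, (max ‖y - w‖ ρ₀) ^ (-α) ≤ Υ) :
    ((G.filter fun y => ‖y - w‖ ≤ ρ).card : ℝ) ≤ Υ * ρ ^ α := by
  have hρ : 0 < ρ := hρ₀.trans_le h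
  have h1 : ((G.filter fun y => ‖y - w‖ ≤ ρ).card : ℝ) * ρ ^ (-α) ≤ Υ := by
    refine le_trans ?_ ((Finset.sum_le_sum_of_subset_of_nonneg
      (Finset.filter_subset (fun y => ‖y - w‖ ≤ ρ) G) fun y _ _ => by positivity).trans hE)
    rw [← nsmul_eq_mul]
    refine Finset.card_nsmul_le_sum _ _ _ fun y hy => ?_
    exact Real.rpow_le_rpow_of_nonpos (by positivity) (max_le (Finset.mem_filter.1 hy).2 h)
      (by linarith)
  rw [Real.rpow_neg hρ.le] at h1
  have h2 : 0 < ρ ^ α := by positivity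
  rwa [← div_eq_mul_inv, div_le_iff₀ h2] at h1

lemma K_pos_le {G A : Finset (Fin 9 → ℝ)} (hA : A ⊆ G) [Nonempty A] {ρ₀ ρ α Υ : ℝ}
    (hα : 0 ≤ α) (hρ₀ : 0 < ρ₀) (h : ρ₀ ≤ ρ)
    (hE : ∀ w ∈ G, ∑ y ∈ G, (max ‖y - w‖ ρ₀) ^ (-α) ≤ Υ) :
    K (pos (fun a : A => (a : Fin 9 → ℝ)) ρ) ≤ Real.log (Υ * ρ ^ α) := by
  refine K_le_log _ ?_
  rw [mul_comm, ← nsmul_eq_mul, ← Finset.card_univ]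
  refine Finset.sum_le_card_nsmul _ _ _ fun a _ => ?_
  refine le_trans ?_ (card_le_of_energy hα hρ₀ h (hE a (hA a.2)))
  norm_cast
  unfold cls
  rw [← Finset.card_map (Function.Embedding.subtype _)]
  refine Finset.card_le_card fun y hy => ?_
  obtain ⟨b, hb, rfl⟩ := Finset.mem_map.1 hy
  refine Finset.mem_filter.2 ⟨hA b.2, ?_⟩
  have hab := (Finset.mem_filter.1 hb).2
  have hρ := hρ₀.trans_le h
  refine (pi_norm_le_iff_of_nonneg hρ.le).2 fun m => ?_
  exact pos_le hρ (Setoid.symm' _ hab) m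

lemma K_pairs_le {G A : Finset (Fin 9 → ℝ)} (hA : A ⊆ G) [Nonempty A] {ρ R lam : ℝ}
    (hρ : 0 < ρ) (hR : 0 < R) (V : Fin 7 → ℝ × ℝ)
    (h : (((G ×ˢ G).filter fun p => ‖p.2 - p.1‖ ≤ R ∧
      ∀ k, |(J i (V k) *ᵥ (p.2 - p.1)) 0| ≤ ρ).card : ℝ) ≤ lam) :
    K (pos (fun a : A => (a : Fin 9 → ℝ)) R ⊓ Finset.univ.inf fun k =>
      rows i (fun a : A => (a : Fin 9 → ℝ)) (V k) 1 ρ) ≤ Real.log (lam / A.card) := by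
  refine K_le_log _ ?_
  have hc : (A.card : ℝ) ≠ 0 := by
    have : 0 < A.card := Finset.card_pos.2 ⟨_, (Classical.arbitrary A).2⟩
    positivity
  rw [Fintype.card_coe, div_mul_cancel₀ _ hc]
  refine le_trans ?_ h
  norm_cast
  unfold cls
  rw [← Finset.card_sigma, ← Finset.card_map
    (⟨fun q => ((q.1 : Fin 9 → ℝ), (q.2 : Fin 9 → ℝ)), by
      rintro ⟨a, b⟩ ⟨c, d⟩ h
      simp only [Prod.mk.injEq, Subtype.coe_inj] at h
      obtain ⟨rfl, rfl⟩ := h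
      rfl⟩ : (Σ _ : A, A) ↪ (Fin 9 → ℝ) × (Fin 9 → ℝ))]
  refine Finset.card_le_card fun y hy => ?_
  obtain ⟨⟨a, b⟩, hb, rfl⟩ := Finset.mem_map.1 hy
  have hab := (Finset.mem_filter.1 (Finset.mem_sigma.1 hb).2).2
  refine Finset.mem_filter.2 ⟨Finset.mem_product.2 ⟨hA a.2, hA b.2⟩, ?_, fun k => ?_⟩
  · refine (pi_norm_le_iff_of_nonneg hR.le).2 fun m => ?_
    exact pos_le hR (Setoid.symm' _ hab.1) m
  · have h2 : (Finset.univ.inf fun k =>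
        rows i (fun a : A => (a : Fin 9 → ℝ)) (V k) 1 ρ) ≤
          rows i (fun a : A => (a : Fin 9 → ℝ)) (V k) 1 ρ :=
      Finset.inf_le (Finset.mem_univ k)
    exact rows_le hρ (Setoid.symm' _ (h2 hab.2)) 0 (by decide)

lemma le_K_box {G A : Finset (Fin 9 → ℝ)} [Nonempty A] {s : Fin 9 → ℝ} {M : ℝ}
    (hs : ∀ m, 0 < s m) (hM : 0 < M) (u : ℝ × ℝ)
    (h : ∀ w ∈ A, M ≤ ((G.filter fun y => ∀ m, |(J i u *ᵥ (y - w)) m| ≤ s m).card : ℝ)) :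
    Real.log A.card - Real.log (3 ^ 9 * G.card / M) ≤
      K (box i (fun a : A => (a : Fin 9 → ℝ)) u s) := by
  have := log_card_sub_le_K (Ω := A) (fun a m => ⌊(J i u *ᵥ (a : Fin 9 → ℝ)) m / s m⌋)
    (C := 3 ^ 9 * G.card / M) ?_
  · rw [Fintype.card_coe] at this
    exact this
  · rw [le_div_iff₀ hM]
    refine le_trans ?_ (card_floor_image_mul_le (M := M) (fun z => J i u *ᵥ z) hs G A
      fun w hw => ?_)
    · gcongr
      intro c hc
      simp only [Finset.mem_image] at hc ⊢
      obtain ⟨a, _, rfl⟩ := hc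
      exact ⟨a, a.2, rfl⟩
    · simpa only [mulVec_sub, Pi.sub_apply] using h w hw


open Entropy

/-- the five scales of a fine box around scale `r` -/
noncomputable def scales (r ℓ : ℝ) : Fin 5 → ℝ := fun j => r * Real.exp (((j : ℝ) - 2) * ℓ)

lemma scales_pos {r : ℝ} (hr : 0 < r) (ℓ : ℝ) (j : Fin 5) : 0 < scales r ℓ j := by
  unfold scales; positivity

lemma scales_mono {r ℓ : ℝ} (hr : 0 < r) (hℓ : 0 ≤ ℓ) : Monotone (scales r ℓ) := by
  intro j k hjk
  unfold scales
  have : (j : ℝ) ≤ k := by exact_mod_cast hjk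
  gcongr

lemma log_scales {r : ℝ} (hr : 0 < r) (ℓ : ℝ) (j : Fin 5) :
    Real.log (scales r ℓ j) = Real.log r + ((j : ℝ) - 2) * ℓ := by
  unfold scales
  rw [Real.log_mul hr.ne' (Real.exp_pos _).ne', Real.log_exp]

lemma phiFn_le {α : ℝ} (h0 : 0 < α) (h9 : α < 9) : phiFn α ≤ min α 7 / 7 - α / 9 := by
  unfold phiFn
  rcases le_total α 7 with h | h
  · rw [min_eq_left h]
    have := min_le_left (8 / 9 * α) (1 - α / 9)
    linarith
  · rw [min_eq_right h]
    have := min_le_right (8 / 9 * α) (1 - α / 9)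
    linarith

/-- number of points of `G` in the fine box around `w` -/
noncomputable def boxCount (i : Fin 2) (G : Finset (Fin 9 → ℝ)) (r ℓ : ℝ) (u : ℝ × ℝ)
    (w : Fin 9 → ℝ) : ℕ :=
  (G.filter fun y => ∀ m, |(J i u *ᵥ (y - w)) m| ≤ boxScale (scales r ℓ) m).card

lemma measurableSet_lt_boxCount (i : Fin 2) (G : Finset (Fin 9 → ℝ)) (r ℓ M : ℝ)
    (w : Fin 9 → ℝ) : MeasurableSet {u | M < (boxCount i G r ℓ u w : ℝ)} := by
  refine measurableSet_lt measurable_const ?_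
  unfold boxCount
  simp only [Finset.card_filter, Nat.cast_sum]
  refine Finset.measurable_sum _ fun y _ => ?_
  have : MeasurableSet {u | ∀ m, |(J i u *ᵥ (y - w)) m| ≤ boxScale (scales r ℓ) m} := by
    simp only [Set.ofPred_forall]
    exact MeasurableSet.iInter fun m =>
      measurableSet_le (continuous_J_mulVec i (y - w) m).abs.measurable measurable_const
  simp only [Nat.cast_ite]
  exact Measurable.ite this measurable_const measurable_const

/-- the entropy inequality in terms of the box counts and the pair counts -/
lemma exists_log_card_le (i : Fin 2) : ∃ C : ℝ, 0 ≤ C ∧ ∀ (G A : Finset (Fin 9 → ℝ)), A ⊆ G →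
    A.Nonempty → ∀ (r ℓ α Υ M lam θ : ℝ) (U : Fin 9 → ℝ × ℝ), 0 < r → 0 ≤ ℓ → 0 ≤ α → 0 < M →
    0 < θ → θ ≤ 1 → 0 < Υ → 0 < lam →
    (∀ w ∈ G, ∑ y ∈ G, (max ‖y - w‖ (scales r ℓ 0)) ^ (-α) ≤ Υ) → U ∈ Sublevel.tuples 9 →
    Good i θ U → (∀ w ∈ A, ∀ p, M ≤ boxCount i G r ℓ (U p) w) →
    (∀ e : Fin 7 ↪ Fin 9, (((G ×ˢ G).filter fun p => ‖p.2 - p.1‖ ≤ scales r ℓ 1 ∧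
      ∀ k, |(J i (U (e k)) *ᵥ (p.2 - p.1)) 0| ≤ scales r ℓ 0).card : ℝ) ≤ lam) →
    9 * Real.log M ≤ 81 * Real.log 3 + 9 * Real.log G.card - 72 / 7 * Real.log A.card +
      54 / 7 * Real.log Υ + 54 / 7 * α * Real.log r + 16 / 7 * α * ℓ + 9 / 7 * Real.log lam +
      C * (1 + Real.log θ⁻¹) := by
  obtain ⟨C, hC, h⟩ := exists_sum_K_box_le i
  refine ⟨C, hC, ?_⟩
  intro G A hA hAn r ℓ α Υ M lam θ U hr hℓ hα hM hθ hθ1 hΥ hlam hE hU hg hbox hpair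
  have : Nonempty A := hAn.to_subtype
  have hq := scales_pos hr ℓ
  have hqm := scales_mono hr hℓ
  have hAc : (0 : ℝ) < A.card := by exact_mod_cast hAn.card_pos
  have hGc : (0 : ℝ) < G.card := by exact_mod_cast (hAn.mono hA).card_pos
  have h1 := h A (fun a => (a : Fin 9 → ℝ)) (scales r ℓ) hq hqm U θ (Real.log (lam / A.card))
    hθ hθ1 hU hg fun e => K_pairs_le hA (hq 0) (hq 1) (fun k => U (e k)) (hpair e)
  have h2 := Finset.sum_le_sum fun p (_ : p ∈ Finset.univ) =>
    le_K_box (A := A) (G := G) (boxScale_pos hq) hM (U p) fun w hw => hbox w hw p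
  have hK : ∀ j, K (pos (fun a : A => (a : Fin 9 → ℝ)) (scales r ℓ j)) ≤
      Real.log Υ + α * (Real.log r + ((j : ℝ) - 2) * ℓ) := fun j => by
    refine (K_pos_le hA hα (hq 0) (hqm (Fin.zero_le j)) hE).trans (le_of_eq ?_)
    rw [Real.log_mul hΥ.ne' (Real.rpow_pos_of_pos (hq j) _).ne', Real.log_rpow (hq j),
      log_scales hr]
  have k1 := hK 1
  have k2 := hK 2
  have k3 := hK 3
  have k4 := hK 4
  rw [Real.log_div (by positivity) hM.ne', Real.log_mul (by norm_num) hGc.ne', Real.log_pow,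
    Finset.sum_const, Finset.card_univ, Fintype.card_fin, nsmul_eq_mul] at h2
  rw [Real.log_div hlam.ne' hAc.ne'] at h1
  have h3 := h2.trans h1
  have c1 : (((1 : Fin 5) : ℕ) : ℝ) = 1 := by norm_num
  have c2 : (((2 : Fin 5) : ℕ) : ℝ) = 2 := by norm_num
  have c3 : (((3 : Fin 5) : ℕ) : ℝ) = 3 := by norm_num
  have c4 : (((4 : Fin 5) : ℕ) : ℝ) = 4 := by norm_num
  rw [c1] at k1
  rw [c2] at k2
  rw [c3] at k3
  rw [c4] at k4
  push_cast at h3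
  linarith


/-- for most `u`, most points of `G` have few points of `G` in their fine box at `u` -/
theorem exists_boxCount_bound (i : Fin 2) : ∃ E : ℝ, 1 ≤ E ∧ ∀ (ε ℓ α r Υ : ℝ), 0 < α → α < 9 →
    0 < r → 0 < Υ → 0 ≤ ℓ → E ≤ ε * ℓ → ∀ G : Finset (Fin 9 → ℝ),
    (∀ w ∈ G, ∑ y ∈ G, (max ‖y - w‖ (scales r ℓ 0)) ^ (-α) ≤ Υ) →
    volume {u ∈ uSq | Real.exp (-(ε * ℓ)) * G.card < ((G.filter fun w =>
      Υ * r ^ α * Real.exp (E * (ε * ℓ) - phiFn α * ℓ) < boxCount i G r ℓ u w).card : ℝ)} ≤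
      ENNReal.ofReal (4 * Real.exp (-(ε * ℓ))) := by
  obtain ⟨C₁, c, hC₁, hc, hgood⟩ := tupMeas_not_good_le i
  obtain ⟨C₂, hC₂, hpairs⟩ := exists_pair_count_bound i
  obtain ⟨C₃, hC₃, hent⟩ := exists_log_card_le i
  obtain ⟨n, hn⟩ : ∃ n : ℝ, n = Fintype.card (Fin 7 ↪ Fin 9) := ⟨_, rfl⟩
  have hn1 : 1 ≤ n := by
    have : 0 < Fintype.card (Fin 7 ↪ Fin 9) := Fintype.card_pos_iff.2 ⟨Fin.castLEEmb (by norm_num)⟩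
    rw [hn]
    exact_mod_cast this
  obtain ⟨κ, hκ, hκc⟩ : ∃ κ : ℝ, 0 < κ ∧ κ * c = 20 := ⟨20 / c, by positivity, by field_simp⟩
  have hl2 : 0 ≤ Real.log 2 := Real.log_nonneg (by norm_num)
  have hl3 : 0 ≤ Real.log 3 := Real.log_nonneg (by norm_num)
  have hln : 0 ≤ Real.log (n * C₂) := Real.log_nonneg (by nlinarith)
  refine ⟨(C₁ + 2) + (81 * Real.log 3 + 72 / 7 * Real.log 2 + 9 / 7 * Real.log (n * C₂) + C₃) +
    (72 / 7 * 18 + 9 / 7 * (14 * κ + 19) + C₃ * κ), ?_, ?_⟩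
  · have : 0 ≤ C₃ * κ := by positivity
    linarith
  intro ε ℓ α r Υ hα hα9 hr hΥ hℓ hE G hG
  obtain ⟨E₀, hE₀⟩ : ∃ E₀ : ℝ, E₀ =
    (C₁ + 2) + (81 * Real.log 3 + 72 / 7 * Real.log 2 + 9 / 7 * Real.log (n * C₂) + C₃) +
    (72 / 7 * 18 + 9 / 7 * (14 * κ + 19) + C₃ * κ) := ⟨_, rfl⟩
  rw [← hE₀] at hE ⊢
  obtain ⟨x, hx⟩ : ∃ x : ℝ, x = ε * ℓ := ⟨_, rfl⟩
  rw [← hx] at hE ⊢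
  have hC₃κ : 0 ≤ C₃ * κ := by positivity
  have hx1 : C₁ + 2 ≤ x := by linarith
  have hx1' : 1 ≤ x := by linarith
  rcases G.eq_empty_or_nonempty with rfl | hGn
  · simp
  have hN : (0 : ℝ) < G.card := by exact_mod_cast hGn.card_pos
  have hq := scales_pos hr ℓ
  have hqm := scales_mono hr hℓ
  obtain ⟨M, hM⟩ : ∃ M : ℝ, M = Υ * r ^ α * Real.exp (E₀ * x - phiFn α * ℓ) := ⟨_, rfl⟩
  have hM0 : 0 < M := by rw [hM]; positivity
  rw [← hM]
  by_contra hcon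
  rw [not_le] at hcon
  obtain ⟨β, hβ⟩ : ∃ β : ℝ, β = min α 7 := ⟨_, rfl⟩
  obtain ⟨X, hX⟩ : ∃ X : ℝ, X = G.card * (scales r ℓ 0 ^ β * scales r ℓ 1 ^ (α - β) * Υ) := ⟨_, rfl⟩
  have hX0 : 0 < X := by
    rw [hX]
    have := Real.rpow_pos_of_pos (hq 0) β
    have := Real.rpow_pos_of_pos (hq 1) (α - β)
    positivity
  obtain ⟨θ, hθ⟩ : ∃ θ : ℝ, θ = Real.exp (-(κ * x)) := ⟨_, rfl⟩
  have hθ0 : 0 < θ := by rw [hθ]; positivity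
  have hθ1 : θ ≤ 1 := by
    rw [hθ]
    exact Real.exp_le_one_iff.2 (by have : 0 ≤ κ * x := by positivity
                                    linarith)
  have hlθ : Real.log θ = -(κ * x) := by rw [hθ, Real.log_exp]
  obtain ⟨τ, hτ⟩ : ∃ τ : ℝ, τ = Real.exp (-x) := ⟨_, rfl⟩
  have hτ0 : 0 < τ := by rw [hτ]; positivity
  have hτ1 : τ ≤ 1 := by rw [hτ]; exact Real.exp_le_one_iff.2 (by linarith)
  have hlτ : Real.log τ = -x := by rw [hτ, Real.log_exp]
  rw [← hτ] at hcon
  obtain ⟨lam, hlam⟩ : ∃ lam : ℝ, lam = n * C₂ / θ ^ 14 * X / τ ^ 19 := ⟨_, rfl⟩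
  have hlam0 : 0 < lam := by rw [hlam]; positivity
  have hloglam : Real.log lam = Real.log (n * C₂) + 14 * (κ * x) + Real.log X + 19 * x := by
    rw [hlam, Real.log_div (by positivity) (by positivity), Real.log_mul (by positivity) hX0.ne',
      Real.log_div (by positivity) (by positivity), Real.log_pow, Real.log_pow, hlθ, hlτ]
    push_cast
    ring
  have hlogX : Real.log X = Real.log G.card + β * (Real.log r - 2 * ℓ) +
      (α - β) * (Real.log r - ℓ) + Real.log Υ := by
    have p0 := Real.rpow_pos_of_pos (hq 0) β
    have p1 := Real.rpow_pos_of_pos (hq 1) (α - β)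
    rw [hX, Real.log_mul hN.ne' (by positivity), Real.log_mul (by positivity) hΥ.ne',
      Real.log_mul p0.ne' p1.ne', Real.log_rpow (hq 0), Real.log_rpow (hq 1), log_scales hr,
      log_scales hr]
    norm_num
    ring
  have hlogM : Real.log M = Real.log Υ + α * Real.log r + (E₀ * x - phiFn α * ℓ) := by
    rw [hM, Real.log_mul (by positivity) (Real.exp_pos _).ne', Real.log_mul hΥ.ne' (by positivity),
      Real.log_rpow hr, Real.log_exp]
  let bad : (Fin 7 ↪ Fin 9) → Set (Fin 9 → ℝ × ℝ) := fun e => {U | Good i θ U ∧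
    lam < (((G ×ˢ G).filter fun p => ‖p.2 - p.1‖ ≤ scales r ℓ 1 ∧
      ∀ k, |(J i (U (e k)) *ᵥ (p.2 - p.1)) 0| ≤ scales r ℓ 0).card : ℝ)}
  have hbad : ∀ e, Sublevel.tupMeas 9 (bad e) ≤ ENNReal.ofReal (τ ^ 19 / n) := fun e => by
    refine (hpairs θ (scales r ℓ 0) (scales r ℓ 1) α Υ lam hθ0 hθ1 (hq 0) (hqm (Fin.zero_le 1))
      hlam0 G hG e).trans (ENNReal.ofReal_le_ofReal (le_of_eq ?_))
    rw [← hβ, ← hX, hlam]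
    field_simp
  have hB : Sublevel.tupMeas 9 ({U | ¬ Good i θ U} ∪ ⋃ e, bad e) ≤
      ENNReal.ofReal (C₁ * τ ^ 20 + τ ^ 19) := by
    refine (measure_union_le _ _).trans ?_
    rw [ENNReal.ofReal_add (by positivity) (by positivity)]
    refine add_le_add ((hgood θ hθ0 hθ1).trans (le_of_eq ?_)) ?_
    · congr 2
      rw [hθ, ← Real.exp_mul, hτ, ← Real.exp_nat_mul]
      congr 1
      push_cast
      linear_combination (-x) * hκc
    · refine (measure_iUnion_fintype_le _ _).trans ((Finset.sum_le_sum fun e _ => hbad e).trans ?_)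
      rw [Finset.sum_const, Finset.card_univ, nsmul_eq_mul, ← ENNReal.ofReal_natCast, ← hn,
        ← ENNReal.ofReal_mul (by positivity)]
      refine ENNReal.ofReal_le_ofReal (le_of_eq ?_)
      field_simp
  have hτC : (C₁ + 1) * τ < 1 := by
    rw [hτ, Real.exp_neg, ← div_eq_mul_inv, div_lt_one (Real.exp_pos _)]
    linarith [Real.add_one_le_exp x]
  obtain ⟨U, hU, hUB, hcard⟩ := Sublevel.exists_tuple_not_mem G
    (fun w => {u | M < (boxCount i G r ℓ u w : ℝ)})
    (fun w => measurableSet_lt_boxCount i G r ℓ M w) hτ0 hGn _ hB (by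
      have h1 : 0 < τ ^ 18 := by positivity
      have h2 : 0 < τ ^ 19 := by positivity
      have h3 : C₁ * τ ^ 20 ≤ C₁ * τ ^ 19 := by
        have := pow_le_pow_of_le_one hτ0.le hτ1 (show 19 ≤ 20 by norm_num)
        gcongr
      have h4 : (C₁ + 1) * τ * τ ^ 18 < 1 * τ ^ 18 := by gcongr
      have h5 : C₁ * τ ^ 19 + τ ^ 19 = (C₁ + 1) * τ * τ ^ 18 := by ring
      linarith) hcon
  rw [Set.mem_union, not_or, Set.mem_iUnion, not_exists] at hUB
  have hUg : Good i θ U := not_not.1 hUB.1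
  set A := G.filter fun w => ∀ p, U p ∈ {u | M < (boxCount i G r ℓ u w : ℝ)} with hA
  have hAc : (0 : ℝ) < A.card := lt_of_lt_of_le (by positivity) hcard
  have hAn : A.Nonempty := Finset.card_pos.1 (by exact_mod_cast hAc)
  have hlogA : Real.log G.card - Real.log 2 - 18 * x ≤ Real.log A.card := by
    have := Real.log_le_log (by positivity) hcard
    rw [Real.log_mul (by positivity) hN.ne', Real.log_div (by positivity) (by norm_num),
      Real.log_pow, hlτ] at this
    push_cast at this
    linarith
  have key := hent G A (Finset.filter_subset _ _) hAn r ℓ α Υ M lam θ U hr hℓ hα.le hM0 hθ0 hθ1 hΥ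
    hlam0 hG hU hUg (fun w hw p => ((Finset.mem_filter.1 hw).2 p).le)
    (fun e => le_of_not_gt fun h => hUB.2 e ⟨hUg, h⟩)
  rw [Real.log_inv, hlθ, hloglam, hlogX, hlogM] at key
  have hφ := mul_le_mul_of_nonneg_right (phiFn_le hα hα9) hℓ
  rw [← hβ] at hφ
  have hE₁ : E₀ * 1 ≤ E₀ * x := mul_le_mul_of_nonneg_left hx1' (by rw [hE₀]; linarith)
  have hE₂ : E₀ * x = (C₁ + 2) * x + (81 * Real.log 3 + 72 / 7 * Real.log 2 +
    9 / 7 * Real.log (n * C₂) + C₃) * x + (72 / 7 * 18 + 9 / 7 * (14 * κ + 19) + C₃ * κ) * x := by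
    rw [hE₀]; ring
  have hE₃ : 0 ≤ (C₁ + 2) * x := by positivity
  have hE₄ : (81 * Real.log 3 + 72 / 7 * Real.log 2 + 9 / 7 * Real.log (n * C₂) + C₃) * 1 ≤
      (81 * Real.log 3 + 72 / 7 * Real.log 2 + 9 / 7 * Real.log (n * C₂) + C₃) * x := by
    gcongr
  have hE₅ : 0 < (C₁ + 2) * x := by positivity
  have hE₆ : 0 ≤ E₀ * 1 := by rw [hE₀]; linarith
  linarith


/-- coefficients of the upper right entry of `u z u⁻¹`, as a polynomial in the parameters of `u` -/
noncomputable def coeffs (i : Fin 2) : M4 →ₗ[ℝ] Fin 9 → ℝ where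
  toFun z := if i = 0 then ![z 0 3, z 1 3 - z 0 2, z 2 3 - z 0 1, -z 1 2,
      z 0 0 + z 3 3 - z 1 1 - z 2 2, -z 2 1, z 1 0 - z 3 2, z 2 0 - z 3 1, z 3 0]
    else ![z 0 3, z 1 3 - z 0 1, z 2 3 - z 0 2, (z 0 0 + z 3 3) / 2 - z 1 1, -z 1 2 - z 2 1,
      (z 0 0 + z 3 3) / 2 - z 2 2, (z 1 0 - z 3 1) / 2, (z 2 0 - z 3 2) / 2, z 3 0 / 4]
  map_add' x y := by
    split_ifs <;> ext m <;> fin_cases m <;> simp <;> ring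
  map_smul' c x := by
    split_ifs <;> ext m <;> fin_cases m <;> simp <;> ring

lemma abs_apply_le_mnorm (z : M4) (j k : Fin 4) : |z j k| ≤ mnorm z :=
  le_ciSup (f := fun p : Fin 4 × Fin 4 => |z p.1 p.2|) (Set.finite_range _).bddAbove (j, k)

lemma mnorm_nonneg (z : M4) : 0 ≤ mnorm z := (abs_nonneg _).trans (abs_apply_le_mnorm z 0 0)

lemma mnorm_le {z : M4} {C : ℝ} (h : ∀ j k, |z j k| ≤ C) : mnorm z ≤ C :=
  ciSup_le fun p => h p.1 p.2

lemma mnorm_sub_le (x y : M4) : mnorm (x - y) ≤ mnorm x + mnorm y :=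
  mnorm_le fun j k => (abs_sub _ _).trans
    (add_le_add (abs_apply_le_mnorm x j k) (abs_apply_le_mnorm y j k))

lemma abs_coeffs_le (i : Fin 2) (z : M4) (m : Fin 9) : |coeffs i z m| ≤ 4 * mnorm z := by
  have h : ∀ j k, -mnorm z ≤ z j k ∧ z j k ≤ mnorm z := fun j k =>
    abs_le.1 (abs_apply_le_mnorm z j k)
  have h0 := mnorm_nonneg z
  rw [abs_le]
  fin_cases i <;> fin_cases m <;> simp [coeffs] <;> constructor <;>
    linarith [h 0 0, h 0 1, h 0 2, h 0 3, h 1 0, h 1 1, h 1 2, h 1 3, h 2 0, h 2 1, h 2 2, h 2 3,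
      h 3 0, h 3 1, h 3 2, h 3 3]

lemma uMat_mul (i : Fin 2) (r s : ℝ) : uMat i r s * uMat i (-r) (-s) = 1 := by
  fin_cases i <;> ext j k <;> fin_cases j <;> fin_cases k <;>
    simp [uMat, Matrix.mul_apply, Fin.sum_univ_four] <;> ring

lemma uMat_inv (i : Fin 2) (r s : ℝ) : (uMat i r s)⁻¹ = uMat i (-r) (-s) :=
  Matrix.inv_eq_right_inv (uMat_mul i r s)

lemma aMat_inv (t : ℝ) : (aMat t)⁻¹ = aMat (-t) := by
  refine Matrix.inv_eq_right_inv ?_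
  unfold aMat
  rw [Matrix.diagonal_mul_diagonal, ← Matrix.diagonal_one]
  congr 1
  ext j
  fin_cases j <;> simp [← Real.exp_add]

lemma mul_mul_apply_four (x y z : M4) (j k : Fin 4) : (x * y * z) j k =
    (x j 0 * y 0 0 + x j 1 * y 1 0 + x j 2 * y 2 0 + x j 3 * y 3 0) * z 0 k +
    (x j 0 * y 0 1 + x j 1 * y 1 1 + x j 2 * y 2 1 + x j 3 * y 3 1) * z 1 k +
    (x j 0 * y 0 2 + x j 1 * y 1 2 + x j 2 * y 2 2 + x j 3 * y 3 2) * z 2 k +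
    (x j 0 * y 0 3 + x j 1 * y 1 3 + x j 2 * y 2 3 + x j 3 * y 3 3) * z 3 k := by
  simp only [Matrix.mul_apply, Fin.sum_univ_four]

lemma J_mulVec_coeffs (i : Fin 2) (r s : ℝ) (z : M4) :
    J i (r, s) *ᵥ coeffs i z = coeffs i (uMat i r s * z * uMat i (-r) (-s)) := by
  rw [J, jet_mulVec]
  ext m
  fin_cases i <;> fin_cases m <;> simp [coeffs, mul_mul_apply_four] <;> simp [uMat] <;> ring1

/-- the weights of the coefficients under the diagonal flow -/
lemma coeffs_aMat (i : Fin 2) (t : ℝ) (y : M4) (m : Fin 9) :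
    coeffs i (aMat t * y * aMat (-t)) m =
      ![Real.exp (2 * t), Real.exp t, Real.exp t, 1, 1, 1, Real.exp (-t), Real.exp (-t),
        Real.exp (-(2 * t))] m * coeffs i y m := by
  have h1 : Real.exp (2 * t) = Real.exp t * Real.exp t := by rw [← Real.exp_add]; ring_nf
  have h2 : Real.exp (-(2 * t)) = Real.exp (-t) * Real.exp (-t) := by rw [← Real.exp_add]; ring_nf
  have h3 : Real.exp t * Real.exp (-t) = 1 := by rw [← Real.exp_add]; simp
  rw [h1, h2]
  fin_cases i <;> fin_cases m <;>
    simp [coeffs, aMat, Matrix.mul_diagonal, Matrix.diagonal_mul] <;>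
    first | ring1 | linear_combination (y 0 0 + y 3 3) * h3

/-- the jet at `u` is controlled by the image under the diagonal flow -/
lemma abs_J_coeffs_le (i : Fin 2) (ℓ r s ρ : ℝ) (z : M4)
    (h : mnorm (Adm (aMat ℓ * uMat i r s) z) ≤ ρ) (m : Fin 9) :
    |(J i (r, s) *ᵥ coeffs i z) m| ≤ boxScale (scales (4 * ρ) ℓ) m := by
  have h1 : Adm (aMat ℓ * uMat i r s) z =
      aMat ℓ * (uMat i r s * z * uMat i (-r) (-s)) * aMat (-ℓ) := by
    unfold Adm
    rw [Matrix.mul_inv_rev, uMat_inv, aMat_inv]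
    simp only [Matrix.mul_assoc]
  have h2 := abs_coeffs_le i (Adm (aMat ℓ * uMat i r s) z) m
  rw [h1, coeffs_aMat, ← J_mulVec_coeffs, ← h1, abs_mul] at h2
  have h3 := h2.trans (mul_le_mul_of_nonneg_left h (by norm_num))
  have key : ∀ t x : ℝ, |Real.exp t| * x ≤ 4 * ρ → x ≤ 4 * ρ * Real.exp (-t) := fun t x hx => by
    rw [abs_of_pos (Real.exp_pos t), mul_comm] at hx
    rw [Real.exp_neg, ← div_eq_mul_inv, le_div_iff₀ (Real.exp_pos t)]
    exact hx
  have e0 : ∀ t x : ℝ, |Real.exp t| * x ≤ 4 * ρ → ∀ w, w = -t → x ≤ 4 * ρ * Real.exp w :=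
    fun t x hx w hw => hw ▸ key t x hx
  have c2 : (((2 : Fin 5) : ℕ) : ℝ) = 2 := by norm_num
  have c3 : (((3 : Fin 5) : ℕ) : ℝ) = 3 := by norm_num
  have c4 : (((4 : Fin 5) : ℕ) : ℝ) = 4 := by norm_num
  unfold boxScale scales
  rw [c2, c3, c4]
  clear h2
  fin_cases m
  · exact e0 _ _ h3 _ (by simp)
  · exact e0 _ _ h3 _ (by norm_num)
  · exact e0 _ _ h3 _ (by norm_num)
  · exact e0 0 _ (by simpa using h3) _ (by norm_num)
  · exact e0 0 _ (by simpa using h3) _ (by norm_num)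
  · exact e0 0 _ (by simpa using h3) _ (by norm_num)
  · exact e0 _ _ h3 _ (by ring)
  · exact e0 _ _ h3 _ (by ring)
  · exact e0 _ _ h3 _ (by ring)

set_option maxHeartbeats 1000000 in
/-- on `𝔯ᵢ` the coefficients control the norm -/
lemma mnorm_le_coeffs (i : Fin 2) {z : M4} (hz : z ∈ rSpace i) : mnorm z ≤ 4 * ‖coeffs i z‖ := by
  have hy : ∀ m, |coeffs i z m| ≤ ‖coeffs i z‖ := fun m => norm_le_pi_norm (coeffs i z) m
  obtain ⟨ht, hs⟩ := Submodule.mem_inf.1 hz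
  have ht : z 0 0 + z 1 1 + z 2 2 + z 3 3 = 0 := by
    have : z.trace = 0 := ht
    simpa [Matrix.trace, Fin.sum_univ_four] using this
  have hs : z * Qmat i = Qmat i * zᵀ := by
    have hdet : IsUnit (Qmat i).det := by
      refine Matrix.isUnit_det_of_right_inverse
        (B := (if i = 0 then (4 : ℝ) else 1) • Qmat i) ?_
      fin_cases i <;> ext j k <;> fin_cases j <;> fin_cases k <;> simp [Qmat] <;> norm_num
    have h1 : -(Qmat i * zᵀ * (Qmat i)⁻¹) + z = 0 := hs
    rw [neg_add_eq_zero] at h1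
    calc z * Qmat i = Qmat i * zᵀ * (Qmat i)⁻¹ * Qmat i := by rw [h1]
      _ = Qmat i * zᵀ := by
        rw [Matrix.mul_assoc, Matrix.nonsing_inv_mul _ hdet, Matrix.mul_one]
  have hs : ∀ j k, (z * Qmat i) j k = (Qmat i * zᵀ) j k := fun j k => by rw [hs]
  obtain ⟨c, hc⟩ : ∃ c, c = ‖coeffs i z‖ := ⟨_, rfl⟩
  have hy : ∀ m, -c ≤ coeffs i z m ∧ coeffs i z m ≤ c := fun m => abs_le.1 (hc ▸ hy m)
  rw [← hc]
  refine mnorm_le fun j k => ?_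
  have h01 := hs 0 1
  have h02 := hs 0 2
  have h03 := hs 0 3
  have h12 := hs 1 2
  have h13 := hs 1 3
  have h23 := hs 2 3
  have y0 := hy 0
  have y1 := hy 1
  have y2 := hy 2
  have y3 := hy 3
  have y4 := hy 4
  have y5 := hy 5
  have y6 := hy 6
  have y7 := hy 7
  have y8 := hy 8
  clear hc hz hs hy
  rw [abs_le]
  fin_cases i <;>
    simp [Qmat, coeffs, Matrix.mul_apply, Fin.sum_univ_four]
      at h01 h02 h03 h12 h13 h23 y0 y1 y2 y3 y4 y5 y6 y7 y8 <;>
    fin_cases j <;> fin_cases k <;> simp <;> constructor <;> linarith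


/-- dyadic decomposition of a sum of truncated inverse powers -/
lemma sum_rpow_neg_le_of_card_le {ι : Type*} (T : Finset ι) (d : ι → ℝ) {α A η : ℝ} (hα : 0 ≤ α)
    (hη : 0 < η) (K : ℕ) (hK : ∀ x ∈ T, d x ≤ 2 ^ K * η)
    (hA : ∀ k ≤ K, ((T.filter fun x => d x ≤ 2 ^ k * η).card : ℝ) ≤ A * (2 ^ k * η) ^ α) :
    ∑ x ∈ T, (max (d x) η) ^ (-α) ≤ (K + 1) * (A * 2 ^ α) := by
  have h2 : ∀ k : ℕ, 0 < 2 ^ k * η := fun k => by positivity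
  have hx : ∀ x ∈ T, (max (d x) η) ^ (-α) ≤
      ∑ k ∈ Finset.range (K + 1), if d x ≤ 2 ^ k * η then (2 ^ k * η / 2) ^ (-α) else 0 := by
    intro x hx
    have hex : ∃ k, d x ≤ 2 ^ k * η := ⟨K, hK x hx⟩
    obtain ⟨k, hk, hmin⟩ : ∃ k, d x ≤ 2 ^ k * η ∧ ∀ j < k, ¬ d x ≤ 2 ^ j * η :=
      ⟨Nat.find hex, Nat.find_spec hex, fun j hj => Nat.find_min hex hj⟩
    have hkK : k ≤ K := not_lt.1 fun h => hmin K h (hK x hx)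
    have hle : 2 ^ k * η / 2 ≤ max (d x) η := by
      cases k with
      | zero => exact le_max_of_le_right (by rw [pow_zero]; linarith)
      | succ j =>
        refine le_max_of_le_left ?_
        have := not_le.1 (hmin j (Nat.lt_succ_self j))
        rw [pow_succ]
        linarith
    have h3 : (max (d x) η) ^ (-α) ≤ (2 ^ k * η / 2) ^ (-α) :=
      Real.rpow_le_rpow_of_nonpos (half_pos (h2 k)) hle (by linarith)
    refine h3.trans ?_
    have h4 := Finset.single_le_sum
      (f := fun k => if d x ≤ 2 ^ k * η then (2 ^ k * η / 2) ^ (-α) else 0)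
      (s := Finset.range (K + 1)) (fun j _ => by
        split_ifs
        · exact Real.rpow_nonneg (half_pos (h2 j)).le _
        · exact le_rfl) (Finset.mem_range.2 (Nat.lt_succ_of_le hkK))
    simpa only [if_pos hk] using h4
  refine (Finset.sum_le_sum hx).trans ?_
  rw [Finset.sum_comm]
  have hk : ∀ k ∈ Finset.range (K + 1),
      (∑ x ∈ T, if d x ≤ 2 ^ k * η then (2 ^ k * η / 2) ^ (-α) else 0) ≤ A * 2 ^ α := by
    intro k hk
    rw [← Finset.sum_filter, Finset.sum_const, nsmul_eq_mul]
    refine (mul_le_mul_of_nonneg_right (hA k (Nat.lt_succ_iff.1 (Finset.mem_range.1 hk)))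
      (Real.rpow_nonneg (half_pos (h2 k)).le _)).trans (le_of_eq ?_)
    rw [Real.div_rpow (h2 k).le zero_le_two, Real.rpow_neg (h2 k).le, Real.rpow_neg zero_le_two]
    have := Real.rpow_pos_of_pos (h2 k) α
    field_simp
  refine (Finset.sum_le_sum hk).trans (le_of_eq ?_)
  rw [Finset.sum_const, Finset.card_range, nsmul_eq_mul]
  push_cast
  ring

lemma energy_image_le (α η : ℝ) (hη : 0 ≤ η) (T : Finset M4) (f : M4 → M4) (w : M4) :
    energy α η (T.image f) (f w) ≤ ∑ w' ∈ T, (max (mnorm (f w' - f w)) η) ^ (-α) := by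
  have hn : ∀ y : M4, 0 ≤ (max (mnorm (y - f w)) η) ^ (-α) := fun y =>
    Real.rpow_nonneg (le_max_of_le_right hη) _
  unfold energy
  refine (Finset.sum_le_sum_of_subset_of_nonneg (Finset.erase_subset _ _)
    fun y _ _ => hn y).trans ?_
  rw [← Finset.sum_fiberwise_of_maps_to (s := T) (t := T.image f) (g := f)
    (fun x hx => Finset.mem_image_of_mem f hx)]
  refine Finset.sum_le_sum fun y hy => ?_
  obtain ⟨x, hx, rfl⟩ := Finset.mem_image.1 hy
  exact Finset.single_le_sum (f := fun w' => (max (mnorm (f w' - f w)) η) ^ (-α))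
    (fun w' _ => hn (f w')) (Finset.mem_filter.2 ⟨hx, rfl⟩)

lemma coeffs_injOn (i : Fin 2) {F : Finset M4} (hF : ∀ w ∈ F, w ∈ rSpace i) :
    Set.InjOn (coeffs i) F := by
  intro x hx y hy h
  have h1 := mnorm_le_coeffs i (Submodule.sub_mem _ (hF x hx) (hF y hy))
  rw [map_sub, h, sub_self, norm_zero, mul_zero] at h1
  ext j k
  have h2 := abs_nonpos_iff.1 ((abs_apply_le_mnorm (x - y) j k).trans h1)
  exact sub_eq_zero.1 h2

lemma rpow_neg_max_le {a b c e α κ : ℝ} (hα : 0 ≤ α) (hκ : 1 ≤ κ) (hb : 0 < b) (hac : a ≤ κ * c)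
    (hbe : b ≤ e) : (max c e) ^ (-α) ≤ κ ^ α * (max a b) ^ (-α) := by
  have hm : 0 < max a b := lt_max_of_lt_right hb
  have hκ0 : 0 < κ := by linarith
  have h1 : max a b / κ ≤ max c e := by
    rw [div_le_iff₀ hκ0, mul_comm]
    refine max_le (hac.trans (mul_le_mul_of_nonneg_left (le_max_left _ _) hκ0.le)) ?_
    have : 0 ≤ max c e := hb.le.trans (hbe.trans (le_max_right _ _))
    nlinarith [hbe.trans (le_max_right c e)]
  refine (Real.rpow_le_rpow_of_nonpos (div_pos hm hκ0) h1 (by linarith)).trans (le_of_eq ?_)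
  rw [Real.div_rpow hm.le hκ0.le, Real.rpow_neg hκ0.le, div_inv_eq_mul, mul_comm]

/-- the number of points is controlled by the energy -/
lemma card_le_energy {α δ Υ : ℝ} (hα : 0 < α) (hδ : 0 < δ) (hδ1 : δ < 1) {F : Finset M4}
    (hF : ∀ w ∈ F, mnorm w ≤ 1) (hN : 2 ≤ (F.card : ℝ)) {w : M4} (hw : w ∈ F)
    (hE : energy α δ F w ≤ Υ) : (F.card : ℝ) ≤ 2 * (2 ^ α * Υ) := by
  have h1 : ((F.erase w).card : ℝ) * (2 : ℝ) ^ (-α) ≤ energy α δ F w := by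
    unfold energy
    rw [← nsmul_eq_mul, ← Finset.sum_const]
    refine Finset.sum_le_sum fun x hx => ?_
    refine Real.rpow_le_rpow_of_nonpos (lt_max_of_lt_right hδ) (max_le ?_ (by linarith))
      (by linarith)
    exact (mnorm_sub_le _ _).trans (by linarith [hF x (Finset.mem_of_mem_erase hx), hF w hw])
  rw [Finset.card_erase_of_mem hw, Nat.cast_sub (Finset.card_pos.2 ⟨w, hw⟩),
    Real.rpow_neg zero_le_two, ← div_eq_mul_inv] at h1
  have h2 : (0 : ℝ) < 2 ^ α := by positivity
  have h3 := (div_le_iff₀ h2).1 (h1.trans hE)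
  push_cast at h3
  linarith

/-- the energy of the set of coefficients -/
lemma sum_coeffs_le (i : Fin 2) {α δ Υ η : ℝ} (hα : 0 < α) (hα9 : α < 9) (hδ : 0 < δ)
    (hδ1 : δ < 1) (hΥ : 0 < Υ)
    {F : Finset M4} (hF : ∀ w ∈ F, w ∈ rSpace i ∧ mnorm w ≤ 1) (hN : 2 ≤ (F.card : ℝ))
    (hE : ∀ w ∈ F, energy α δ F w ≤ Υ) (hη : max δ ((F.card : ℝ) ^ (-1 / α)) ≤ η) :
    ∀ v ∈ F.image (coeffs i), ∑ y ∈ F.image (coeffs i), (max ‖y - v‖ η) ^ (-α) ≤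
      3 * 4 ^ 9 * Υ := by
  intro v hv
  obtain ⟨w, hw, rfl⟩ := Finset.mem_image.1 hv
  have hη0 : 0 < η := hδ.trans_le ((le_max_left _ _).trans hη)
  rw [Finset.sum_image (coeffs_injOn i fun w hw => (hF w hw).1), ← Finset.sum_erase_add _ _ hw,
    sub_self, norm_zero, max_eq_right hη0.le]
  have hN0 : (0 : ℝ) < F.card := by linarith
  have h1 : η ^ (-α) ≤ F.card := by
    refine (Real.rpow_le_rpow_of_nonpos (Real.rpow_pos_of_pos hN0 _)
      ((le_max_right _ _).trans hη) (by linarith)).trans (le_of_eq ?_)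
    rw [← Real.rpow_mul hN0.le]
    have : -1 / α * -α = 1 := by field_simp
    rw [this, Real.rpow_one]
  have h2 := card_le_energy hα hδ hδ1 (fun w hw => (hF w hw).2) hN hw (hE w hw)
  have h3 : ∑ x ∈ F.erase w, (max ‖coeffs i x - coeffs i w‖ η) ^ (-α) ≤ 4 ^ α * Υ := by
    refine le_trans ?_ (mul_le_mul_of_nonneg_left (hE w hw) (by positivity))
    unfold energy
    rw [Finset.mul_sum]
    refine Finset.sum_le_sum fun x hx => ?_
    refine rpow_neg_max_le hα.le (by norm_num) hδ ?_ ((le_max_left _ _).trans hη)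
    rw [← map_sub]
    exact mnorm_le_coeffs i
      (Submodule.sub_mem _ (hF x (Finset.mem_of_mem_erase hx)).1 (hF w hw).1)
  have h4 : (2 : ℝ) ^ α ≤ 4 ^ (9 : ℕ) := by
    rw [← Real.rpow_natCast]
    exact (Real.rpow_le_rpow zero_le_two (by norm_num) hα.le).trans
      (Real.rpow_le_rpow_of_exponent_le (by norm_num) (by exact_mod_cast hα9.le))
  have h5 : (4 : ℝ) ^ α ≤ 4 ^ (9 : ℕ) := by
    rw [← Real.rpow_natCast]
    exact Real.rpow_le_rpow_of_exponent_le (by norm_num) (by exact_mod_cast hα9.le)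
  have h6 := mul_le_mul_of_nonneg_right h4 hΥ.le
  have h7 := mul_le_mul_of_nonneg_right h5 hΥ.le
  linarith

lemma Adm_sub (g x y : M4) : Adm g x - Adm g y = Adm g (x - y) := by
  simp only [Adm, Matrix.mul_sub, Matrix.sub_mul]

/-- points close after the action of `a_ℓ u` lie in a common box -/
lemma card_close_le_boxCount (i : Fin 2) {F T : Finset M4} (hF : ∀ w ∈ F, w ∈ rSpace i)
    (hT : T ⊆ F) (ℓ ρ : ℝ) (u : ℝ × ℝ) (w : M4) :
    (T.filter fun w' => mnorm (Adm (aMat ℓ * uMat i u.1 u.2) w' -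
      Adm (aMat ℓ * uMat i u.1 u.2) w) ≤ ρ).card ≤
      boxCount i (F.image (coeffs i)) (4 * ρ) ℓ u (coeffs i w) := by
  unfold boxCount
  rw [← Finset.card_image_of_injOn (f := coeffs i) (s := T.filter _)
    ((coeffs_injOn i hF).mono fun x hx => hT (Finset.mem_filter.1 (Finset.mem_coe.1 hx)).1)]
  refine Finset.card_le_card fun y hy => ?_
  obtain ⟨x, hx, rfl⟩ := Finset.mem_image.1 hy
  obtain ⟨hxT, hx⟩ := Finset.mem_filter.1 hx
  refine Finset.mem_filter.2 ⟨Finset.mem_image_of_mem _ (hT hxT), fun m => ?_⟩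
  rw [← map_sub]
  rw [Adm_sub] at hx
  exact abs_J_coeffs_le i ℓ u.1 u.2 ρ _ hx m


lemma phiFn_le_self {α : ℝ} (h0 : 0 < α) (h9 : α < 9) : phiFn α ≤ α := by
  have h1 := phiFn_le h0 h9
  have h2 : min α 7 ≤ α := min_le_left _ _
  linarith

lemma abs_log_le {δ : ℝ} (h0 : 0 < δ) (h1 : δ < 1) : |Real.log δ| = -Real.log δ :=
  abs_of_neg (Real.log_neg h0 h1)

/-- when `e^{-ℓ} ≤ δ` the energy after expansion is trivially small -/
lemma energy_le_of_large {α δ Υ ℓ η : ℝ} (hα : 0 < α) (hα9 : α < 9) (hδ : 0 < δ) (hδ1 : δ < 1)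
    (hΥ : 0 < Υ) (hℓ : Real.exp (-ℓ) ≤ δ) (hη : Real.exp (2 * ℓ) * δ ≤ η) {F T : Finset M4}
    (hF : ∀ w ∈ F, mnorm w ≤ 1) (hN : 2 ≤ (F.card : ℝ)) {w : M4} (hw : w ∈ F)
    (hE : energy α δ F w ≤ Υ) (hT : T ⊆ F) (f : M4 → M4) (v : M4) :
    energy α η (T.image f) (f v) ≤ 2 ^ 10 * Real.exp (-(phiFn α * ℓ)) * Υ := by
  have hη0 : Real.exp ℓ ≤ η := by
    refine le_trans ?_ ((mul_le_mul_of_nonneg_left hℓ (Real.exp_pos _).le).trans hη)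
    rw [← Real.exp_add]
    exact Real.exp_le_exp.2 (by linarith)
  have hηp : 0 < η := (Real.exp_pos _).trans_le hη0
  have hℓ0 : 0 ≤ ℓ := by
    have := Real.exp_lt_one_iff.1 (hℓ.trans_lt hδ1)
    linarith
  refine (energy_image_le α η hηp.le T f v).trans ?_
  have h1 : ∀ x ∈ T, (max (mnorm (f x - f v)) η) ^ (-α) ≤ Real.exp (-(phiFn α * ℓ)) := by
    intro x _
    refine (Real.rpow_le_rpow_of_nonpos (Real.exp_pos ℓ) (hη0.trans (le_max_right _ _))
      (by linarith)).trans ?_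
    rw [← Real.exp_mul]
    refine Real.exp_le_exp.2 ?_
    have := mul_le_mul_of_nonneg_right (phiFn_le_self hα hα9) hℓ0
    linarith
  refine (Finset.sum_le_card_nsmul _ _ _ h1).trans ?_
  rw [nsmul_eq_mul]
  have h2 : (T.card : ℝ) ≤ F.card := by exact_mod_cast Finset.card_le_card hT
  have h3 := h2.trans (card_le_energy hα hδ hδ1 hF hN hw hE)
  have h4 : (2 : ℝ) ^ α ≤ 2 ^ (9 : ℕ) := by
    rw [← Real.rpow_natCast]
    exact Real.rpow_le_rpow_of_exponent_le (by norm_num) (by exact_mod_cast hα9.le)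
  have h5 := mul_le_mul_of_nonneg_right h4 hΥ.le
  have h6 : (T.card : ℝ) ≤ 2 ^ 10 * Υ := by linarith
  refine (mul_le_mul_of_nonneg_right h6 (Real.exp_pos _).le).trans (le_of_eq (by ring))

/-- the number of dyadic scales between `δ` and `1` -/
lemma exists_scale_count {L : ℝ} (hL : 1 ≤ L) :
    ∃ K : ℕ, (K : ℝ) + 1 ≤ 4 * L ∧ Real.exp L ≤ 2 ^ K := by
  refine ⟨⌈2 * L⌉₊, ?_, ?_⟩
  · have := Nat.ceil_lt_add_one (show (0 : ℝ) ≤ 2 * L by linarith)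
    linarith
  · have h1 := Nat.le_ceil (2 * L)
    have h2 := Real.log_two_gt_d9
    rw [← Real.rpow_natCast, Real.rpow_def_of_pos zero_lt_two]
    refine Real.exp_le_exp.2 ?_
    nlinarith

lemma le_inv_sqrt_mul_exp {ε L : ℝ} (hε : 0 < ε) :
    L ≤ 1 / √ε * Real.exp (√ε * L) := by
  have h := Real.sqrt_pos.2 hε
  rw [one_div, inv_mul_eq_div, le_div_iff₀ h]
  linarith [Real.add_one_le_exp (√ε * L)]

lemma card_filter_coeffs_le (i : Fin 2) {F : Finset M4} (hF : ∀ w ∈ F, w ∈ rSpace i)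
    (P : (Fin 9 → ℝ) → Prop) :
    (F.filter fun w => P (coeffs i w)).card ≤ ((F.image (coeffs i)).filter P).card := by
  rw [← Finset.card_image_of_injOn (f := coeffs i) (s := F.filter _)
    ((coeffs_injOn i hF).mono fun x hx => (Finset.mem_filter.1 (Finset.mem_coe.1 hx)).1)]
  refine Finset.card_le_card fun y hy => ?_
  obtain ⟨x, hx, rfl⟩ := Finset.mem_image.1 hy
  obtain ⟨hxF, hx⟩ := Finset.mem_filter.1 hx
  exact Finset.mem_filter.2 ⟨Finset.mem_image_of_mem _ hxF, hx⟩

lemma card_sdiff_filter_le {ι : Type*} [DecidableEq ι] (F : Finset ι) (K : ℕ)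
    (P : ℕ → ι → Prop) {c : ℝ}
    (h : ∀ k < K, ((F.filter (P k)).card : ℝ) ≤ c) :
    ((F \ F.filter fun w => ∀ k < K, ¬ P k w).card : ℝ) ≤ K * c := by
  have h1 : F \ F.filter (fun w => ∀ k < K, ¬ P k w) ⊆
      (Finset.range K).biUnion fun k => F.filter (P k) := by
    intro w hw
    obtain ⟨hwF, hw⟩ := Finset.mem_sdiff.1 hw
    rw [Finset.mem_filter] at hw
    push Not at hw
    obtain ⟨k, hk, hP⟩ := hw hwF
    exact Finset.mem_biUnion.2 ⟨k, Finset.mem_range.2 hk, Finset.mem_filter.2 ⟨hwF, hP⟩⟩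
  have h2 := (Finset.card_le_card h1).trans Finset.card_biUnion_le
  refine (Nat.cast_le.2 h2).trans ?_
  push_cast
  refine (Finset.sum_le_sum fun k hk => h k (Finset.mem_range.1 hk)).trans (le_of_eq ?_)
  rw [Finset.sum_const, Finset.card_range, nsmul_eq_mul]

lemma mU_iUnion_le (K : ℕ) (S : ℕ → Set (ℝ × ℝ)) {τ : ℝ} (hτ : 0 ≤ τ)
    (h : ∀ k < K, volume (S k) ≤ ENNReal.ofReal (4 * τ)) {B : Set (ℝ × ℝ)}
    (hB : ∀ u ∈ B, ∃ k < K, u ∈ S k) : mU B ≤ ENNReal.ofReal (K * τ) := by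
  have h1 : B ⊆ ⋃ k ∈ Finset.range K, S k := fun u hu => by
    obtain ⟨k, hk, hu⟩ := hB u hu
    exact Set.mem_biUnion (Finset.mem_coe.2 (Finset.mem_range.2 hk)) hu
  have h2 : volume B ≤ K * ENNReal.ofReal (4 * τ) := by
    refine (measure_mono h1).trans ((measure_biUnion_finset_le _ _).trans ?_)
    refine (Finset.sum_le_sum fun k hk => h k (Finset.mem_range.1 hk)).trans (le_of_eq ?_)
    rw [Finset.sum_const, Finset.card_range, nsmul_eq_mul]
  unfold mU
  refine ENNReal.div_le_of_le_mul (h2.trans (le_of_eq ?_))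
  rw [← ENNReal.ofReal_natCast, ← ENNReal.ofReal_mul (by positivity),
    show (4 : ENNReal) = ENNReal.ofReal 4 by simp, ← ENNReal.ofReal_mul (by positivity)]
  congr 1
  ring


/-- the improved energy estimate when the expansion is short compared with the scale `δ` -/
lemma exists_improvement (i : Fin 2) : ∃ E : ℝ, 1 ≤ E ∧ ∀ ε α δ Υ ℓ L : ℝ, 0 < α → α < 9 →
    0 < δ → δ < 1 → 0 < Υ → 0 ≤ ℓ → E ≤ ε * ℓ → 1 ≤ L → L = -Real.log δ → ∀ F : Finset M4,
    (∀ w ∈ F, w ∈ rSpace i ∧ mnorm w ≤ 1) → 2 ≤ (F.card : ℝ) → (∀ w ∈ F, energy α δ F w ≤ Υ) →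
    ∃ J ⊆ uSq, mU (uSq \ J) ≤ ENNReal.ofReal (4 * L * Real.exp (-(ε * ℓ))) ∧
      ∀ p ∈ J, ∃ Fu ⊆ F,
        ((F \ Fu).card : ℝ) ≤ 4 * L * Real.exp (-(ε * ℓ)) * F.card ∧
        ∀ w ∈ Fu,
          energy α (Real.exp (2*ℓ) * max δ ((F.card : ℝ) ^ (-1/α)))
            ((Fu.filter (fun w' =>
                mnorm (Adm (aMat ℓ * uMat i p.1 p.2) w' - Adm (aMat ℓ * uMat i p.1 p.2) w)
                  ≤ Real.exp (-(2*ℓ)))).image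
              (fun w' => Adm (aMat ℓ * uMat i p.1 p.2) w'))
            (Adm (aMat ℓ * uMat i p.1 p.2) w)
          ≤ 4 * L * (3 * 4 ^ 9 * 8 ^ 9 * Υ * Real.exp (E * (ε * ℓ) - phiFn α * ℓ)) := by
  obtain ⟨E, hE1, hcore⟩ := exists_boxCount_bound i
  refine ⟨E, hE1, fun ε α δ Υ ℓ L hα hα9 hδ hδ1 hΥ hℓ hεℓ hL hLδ F hF hN hen => ?_⟩
  obtain ⟨K, hK, hKL⟩ := exists_scale_count hL
  obtain ⟨η₀, hη₀⟩ : ∃ η, η = max δ ((F.card : ℝ) ^ (-1 / α)) := ⟨_, rfl⟩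
  obtain ⟨η, hη⟩ : ∃ η, η = Real.exp (2 * ℓ) * η₀ := ⟨_, rfl⟩
  obtain ⟨τ, hτ⟩ : ∃ τ, τ = Real.exp (-(ε * ℓ)) := ⟨_, rfl⟩
  have hη₀δ : δ ≤ η₀ := hη₀ ▸ le_max_left _ _
  have hηp : 0 < η := hη ▸ mul_pos (Real.exp_pos _) (hδ.trans_le hη₀δ)
  have hτ0 : 0 < τ := hτ ▸ Real.exp_pos _
  have hFr : ∀ w ∈ F, w ∈ rSpace i := fun w hw => (hF w hw).1
  obtain ⟨G, hG⟩ : ∃ G, G = F.image (coeffs i) := ⟨_, rfl⟩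
  have hGF : G.card = F.card := hG ▸ Finset.card_image_of_injOn (coeffs_injOn i hFr)
  obtain ⟨C, hC⟩ : ∃ C, C = 3 * 4 ^ 9 * Υ := ⟨_, rfl⟩
  have hC0 : 0 < C := by rw [hC]; positivity
  have hr : ∀ k : ℕ, 0 < 4 * (2 ^ k * η) := fun k => by positivity
  obtain ⟨M, hM⟩ : ∃ M : ℕ → ℝ, M = fun k => C * (4 * (2 ^ k * η)) ^ α *
    Real.exp (E * (ε * ℓ) - phiFn α * ℓ) := ⟨_, rfl⟩
  obtain ⟨S, hS⟩ : ∃ S : ℕ → Set (ℝ × ℝ), S = fun k => {u ∈ uSq | τ * G.card <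
      ((G.filter fun w => M k < boxCount i G (4 * (2 ^ k * η)) ℓ u w).card : ℝ)} := ⟨_, rfl⟩
  have hvol : ∀ k < K + 1, volume (S k) ≤ ENNReal.ofReal (4 * τ) := by
    intro k _
    have h := hcore ε ℓ α (4 * (2 ^ k * η)) C hα hα9 (hr k) hC0 hℓ hεℓ G ?_
    · simpa only [hS, hM, hτ] using h
    · have hsc : η₀ ≤ scales (4 * (2 ^ k * η)) ℓ 0 := by
        have e1 : scales (4 * (2 ^ k * η)) ℓ 0 =
            4 * 2 ^ k * (Real.exp (2 * ℓ) * Real.exp ((((0 : Fin 5) : ℕ) - 2) * ℓ)) * η₀ := by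
          rw [hη]
          unfold scales
          ring
        have e2 : (2 : ℝ) * ℓ + (((0 : Fin 5) : ℕ) - 2) * ℓ = 0 := by simp
        rw [e1, ← Real.exp_add, e2, Real.exp_zero]
        have : (1 : ℝ) ≤ 2 ^ k := one_le_pow₀ one_le_two
        nlinarith [hδ.trans_le hη₀δ]
      rw [hG, hC]
      exact sum_coeffs_le i hα hα9 hδ hδ1 hΥ hF hN hen (hη₀ ▸ hsc)
  have hKc : ((K + 1 : ℕ) : ℝ) ≤ 4 * L := by push_cast; exact hK
  refine ⟨{u ∈ uSq | ∀ k < K + 1, u ∉ S k}, fun u hu => hu.1, ?_, fun u hu => ?_⟩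
  · refine (mU_iUnion_le (K + 1) S hτ0.le hvol fun u hu => ?_).trans
      (ENNReal.ofReal_le_ofReal ?_)
    · by_contra hcon
      push Not at hcon
      exact hu.2 ⟨hu.1, hcon⟩
    · rw [hτ.symm]
      exact mul_le_mul_of_nonneg_right hKc hτ0.le
  · rw [← hτ, ← hη₀, ← hη]
    obtain ⟨huS, hu⟩ := hu
    refine ⟨F.filter fun w => ∀ k < K + 1,
      ¬ M k < boxCount i G (4 * (2 ^ k * η)) ℓ u (coeffs i w), Finset.filter_subset _ _,
      ?_, fun w hw => ?_⟩
    · refine (card_sdiff_filter_le F (K + 1)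
        (fun k w => M k < boxCount i G (4 * (2 ^ k * η)) ℓ u (coeffs i w)) (c := τ * F.card)
        fun k hk => ?_).trans ?_
      · have h1 := card_filter_coeffs_le i hFr
          fun v => M k < boxCount i G (4 * (2 ^ k * η)) ℓ u v
        rw [← hG] at h1
        refine (Nat.cast_le.2 h1).trans ?_
        have h2 := hu k hk
        rw [hS] at h2
        rw [← hGF]
        exact not_lt.1 fun h => h2 ⟨huS, h⟩
      · rw [mul_assoc (4 * L)]
        exact mul_le_mul_of_nonneg_right hKc (by positivity)
    · obtain ⟨Fu, hFu⟩ : ∃ Fu, Fu = F.filter fun w => ∀ k < K + 1,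
        ¬ M k < boxCount i G (4 * (2 ^ k * η)) ℓ u (coeffs i w) := ⟨_, rfl⟩
      rw [← hFu] at hw ⊢
      have hFuF : Fu ⊆ F := hFu ▸ Finset.filter_subset _ _
      have hw2 : ∀ k < K + 1, (boxCount i G (4 * (2 ^ k * η)) ℓ u (coeffs i w) : ℝ) ≤ M k := by
        intro k hk
        rw [hFu] at hw
        exact not_lt.1 ((Finset.mem_filter.1 hw).2 k hk)
      refine (energy_image_le α η hηp.le _ _ w).trans ?_
      refine (sum_rpow_neg_le_of_card_le _ _
        (A := C * 4 ^ α * Real.exp (E * (ε * ℓ) - phiFn α * ℓ)) hα.le hηp K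
        (fun x hx => ?_) fun k hk => ?_).trans ?_
      · refine (Finset.mem_filter.1 hx).2.trans ?_
        have h1 : Real.exp L * δ = 1 := by
          rw [hLδ, Real.exp_neg, Real.exp_log hδ, inv_mul_cancel₀ hδ.ne']
        have h2 : 1 ≤ 2 ^ K * η₀ := h1 ▸ mul_le_mul hKL hη₀δ hδ.le (by positivity)
        have h3 : Real.exp (-(2 * ℓ)) ≤ Real.exp (2 * ℓ) := Real.exp_le_exp.2 (by linarith)
        rw [hη]
        nlinarith [Real.exp_pos (2 * ℓ)]
      · have h1 := card_close_le_boxCount i (T := Fu.filter fun w' =>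
          mnorm (Adm (aMat ℓ * uMat i u.1 u.2) w' - Adm (aMat ℓ * uMat i u.1 u.2) w) ≤
            Real.exp (-(2 * ℓ))) hFr ((Finset.filter_subset _ _).trans hFuF) ℓ (2 ^ k * η) u w
        rw [← hG] at h1
        refine (Nat.cast_le.2 h1).trans ((hw2 k (Nat.lt_succ_of_le hk)).trans (le_of_eq ?_))
        simp only [hM]
        rw [Real.mul_rpow (by norm_num) (by positivity)]
        ring
      · refine mul_le_mul hK ?_ (by positivity) (by linarith)
        have h8 : (4 : ℝ) ^ α * 2 ^ α ≤ 8 ^ 9 := by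
          rw [← Real.mul_rpow (by norm_num) (by norm_num), ← Real.rpow_natCast,
            show (4 : ℝ) * 2 = 8 by norm_num]
          exact Real.rpow_le_rpow_of_exponent_le (by norm_num) hα9.le
        have h9 := mul_le_mul_of_nonneg_left h8
          (mul_pos hC0 (Real.exp_pos (E * (ε * ℓ) - phiFn α * ℓ))).le
        rw [hC] at h9 ⊢
        linarith

end Jet

/-- Theorem 1.? : energy improvement under expansion.
For fixed i, there is an absolute constant E ≥ 1 and, for every ε, constants N_ε, C_ε ≥ 1
depending only on ε, such that for every α ∈ (0,9) with ε ∈ (0, 10^{-10}α), every δ ∈ (0,1),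
Υ > 0 and finite F ⊆ B^{𝔯ᵢ}_1(0) with #F ≥ N_ε whose modified α-energies are ≤ Υ,
and every ℓ ≥ N_ε, there is J ⊆ 𝖡₁ᵁ with small complement such that for u ∈ J there is a
large subset F_u ⊆ F whose localized energies after applying a_ℓ u improve by e^{-φ(α)ℓ}. -/
theorem stmt2 (i : Fin 2) :
    ∃ E : ℝ, 1 ≤ E ∧
    ∀ ε : ℝ, 0 < ε →
    ∃ Nε Cε : ℝ, 1 ≤ Nε ∧ 1 ≤ Cε ∧
    ∀ α : ℝ, α ∈ Set.Ioo (0:ℝ) 9 → ε < α / 10 ^ 10 →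
    ∀ δ : ℝ, δ ∈ Set.Ioo (0:ℝ) 1 →
    ∀ Υ : ℝ, 0 < Υ →
    ∀ F : Finset M4,
      (∀ w ∈ F, w ∈ rSpace i ∧ mnorm w ≤ 1) →
      Nε ≤ (F.card : ℝ) →
      (∀ w ∈ F, energy α δ F w ≤ Υ) →
    ∀ ℓ : ℝ, Nε ≤ ℓ →
    ∃ J ⊆ uSq,
      mU (uSq \ J) ≤ ENNReal.ofReal (Cε * |Real.log δ| * Real.exp (-(ε * ℓ))) ∧
      ∀ p ∈ J, ∃ Fu ⊆ F,
        ((F \ Fu).card : ℝ) ≤ Cε * |Real.log δ| * Real.exp (-(ε * ℓ)) * F.card ∧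
        ∀ w ∈ Fu,
          energy α (Real.exp (2*ℓ) * max δ ((F.card : ℝ) ^ (-1/α)))
            ((Fu.filter (fun w' =>
                mnorm (Adm (aMat ℓ * uMat i p.1 p.2) w' - Adm (aMat ℓ * uMat i p.1 p.2) w)
                  ≤ Real.exp (-(2*ℓ)))).image
              (fun w' => Adm (aMat ℓ * uMat i p.1 p.2) w'))
            (Adm (aMat ℓ * uMat i p.1 p.2) w)
          ≤ Cε * Real.exp (-(phiFn α * ℓ)) * δ ^ (-(E * Real.sqrt ε)) * Υ := by
  obtain ⟨E, hE1, himp⟩ := Jet.exists_improvement i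
  refine ⟨E + 1, by linarith, fun ε hε => ?_⟩
  have hsq := Real.sqrt_pos.2 hε
  obtain ⟨D, hD⟩ : ∃ D : ℝ, D = 4 * (3 * 4 ^ 9 * 8 ^ 9) / √ε := ⟨_, rfl⟩
  have hD0 : 0 < D := by rw [hD]; positivity
  have hEε : 0 < E / ε := by positivity
  refine ⟨2 + E / ε, 2 ^ 10 + D, by linarith, by linarith, ?_⟩
  intro α ⟨hα, hα9⟩ hεα δ ⟨hδ, hδ1⟩ Υ hΥ F hF hN hen ℓ hℓ
  have hε1 : ε ≤ 1 := by linarith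
  have hεsq : ε ≤ √ε := by
    nlinarith [Real.sq_sqrt hε.le, Real.sqrt_le_one.2 hε1]
  have hN2 : 2 ≤ (F.card : ℝ) := by linarith
  rw [Jet.abs_log_le hδ hδ1]
  obtain ⟨L, hL⟩ : ∃ L, L = -Real.log δ := ⟨_, rfl⟩
  have hL0 : 0 < L := hL ▸ neg_pos.2 (Real.log_neg hδ hδ1)
  have hpow : δ ^ (-((E + 1) * √ε)) = Real.exp ((E + 1) * √ε * L) := by
    rw [Real.rpow_def_of_pos hδ, hL]
    congr 1
    ring
  rw [← hL, hpow]
  have hexp1 : 1 ≤ Real.exp ((E + 1) * √ε * L) := Real.one_le_exp (by positivity)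
  have hC4 : (4 : ℝ) ≤ 2 ^ 10 + D := by linarith
  rcases le_or_gt L ℓ with hLℓ | hLℓ
  · refine ⟨uSq, subset_rfl, by simp [mU], fun p _ => ⟨F, subset_rfl, ?_, fun w hw => ?_⟩⟩
    · rw [Finset.sdiff_self, Finset.card_empty, Nat.cast_zero]
      positivity
    · have h1 : Real.exp (-ℓ) ≤ δ := by
        rw [← Real.exp_log hδ]
        exact Real.exp_le_exp.2 (by linarith)
      refine (Jet.energy_le_of_large hα hα9 hδ hδ1 hΥ h1
        (mul_le_mul_of_nonneg_left (le_max_left _ _) (Real.exp_pos _).le) (fun w hw => (hF w hw).2)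
        hN2 hw (hen w hw) (Finset.filter_subset _ _) _ _).trans ?_
      refine mul_le_mul_of_nonneg_right ?_ hΥ.le
      rw [mul_assoc]
      refine mul_le_mul (by linarith) ?_ (Real.exp_pos _).le (by linarith)
      exact le_mul_of_one_le_right (Real.exp_pos _).le hexp1
  · have hℓε : E ≤ ε * ℓ := by
      have := (div_le_iff₀ hε).1 (show E / ε ≤ ℓ by linarith)
      linarith
    obtain ⟨J, hJ, hJm, hJp⟩ := himp ε α δ Υ ℓ L hα hα9 hδ hδ1 hΥ (by linarith) hℓε (by linarith)
      hL F hF hN2 hen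
    have hτ := Real.exp_pos (-(ε * ℓ))
    refine ⟨J, hJ, hJm.trans (ENNReal.ofReal_le_ofReal ?_), fun p hp => ?_⟩
    · gcongr
    · obtain ⟨Fu, hFu, hcard, hfin⟩ := hJp p hp
      refine ⟨Fu, hFu, hcard.trans (by gcongr), fun w hw => (hfin w hw).trans ?_⟩
      have h1 : E * (ε * ℓ) ≤ E * √ε * L := by
        rw [mul_assoc]
        exact mul_le_mul_of_nonneg_left
          (mul_le_mul hεsq hLℓ.le (by linarith) hsq.le) (by linarith)
      have h2 : Real.exp (E * (ε * ℓ) - phiFn α * ℓ) ≤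
          Real.exp (E * √ε * L) * Real.exp (-(phiFn α * ℓ)) := by
        rw [← Real.exp_add]
        exact Real.exp_le_exp.2 (by linarith)
      have h3 : Real.exp ((E + 1) * √ε * L) = Real.exp (E * √ε * L) * Real.exp (√ε * L) := by
        rw [← Real.exp_add]
        ring_nf
      have h4 := Jet.le_inv_sqrt_mul_exp (L := L) hε
      calc 4 * L * (3 * 4 ^ 9 * 8 ^ 9 * Υ * Real.exp (E * (ε * ℓ) - phiFn α * ℓ))
          ≤ 4 * (1 / √ε * Real.exp (√ε * L)) * (3 * 4 ^ 9 * 8 ^ 9 * Υ *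
            (Real.exp (E * √ε * L) * Real.exp (-(phiFn α * ℓ)))) := by gcongr
        _ = D * Real.exp (-(phiFn α * ℓ)) * Real.exp ((E + 1) * √ε * L) * Υ := by
          rw [h3, hD]
          ring
        _ ≤ _ := by
          gcongr
          linarith
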